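/- Let N be a positive integer and i ∈ {0, 1, …, N−1}. Suppose K is a compact interval with non-empty interior contained in Λ = {x ∈ ℝ : lim_{j→∞} discr X_{jN+i}(x) exists and is negative}. Assume lim_{j→∞} a_{(j+1)N+i−1}/a_{jN+i−1} = 1 and that (X_{jN+i} restricted to K : j ∈ ℕ) belongs to 𝒟_1(K, GL(2,ℝ)); let 𝒳 be the uniform limit on K of (X_{jN+i}). Then there exists a probability measure ν on ℝ such that ∫ p_n p_m dν = δ_{nm} for all n, m ≥ 0, the restriction of ν to K is absolutely continuous with respect to Lebesgue measure with a density w that is continuous and strictly positive on K, and there exist c > 0, M ∈ ℕ and a continuous function η : K → ℝ such that for all k ≥ M and x ∈ K, discr X_{kN+i}(x) < 0 and | √(a_{(k+1)N+i−1}) · p_{kN+i}(x) − √( 2 |[𝒳(x)]_{2,1}| / (π w(x) √(−discr 𝒳(x))) ) · sin( ∑_{j=M+1}^k θ_{jN+i}(x) + η(x) ) | ≤ c · ∑_{j=k}^∞ sup_{y∈K} ‖X_{(j+1)N+i}(y) − X_{jN+i}(y)‖, where θ_n(x) = arccos( tr X_n(x) / (2 √(det X_n(x))) ). -/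

import Mathlib

open Filter Topology MeasureTheory Real

attribute [local instance] Matrix.normedAddCommGroup

noncomputable section

abbrev Mat2 := Matrix (Fin 2) (Fin 2) ℝ

/-- The transfer matrix `B_n(x)` built from the Jacobi parameters `(a_n)`, `(b_n)`. -/
def Bmat (a b : ℕ → ℝ) (n : ℕ) (x : ℝ) : Mat2 :=
  !![0, 1; -(a (n - 1)) / a n, (x - b n) / a n]

/-- Product in decreasing index order: `prodD C n0 len = C (n0+len-1) ⋯ C n0`. -/
def prodD (C : ℕ → Mat2) (n0 : ℕ) : ℕ → Mat2
  | 0 => 1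
  | (len + 1) => C (n0 + len) * prodD C n0 len

/-- `N`-step transfer matrix `X_n(x) = B_{n+N-1}(x) ⋯ B_n(x)`. -/
def Xmat (a b : ℕ → ℝ) (N n : ℕ) (x : ℝ) : Mat2 :=
  prodD (fun j => Bmat a b j x) n N

/-- Discriminant of a `2×2` matrix. -/
def discr (M : Mat2) : ℝ := (Matrix.trace M) ^ 2 - 4 * M.det

/-- The orthonormal polynomials `p_n` associated to `(a_n)`, `(b_n)`. -/
def opoly (a b : ℕ → ℝ) : ℕ → ℝ → ℝ
  | 0 => fun _ => 1
  | 1 => fun x => (x - b 0) / a 0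
  | (n + 2) => fun x =>
      ((x - b (n + 1)) * opoly a b (n + 1) x - a n * opoly a b n x) / a (n + 1)

/-- `θ_n(x) = arccos( tr X_n(x) / (2 √(det X_n(x))) )`. -/
def thetaf (a b : ℕ → ℝ) (N n : ℕ) (x : ℝ) : ℝ :=
  Real.arccos (Matrix.trace (Xmat a b N n x) / (2 * Real.sqrt (Xmat a b N n x).det))



/-- Complexified orthonormal polynomials. -/
def copoly (a b : ℕ → ℝ) : ℕ → ℂ → ℂ
  | 0 => fun _ => 1
  | 1 => fun z => (z - b 0) / a 0
  | (n + 2) => fun z =>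
      ((z - b (n + 1)) * copoly a b (n + 1) z - a n * copoly a b n z) / a (n + 1)

lemma copoly_ofReal (a b : ℕ → ℝ) (x : ℝ) : ∀ n, copoly a b n (x : ℂ) = (opoly a b n x : ℂ)
  | 0 => by simp [copoly, opoly]
  | 1 => by simp [copoly, opoly]
  | (n + 2) => by
      simp only [copoly, opoly, copoly_ofReal a b x n, copoly_ofReal a b x (n + 1)]
      push_cast; rfl

lemma copoly_diff (a b : ℕ → ℝ) : ∀ n, Differentiable ℂ (copoly a b n)
  | 0 => by simp only [copoly]; fun_prop
  | 1 => by simp only [copoly]; fun_prop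
  | (n + 2) => by
      have h1 := copoly_diff a b n
      have h2 := copoly_diff a b (n + 1)
      simp only [copoly]; fun_prop

lemma opoly_cont (a b : ℕ → ℝ) : ∀ n, Continuous (opoly a b n)
  | 0 => by simp only [opoly]; fun_prop
  | 1 => by simp only [opoly]; fun_prop
  | (n + 2) => by
      have h1 := opoly_cont a b n
      have h2 := opoly_cont a b (n + 1)
      simp only [opoly]; fun_prop

def kapp (a : ℕ → ℝ) (n : ℕ) : ℂ := ∏ j ∈ Finset.range n, (1 / (a j : ℂ))

lemma kapp_ne (a : ℕ → ℝ) (ha : ∀ n, 0 < a n) (n : ℕ) : kapp a n ≠ 0 := by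
  unfold kapp
  rw [Finset.prod_ne_zero_iff]
  intro j _
  have : (a j : ℂ) ≠ 0 := by exact_mod_cast (ha j).ne'
  simp [this]

lemma inv_cobounded : Tendsto (fun z : ℂ => z⁻¹) (Bornology.cobounded ℂ) (𝓝 0) :=
  tendsto_inv₀_cobounded

lemma ne_zero_cobounded : ∀ᶠ z : ℂ in Bornology.cobounded ℂ, z ≠ 0 := by
  have : Tendsto (fun z : ℂ => ‖z‖) (Bornology.cobounded ℂ) atTop := tendsto_norm_cobounded_atTop
  filter_upwards [this.eventually (eventually_gt_atTop 0)] with z hz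
  exact norm_pos_iff.mp hz

lemma copoly_asymp (a b : ℕ → ℝ) : ∀ n,
    Tendsto (fun z => copoly a b n z / z ^ n) (Bornology.cobounded ℂ) (𝓝 (kapp a n))
  | 0 => by simp [copoly, kapp]
  | 1 => by
      have h : Tendsto (fun z : ℂ => (1 - b 0 * z⁻¹) * (1 / (a 0 : ℂ))) (Bornology.cobounded ℂ)
          (𝓝 ((1 - b 0 * 0) * (1 / (a 0 : ℂ)))) :=
        ((inv_cobounded.const_mul _).const_sub _).mul_const _
      have h2 : kapp a 1 = (1 - b 0 * 0) * (1 / (a 0 : ℂ)) := by simp [kapp]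
      rw [h2]
      refine h.congr' ?_
      filter_upwards [ne_zero_cobounded] with z hz
      simp only [copoly]; field_simp
  | (n + 2) => by
      have h1 := copoly_asymp a b n
      have h2 := copoly_asymp a b (n + 1)
      have h : Tendsto (fun z : ℂ => ((1 - b (n + 1) * z⁻¹) * (copoly a b (n + 1) z / z ^ (n + 1))
          - a n * (z⁻¹ * z⁻¹) * (copoly a b n z / z ^ n)) * (1 / (a (n + 1) : ℂ)))
          (Bornology.cobounded ℂ)
          (𝓝 (((1 - b (n + 1) * 0) * kapp a (n + 1) - a n * (0 * 0) * kapp a n) *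
            (1 / (a (n + 1) : ℂ)))) :=
        ((((inv_cobounded.const_mul _).const_sub _).mul h2).sub
          (((inv_cobounded.mul inv_cobounded).const_mul _).mul h1)).mul_const _
      have h3 : kapp a (n + 2) = ((1 - b (n + 1) * 0) * kapp a (n + 1) -
          a n * (0 * 0) * kapp a n) * (1 / (a (n + 1) : ℂ)) := by
        simp [kapp, Finset.prod_range_succ]; ring
      rw [h3]
      refine h.congr' ?_
      filter_upwards [ne_zero_cobounded] with z hz
      simp only [copoly]
      by_cases h0 : (a (n + 1) : ℂ) = 0
      · simp [h0]
      field_simp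
      ring

lemma cauchy_line (f : ℂ → ℂ) (hd : ∀ z : ℂ, 0 ≤ z.im → DifferentiableAt ℂ f z)
    (hb : f =O[Bornology.cobounded ℂ] fun z => (‖z‖ ^ 2)⁻¹) :
    Integrable (fun x : ℝ => f x) ∧ ∫ x : ℝ, f x = 0 := by
  obtain ⟨C, hC0, hC⟩ := hb.exists_pos
  rw [Asymptotics.isBigOWith_iff, ← comap_norm_atTop, Filter.eventually_comap,
    Filter.eventually_atTop] at hC
  obtain ⟨R, hR⟩ := hC
  have hR' : ∀ z : ℂ, R ≤ ‖z‖ → ‖f z‖ ≤ C * (‖z‖ ^ 2)⁻¹ := by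
    intro z hz
    have := hR _ hz z rfl
    simpa using this
  have hcont : Continuous fun x : ℝ => f x := by
    rw [continuous_iff_continuousAt]
    intro x
    have := (hd x (by simp)).continuousAt
    exact ContinuousAt.comp (f := fun x : ℝ => (x : ℂ)) this Complex.continuous_ofReal.continuousAt
  have hIntg : Integrable (fun x : ℝ => f x) := by
    set R1 := max R 1 with hR1
    obtain ⟨B, hB⟩ := (isCompact_Icc (a := -R1) (b := R1)).exists_bound_of_continuousOn
      hcont.continuousOn
    refine Integrable.mono' ((integrable_inv_one_add_sq).const_mul (B * (1 + R1 ^ 2) + 2 * C))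
      hcont.aestronglyMeasurable ?_
    refine Filter.Eventually.of_forall fun x => ?_
    have hB0 : 0 ≤ B := le_trans (norm_nonneg _) (hB 0 (by
      constructor <;> [skip; skip] <;> linarith [le_max_right R 1]))
    have hx1 : 0 < 1 + x ^ 2 := by positivity
    rw [← div_eq_mul_inv, le_div_iff₀ hx1]
    by_cases hx : |x| ≤ R1
    · have h1 := hB x (abs_le.mp hx)
      have h2 : x ^ 2 ≤ R1 ^ 2 := by
        rw [← sq_abs]; gcongr
      have : ‖f x‖ * (1 + x ^ 2) ≤ B * (1 + R1 ^ 2) := by gcongr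
      linarith
    · push Not at hx
      have h1 := hR' x (by
        rw [Complex.norm_real, Real.norm_eq_abs]; exact (le_max_left R 1).trans hx.le)
      rw [Complex.norm_real, Real.norm_eq_abs, sq_abs] at h1
      have hx2 : 1 ≤ x ^ 2 := by
        rw [← sq_abs]; nlinarith [le_max_right R 1]
      have : ‖f x‖ * (1 + x ^ 2) ≤ C * (x ^ 2)⁻¹ * (1 + x ^ 2) := by gcongr
      have h3 : C * (x ^ 2)⁻¹ * (1 + x ^ 2) ≤ 2 * C := by
        rw [mul_assoc, inv_mul_eq_div]
        have : (1 + x ^ 2) / x ^ 2 ≤ 2 := by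
          rw [div_le_iff₀ (by linarith)]; linarith
        nlinarith
      nlinarith [mul_nonneg hB0 (by positivity : 0 ≤ 1 + R1 ^ 2)]
  refine ⟨hIntg, ?_⟩
  have h1 : Tendsto (fun T : ℝ => ∫ x in (-T)..T, f x) atTop (𝓝 (∫ x : ℝ, f x)) :=
    intervalIntegral_tendsto_integral hIntg tendsto_neg_atTop_atBot tendsto_id
  have h2 : Tendsto (fun T : ℝ => ∫ x in (-T)..T, f x) atTop (𝓝 0) := by
    rw [tendsto_zero_iff_norm_tendsto_zero]
    have hlim : Tendsto (fun T : ℝ => 4 * C * T⁻¹) atTop (𝓝 0) := by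
      simpa using tendsto_inv_atTop_zero.const_mul (4 * C)
    refine squeeze_zero' (Eventually.of_forall fun _ => norm_nonneg _) ?_ hlim
    filter_upwards [eventually_ge_atTop R, eventually_gt_atTop 0] with T hTR hT0
    have hrect := Complex.integral_boundary_rect_eq_zero_of_differentiableOn f (-T : ℂ)
      (T + T * Complex.I) (by
        intro z hz
        apply DifferentiableAt.differentiableWithinAt
        apply hd
        have := hz.2
        simp only [Set.mem_preimage] at this
        simp at this
        rw [Set.uIcc_of_le hT0.le] at this
        exact this.1)
    simp only [Complex.neg_re, Complex.ofReal_re, Complex.neg_im, Complex.ofReal_im, Complex.add_re,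
      Complex.mul_re, Complex.I_re, Complex.I_im, Complex.add_im, Complex.mul_im] at hrect
    simp only [mul_zero, zero_mul, sub_zero, add_zero, mul_one, zero_add, neg_zero,
      Complex.ofReal_zero] at hrect
    have hnorm : ∀ x y : ℝ, T ≤ |x| ∨ T ≤ |y| → ‖f (x + y * Complex.I)‖ ≤ C * (T ^ 2)⁻¹ := by
      intro x y h
      have hT : T ≤ ‖(x + y * Complex.I : ℂ)‖ := by
        rcases h with h | h
        · refine h.trans ?_
          simpa using Complex.abs_re_le_norm (x + y * Complex.I : ℂ)
        · refine h.trans ?_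
          simpa using Complex.abs_im_le_norm (x + y * Complex.I : ℂ)
      refine (hR' _ (hTR.trans hT)).trans ?_
      gcongr
    have e1 : ‖∫ x in (-T)..T, f (x + T * Complex.I)‖ ≤ C * (T ^ 2)⁻¹ * |T - (-T)| :=
      intervalIntegral.norm_integral_le_of_norm_le_const fun x _ =>
        hnorm x T (Or.inr (le_abs_self T))
    have e2 : ‖∫ y in (0:ℝ)..T, f (T + y * Complex.I)‖ ≤ C * (T ^ 2)⁻¹ * |T - 0| :=
      intervalIntegral.norm_integral_le_of_norm_le_const fun y _ =>
        hnorm T y (Or.inl (le_abs_self T))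
    have e3 : ‖∫ y in (0:ℝ)..T, f (((-T : ℝ) : ℂ) + y * Complex.I)‖ ≤ C * (T ^ 2)⁻¹ * |T - 0| :=
      intervalIntegral.norm_integral_le_of_norm_le_const fun y _ =>
        hnorm (-T) y (Or.inl (by rw [abs_neg]; exact le_abs_self T))
    have key : (∫ x in (-T)..T, f x) = (∫ x in (-T)..T, f (x + T * Complex.I))
        - Complex.I • (∫ y in (0:ℝ)..T, f (T + y * Complex.I))
        + Complex.I • (∫ y in (0:ℝ)..T, f (((-T : ℝ) : ℂ) + y * Complex.I)) := by
      linear_combination hrect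
    rw [key]
    refine (norm_add_le _ _).trans ?_
    have := norm_sub_le (∫ x in (-T)..T, f (x + T * Complex.I))
      (Complex.I • (∫ y in (0:ℝ)..T, f (T + y * Complex.I)))
    rw [norm_smul, Complex.norm_I, one_mul] at this ⊢
    have e4 : |T - (-T)| = 2 * T := by rw [abs_of_pos] <;> linarith
    have e5 : |T - 0| = T := by rw [abs_of_pos] <;> linarith
    rw [e4] at e1
    rw [e5] at e2 e3
    have e6 : 4 * C * T⁻¹ = C * (T ^ 2)⁻¹ * (2 * T) + C * (T ^ 2)⁻¹ * T + C * (T ^ 2)⁻¹ * T := by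
      field_simp; ring
    linarith
  exact tendsto_nhds_unique h1 h2



lemma copoly_im (a b : ℕ → ℝ) (ha : ∀ n, 0 < a n) (z : ℂ) (hz : 0 < z.im) : ∀ n,
    0 < (copoly a b (n + 1) z * (starRingEnd ℂ) (copoly a b n z)).im
  | 0 => by
      simp only [copoly, map_one, mul_one]
      rw [Complex.div_ofReal_im]
      have : (z - (b 0 : ℂ)).im = z.im := by simp
      rw [this]; exact div_pos hz (ha 0)
  | (n + 1) => by
      have ih := copoly_im a b ha z hz n
      set p := copoly a b n z
      set q := copoly a b (n + 1) z with hq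
      have e : copoly a b (n + 1 + 1) z = ((z - b (n + 1)) * q - a n * p) / a (n + 1) := rfl
      rw [e, div_mul_eq_mul_div, Complex.div_ofReal_im]
      apply div_pos _ (ha _)
      simp only [Complex.mul_im, Complex.mul_re, Complex.sub_re, Complex.sub_im, Complex.ofReal_re,
        Complex.ofReal_im, Complex.conj_re, Complex.conj_im] at ih ⊢
      have h1 : 0 ≤ z.im * (q.re ^ 2 + q.im ^ 2) := by positivity
      have h2 := mul_pos (ha n) ih
      nlinarith

lemma opoly_ne (a b : ℕ → ℝ) (ha : ∀ n, 0 < a n) (x : ℝ) : ∀ n,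
    0 < opoly a b n x ^ 2 + opoly a b (n + 1) x ^ 2
  | 0 => by simp only [opoly]; positivity
  | (n + 1) => by
      have ih := opoly_ne a b ha x n
      by_contra hcon
      have h1 : opoly a b (n + 1) x = 0 := by nlinarith [sq_nonneg (opoly a b (n + 1) x), sq_nonneg (opoly a b (n + 1 + 1) x)]
      have h2 : opoly a b (n + 1 + 1) x = 0 := by nlinarith [sq_nonneg (opoly a b (n + 1) x), sq_nonneg (opoly a b (n + 1 + 1) x)]
      have e : opoly a b (n + 1 + 1) x = ((x - b (n + 1)) * opoly a b (n + 1) x - a n * opoly a b n x) / a (n + 1) := rfl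
      rw [e, div_eq_zero_iff, or_iff_left (ha _).ne', h1] at h2
      have h3 : opoly a b n x = 0 := by
        have := (ha n).ne'
        simpa [this] using h2
      rw [h1, h3] at ih
      simp at ih

/-- The Jost-type function. -/
def EE (a b : ℕ → ℝ) (n : ℕ) (z : ℂ) : ℂ := copoly a b (n + 1) z + Complex.I * copoly a b n z

lemma EE_ne (a b : ℕ → ℝ) (ha : ∀ n, 0 < a n) (n : ℕ) (z : ℂ) (hz : 0 ≤ z.im) :
    EE a b n z ≠ 0 := by
  intro h
  unfold EE at h
  have h1 : copoly a b (n + 1) z = - Complex.I * copoly a b n z := by linear_combination h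
  rcases hz.lt_or_eq with hz | hz
  · have := copoly_im a b ha z hz n
    rw [h1] at this
    simp at this
    nlinarith [sq_nonneg (copoly a b n z).re, sq_nonneg (copoly a b n z).im]
  · have e : z = (z.re : ℂ) := by apply Complex.ext <;> simp [hz.symm]
    rw [e] at h
    rw [copoly_ofReal, copoly_ofReal] at h
    have h2 := opoly_ne a b ha z.re n
    have r := congrArg Complex.re h
    have s := congrArg Complex.im h
    simp at r s
    rw [r, s] at h2
    simp at h2

lemma EE_asymp (a b : ℕ → ℝ) (n : ℕ) :
    Tendsto (fun z => EE a b n z / z ^ (n + 1)) (Bornology.cobounded ℂ) (𝓝 (kapp a (n + 1))) := by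
  have h := (copoly_asymp a b (n + 1)).add
    ((inv_cobounded.mul (copoly_asymp a b n)).const_mul Complex.I)
  have e : kapp a (n + 1) + Complex.I * (0 * kapp a n) = kapp a (n + 1) := by ring
  rw [e] at h
  refine h.congr' ?_
  filter_upwards [ne_zero_cobounded] with z hz
  simp only [EE]
  field_simp
  ring

lemma isBigO_ratio (f g : ℂ → ℂ) (m d : ℕ) (c k : ℂ) (hk : k ≠ 0) (hd : m + 2 ≤ d)
    (hf : Tendsto (fun z => f z / z ^ m) (Bornology.cobounded ℂ) (𝓝 c))
    (hg : Tendsto (fun z => g z / z ^ d) (Bornology.cobounded ℂ) (𝓝 k)) :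
    (fun z => f z / g z) =O[Bornology.cobounded ℂ] fun z => (‖z‖ ^ 2)⁻¹ := by
  have h1 := (hf.div hg hk).isBigO_one ℝ
  have h2 : (fun z : ℂ => z ^ m / z ^ d) =O[Bornology.cobounded ℂ] fun z => (‖z‖ ^ 2)⁻¹ := by
    apply Asymptotics.IsBigO.of_bound 1
    have : Tendsto (fun z : ℂ => ‖z‖) (Bornology.cobounded ℂ) atTop := tendsto_norm_cobounded_atTop
    filter_upwards [this.eventually (eventually_ge_atTop 1)] with z hz
    rw [norm_div, norm_pow, norm_pow, one_mul, Real.norm_of_nonneg (by positivity),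
      div_le_iff₀ (by positivity), inv_mul_eq_div, le_div_iff₀ (by positivity), ← pow_add]
    exact pow_le_pow_right₀ hz hd
  have h3 := h1.mul h2
  simp only [one_mul] at h3
  refine Asymptotics.IsBigO.congr' h3 ?_ EventuallyEq.rfl
  filter_upwards [ne_zero_cobounded] with z hz
  simp only [Pi.div_apply]
  by_cases hgz : g z = 0
  · simp [hgz]
  field_simp

/-- Carmona density. -/
def carm (a b : ℕ → ℝ) (n : ℕ) (x : ℝ) : ℝ :=
  1 / (π * a n * (opoly a b n x ^ 2 + opoly a b (n + 1) x ^ 2))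

def HasInt (f : ℝ → ℝ) (c : ℝ) : Prop := Integrable f ∧ ∫ x, f x = c

lemma HasInt.add {f g : ℝ → ℝ} {c d : ℝ} (hf : HasInt f c) (hg : HasInt g d) :
    HasInt (fun x => f x + g x) (c + d) :=
  ⟨hf.1.add hg.1, by rw [integral_add hf.1 hg.1, hf.2, hg.2]⟩

lemma HasInt.smul {f : ℝ → ℝ} {c : ℝ} (r : ℝ) (hf : HasInt f c) :
    HasInt (fun x => r * f x) (r * c) :=
  ⟨hf.1.const_mul r, by rw [integral_const_mul, hf.2]⟩

lemma HasInt.congr {f g : ℝ → ℝ} {c d : ℝ} (hf : HasInt f c) (h : ∀ x, g x = f x) (e : d = c) :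
    HasInt g d := by
  have : g = f := funext h
  rw [this, e]; exact hf

lemma HasInt.of_re {f : ℝ → ℂ} (hf : Integrable f) (h : ∫ x, f x = 0) :
    HasInt (fun x => (f x).re) 0 := by
  refine ⟨hf.re, ?_⟩
  have := integral_re hf
  simp only [RCLike.re_to_complex] at this
  rw [this, h]; rfl

lemma HasInt.of_im {f : ℝ → ℂ} (hf : Integrable f) (h : ∫ x, f x = 0) :
    HasInt (fun x => (f x).im) 0 := by
  refine ⟨hf.im, ?_⟩
  have := integral_im hf
  simp only [RCLike.im_to_complex] at this
  rw [this, h]; rfl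

lemma EE_normSq (a b : ℕ → ℝ) (n : ℕ) (x : ℝ) :
    Complex.normSq (EE a b n x) = opoly a b n x ^ 2 + opoly a b (n + 1) x ^ 2 := by
  simp [EE, copoly_ofReal, Complex.normSq_apply]; ring

lemma div_EE_re (a b : ℕ → ℝ) (n l : ℕ) (x : ℝ) :
    (copoly a b l x / EE a b n x).re =
      opoly a b l x * opoly a b (n + 1) x / (opoly a b n x ^ 2 + opoly a b (n + 1) x ^ 2) := by
  rw [Complex.div_re, EE_normSq]
  simp [EE, copoly_ofReal]

lemma div_EE_im (a b : ℕ → ℝ) (n l : ℕ) (x : ℝ) :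
    (copoly a b l x / EE a b n x).im =
      -(opoly a b l x * opoly a b n x / (opoly a b n x ^ 2 + opoly a b (n + 1) x ^ 2)) := by
  rw [Complex.div_im, EE_normSq]
  simp [EE, copoly_ofReal]

lemma carm_low (a b : ℕ → ℝ) (ha : ∀ n, 0 < a n) (n l : ℕ) (hl : l < n) :
    HasInt (fun x => opoly a b l x * opoly a b n x * carm a b n x) 0 ∧
    HasInt (fun x => opoly a b l x * opoly a b (n + 1) x * carm a b n x) 0 := by
  have h := cauchy_line (fun z => copoly a b l z / EE a b n z)
    (fun z hz => by
      apply DifferentiableAt.div (copoly_diff a b l z) _ (EE_ne a b ha n z hz)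
      exact (copoly_diff a b (n + 1) z).add ((copoly_diff a b n z).const_mul _))
    (isBigO_ratio _ _ l (n + 1) _ _ (kapp_ne a ha (n + 1)) (by omega) (copoly_asymp a b l)
      (EE_asymp a b n))
  have hpi := Real.pi_pos
  constructor
  · refine ((HasInt.of_im h.1 h.2).smul (-(1 / (π * a n)))).congr (fun x => ?_) (by simp)
    rw [div_EE_im]
    have := (opoly_ne a b ha x n).ne'
    have := (ha n).ne'
    simp only [carm]
    field_simp
  · refine ((HasInt.of_re h.1 h.2).smul ((1 / (π * a n)))).congr (fun x => ?_) (by simp)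
    rw [div_EE_re]
    have := (opoly_ne a b ha x n).ne'
    have := (ha n).ne'
    simp only [carm]
    field_simp

lemma lower_asymp (a b : ℕ → ℝ) (ha : ∀ n, 0 < a n) (n : ℕ) :
    ∃ c : ℂ, Tendsto (fun z => (copoly a b n z * (z + Complex.I) - a n * EE a b n z) / z ^ n)
      (Bornology.cobounded ℂ) (𝓝 c) := by
  cases n with
  | zero =>
    refine ⟨b 0 + Complex.I - a 0 * Complex.I, ?_⟩
    refine tendsto_const_nhds.congr fun z => ?_
    have : (a 0 : ℂ) ≠ 0 := by exact_mod_cast (ha 0).ne'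
    simp only [copoly, EE]
    simp
    field_simp
    ring
  | succ n =>
    have h := ((copoly_asymp a b (n + 1)).const_mul (b (n + 1) + Complex.I - a (n + 1) * Complex.I)).add
      ((inv_cobounded.mul (copoly_asymp a b n)).const_mul (a n : ℂ))
    refine ⟨_, h.congr' ?_⟩
    filter_upwards [ne_zero_cobounded] with z hz
    have : (a (n + 1) : ℂ) ≠ 0 := by exact_mod_cast (ha (n + 1)).ne'
    have e : copoly a b (n + 1 + 1) z = ((z - b (n + 1)) * copoly a b (n + 1) z - a n * copoly a b n z) / a (n + 1) := rfl
    simp only [EE, e]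
    field_simp
    ring

lemma carm_top (a b : ℕ → ℝ) (ha : ∀ n, 0 < a n) (n : ℕ) :
    HasInt (fun x => opoly a b n x * opoly a b n x * carm a b n x) 1 := by
  obtain ⟨c, hc⟩ := lower_asymp a b ha n
  have hI : ∀ z : ℂ, 0 ≤ z.im → z + Complex.I ≠ 0 := by
    intro z hz h
    have := congrArg Complex.im h
    simp at this
    linarith
  have hden : Tendsto (fun z => (EE a b n z * (z + Complex.I)) / z ^ (n + 2))
      (Bornology.cobounded ℂ) (𝓝 (kapp a (n + 1) * (1 + Complex.I * 0))) := by
    refine ((EE_asymp a b n).mul ((inv_cobounded.const_mul Complex.I).const_add 1)).congr' ?_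
    filter_upwards [ne_zero_cobounded] with z hz
    field_simp
    ring
  rw [mul_zero, add_zero, mul_one] at hden
  have hEd : ∀ z, DifferentiableAt ℂ (EE a b n) z := fun z =>
    (copoly_diff a b (n + 1) z).add ((copoly_diff a b n z).const_mul _)
  have h := cauchy_line (fun z => (copoly a b n z * (z + Complex.I) - a n * EE a b n z) /
      (EE a b n z * (z + Complex.I)))
    (fun z hz => by
      have h1 := copoly_diff a b n z
      have h2 := hEd z
      have h3 := mul_ne_zero (EE_ne a b ha n z hz) (hI z hz)
      exact DifferentiableAt.fun_div (by fun_prop) (by fun_prop) h3)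
    (isBigO_ratio _ _ n (n + 2) _ _ (kapp_ne a ha (n + 1)) (by omega) hc hden)
  have hpi := Real.pi_pos
  have h2 : HasInt (fun x : ℝ => (1 + x ^ 2)⁻¹) π :=
    ⟨integrable_inv_one_add_sq, integral_univ_inv_one_add_sq⟩
  have han := (ha n).ne'
  refine (((HasInt.of_im h.1 h.2).smul (-(1 / (π * a n)))).add (h2.smul (1 / π))).congr
    (fun x => ?_) (by field_simp; ring)
  have e1 : (copoly a b n x * (x + Complex.I) - a n * EE a b n x) /
      (EE a b n x * (x + Complex.I)) = copoly a b n x / EE a b n x - a n / (x + Complex.I) := by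
    have h1 := EE_ne a b ha n x (by simp)
    have h2 := hI x (by simp)
    field_simp
  have e2 : ((a n : ℂ) / (x + Complex.I)).im = - (a n / (1 + x ^ 2)) := by
    rw [Complex.div_im]; simp [Complex.normSq_apply]; ring
  rw [e1, Complex.sub_im, div_EE_im, e2]
  have := (opoly_ne a b ha x n).ne'
  have h5 : 1 + x ^ 2 ≠ 0 := by positivity
  simp only [carm]
  field_simp
  ring

lemma opoly_x (a b : ℕ → ℝ) (ha : ∀ n, 0 < a n) (n : ℕ) (x : ℝ) :
    x * opoly a b (n + 1) x = a (n + 1) * opoly a b (n + 2) x + b (n + 1) * opoly a b (n + 1) x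
      + a n * opoly a b n x := by
  have e : opoly a b (n + 2) x = ((x - b (n + 1)) * opoly a b (n + 1) x - a n * opoly a b n x) / a (n + 1) := rfl
  rw [e]
  have := (ha (n + 1)).ne'
  field_simp
  ring

lemma opoly_x0 (a b : ℕ → ℝ) (ha : ∀ n, 0 < a n) (x : ℝ) :
    x * opoly a b 0 x = a 0 * opoly a b 1 x + b 0 * opoly a b 0 x := by
  have := (ha 0).ne'
  simp only [opoly]
  field_simp
  ring

lemma carm_down (a b : ℕ → ℝ) (ha : ∀ n, 0 < a n) (D : ℝ → ℝ) (n : ℕ)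
    (h1 : ∀ l < n, HasInt (fun x => opoly a b l x * opoly a b n x * D x) 0)
    (h2 : ∀ l < n, HasInt (fun x => opoly a b l x * opoly a b (n + 1) x * D x) 0)
    (h3 : HasInt (fun x => opoly a b n x * opoly a b n x * D x) 1) :
    ∀ m ≤ n, (∀ l < m, HasInt (fun x => opoly a b l x * opoly a b m x * D x) 0) ∧
      HasInt (fun x => opoly a b m x * opoly a b m x * D x) 1 := by
  induction n with
  | zero =>
    intro m hm
    obtain rfl : m = 0 := by omega
    exact ⟨h1, h3⟩
  | succ s ih =>
    have hs : (a s) ≠ 0 := (ha s).ne'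
    have xm : ∀ l ≤ s, HasInt (fun x => x * opoly a b l x * opoly a b (s + 1) x * D x)
        (if l = s then a s else 0) := by
      intro l hl
      have htop : HasInt (fun x => opoly a b (l + 1) x * opoly a b (s + 1) x * D x)
          (if l = s then 1 else 0) := by
        split_ifs with h
        · rw [h]; exact h3
        · exact h1 _ (by omega)
      cases l with
      | zero =>
        refine ((htop.smul (a 0)).add ((h1 0 (by omega)).smul (b 0))).congr (fun x => ?_) ?_
        · rw [opoly_x0 a b ha]; ring
        · split_ifs with h
          · rw [← h]; ring
          · ring
      | succ l =>
        refine (((htop.smul (a (l + 1))).add ((h1 (l + 1) (by omega)).smul (b (l + 1)))).add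
          ((h1 l (by omega)).smul (a l))).congr (fun x => ?_) ?_
        · rw [opoly_x a b ha]; ring
        · split_ifs with h
          · rw [← h]; ring
          · ring
    have low : ∀ l ≤ s, HasInt (fun x => opoly a b l x * opoly a b s x * D x)
        (if l = s then 1 else 0) := by
      intro l hl
      refine ((((xm l hl).smul (1 / a s)).add ((h1 l (by omega)).smul (- (b (s + 1) / a s)))).add
        ((h2 l (by omega)).smul (- (a (s + 1) / a s)))).congr (fun x => ?_) ?_
      · have := opoly_x a b ha s x
        have e : opoly a b s x = (x * opoly a b (s + 1) x - a (s + 1) * opoly a b (s + 2) x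
          - b (s + 1) * opoly a b (s + 1) x) / a s := by
          field_simp; linarith
        rw [e]; field_simp; ring
      · split_ifs
        · field_simp; ring
        · ring
    have key := ih (fun l hl => by
        have := low l hl.le
        rwa [if_neg (by omega)] at this)
      (fun l hl => h1 l (by omega))
      (by
        have := low s le_rfl
        rwa [if_pos rfl] at this)
    intro m hm
    rcases Nat.lt_or_ge m (s + 1) with h | h
    · exact key m (by omega)
    · obtain rfl : m = s + 1 := by omega
      exact ⟨h1, h3⟩

/-- orthonormality up to index `n` with respect to the density `D`. -/
def OrthoUpTo (a b : ℕ → ℝ) (D : ℝ → ℝ) (n : ℕ) : Prop :=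
  ∀ j ≤ n, ∀ l ≤ n, HasInt (fun x => opoly a b j x * opoly a b l x * D x) (if j = l then 1 else 0)

lemma carm_ortho (a b : ℕ → ℝ) (ha : ∀ n, 0 < a n) (n : ℕ) :
    OrthoUpTo a b (carm a b n) n := by
  have key := carm_down a b ha (carm a b n) n (fun l hl => (carm_low a b ha n l hl).1)
    (fun l hl => (carm_low a b ha n l hl).2) (carm_top a b ha n)
  intro j hj l hl
  rcases lt_trichotomy j l with h | h | h
  · rw [if_neg h.ne]; exact (key l hl).1 j h
  · rw [h, if_pos rfl]; exact (key l hl).2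
  · rw [if_neg h.ne']
    exact ((key j hj).1 l h).congr (fun x => by ring) rfl

lemma carm_cont (a b : ℕ → ℝ) (ha : ∀ n, 0 < a n) (n : ℕ) : Continuous (carm a b n) := by
  unfold carm
  have h1 := opoly_cont a b n
  have h2 := opoly_cont a b (n + 1)
  apply Continuous.div (by fun_prop) (by fun_prop)
  intro x
  have := opoly_ne a b ha x n
  have := ha n
  have := Real.pi_pos
  positivity

lemma carm_nonneg (a b : ℕ → ℝ) (ha : ∀ n, 0 < a n) (n : ℕ) (x : ℝ) : 0 ≤ carm a b n x := by
  unfold carm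
  have := ha n
  have := Real.pi_pos
  positivity



/-- measure with density `D`. -/
def dmeas (D : ℝ → ℝ) : Measure ℝ := volume.withDensity (fun x => ENNReal.ofReal (D x))

lemma dmeas_integral (D : ℝ → ℝ) (hc : Continuous D) (h0 : ∀ x, 0 ≤ D x) (f : ℝ → ℝ) :
    ∫ x, f x ∂(dmeas D) = ∫ x, f x * D x := by
  unfold dmeas
  rw [integral_withDensity_eq_integral_toReal_smul (by fun_prop) (by simp)]
  refine integral_congr_ae (Eventually.of_forall fun x => ?_)
  simp [ENNReal.toReal_ofReal (h0 x), mul_comm]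

lemma dmeas_integrable (D : ℝ → ℝ) (hc : Continuous D) (h0 : ∀ x, 0 ≤ D x) (f : ℝ → ℝ) :
    Integrable f (dmeas D) ↔ Integrable (fun x => f x * D x) := by
  unfold dmeas
  rw [integrable_withDensity_iff (by fun_prop) (by simp)]
  simp [ENNReal.toReal_ofReal (h0 _)]

lemma dmeas_prob (a b : ℕ → ℝ) (D : ℝ → ℝ) (h0 : ∀ x, 0 ≤ D x) (n : ℕ)
    (hO : OrthoUpTo a b D n) : IsProbabilityMeasure (dmeas D) := by
  have h := hO 0 (by omega) 0 (by omega)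
  simp [opoly, HasInt] at h
  refine ⟨?_⟩
  rw [dmeas, withDensity_apply _ MeasurableSet.univ, Measure.restrict_univ,
    ← ofReal_integral_eq_lintegral_ofReal h.1 (Eventually.of_forall h0), h.2, ENNReal.ofReal_one]

def PSpan (a b : ℕ → ℝ) : Submodule ℝ (ℝ → ℝ) := Submodule.span ℝ (Set.range (opoly a b))

lemma PSpan_x (a b : ℕ → ℝ) (ha : ∀ n, 0 < a n) (f : ℝ → ℝ) (hf : f ∈ PSpan a b) :
    (fun x => x * f x) ∈ PSpan a b := by
  unfold PSpan at *
  induction hf using Submodule.span_induction with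
  | mem f hf =>
    obtain ⟨n, rfl⟩ := hf
    have hm : ∀ n, opoly a b n ∈ Submodule.span ℝ (Set.range (opoly a b)) := fun n =>
      Submodule.subset_span ⟨n, rfl⟩
    cases n with
    | zero =>
      have e : (fun x => x * opoly a b 0 x) = a 0 • opoly a b 1 + b 0 • opoly a b 0 := by
        funext x; rw [opoly_x0 a b ha]; simp
      rw [e]
      exact Submodule.add_mem _ (Submodule.smul_mem _ _ (hm _)) (Submodule.smul_mem _ _ (hm _))
    | succ n =>
      have e : (fun x => x * opoly a b (n + 1) x) = a (n + 1) • opoly a b (n + 2)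
          + b (n + 1) • opoly a b (n + 1) + a n • opoly a b n := by
        funext x; rw [opoly_x a b ha]; simp
      rw [e]
      exact Submodule.add_mem _ (Submodule.add_mem _ (Submodule.smul_mem _ _ (hm _))
        (Submodule.smul_mem _ _ (hm _))) (Submodule.smul_mem _ _ (hm _))
  | zero =>
    have : (fun x : ℝ => x * (0 : ℝ → ℝ) x) = 0 := by funext x; simp
    rw [this]; exact Submodule.zero_mem _
  | add f g _ _ h1 h2 =>
    have : (fun x : ℝ => x * (f + g) x) = (fun x => x * f x) + fun x => x * g x := by
      funext x; simp [mul_add]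
    rw [this]; exact Submodule.add_mem _ h1 h2
  | smul c f _ h =>
    have : (fun x : ℝ => x * (c • f) x) = c • (fun x => x * f x) := by
      funext x; simp; ring
    rw [this]; exact Submodule.smul_mem _ _ h

lemma PSpan_mul (a b : ℕ → ℝ) (ha : ∀ n, 0 < a n) (f : ℝ → ℝ) (hf : f ∈ PSpan a b) : ∀ n,
    (fun x => opoly a b n x * f x) ∈ PSpan a b
  | 0 => by simpa [opoly] using hf
  | 1 => by
      have e : (fun x => opoly a b 1 x * f x) =
          (1 / a 0) • ((fun x => x * f x) - b 0 • f) := by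
        funext x; simp [opoly]; ring
      rw [e]
      exact Submodule.smul_mem _ _ (Submodule.sub_mem _ (PSpan_x a b ha f hf)
        (Submodule.smul_mem _ _ hf))
  | (n + 2) => by
      have h1 := PSpan_mul a b ha f hf n
      have h2 := PSpan_mul a b ha f hf (n + 1)
      have e : (fun x => opoly a b (n + 2) x * f x) =
          (1 / a (n + 1)) • ((fun x => x * (opoly a b (n + 1) x * f x))
            - b (n + 1) • (fun x => opoly a b (n + 1) x * f x)
            - a n • (fun x => opoly a b n x * f x)) := by
        funext x; simp [opoly]; ring
      rw [e]
      exact Submodule.smul_mem _ _ (Submodule.sub_mem _ (Submodule.sub_mem _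
        (PSpan_x a b ha _ h2) (Submodule.smul_mem _ _ h2)) (Submodule.smul_mem _ _ h1))

lemma PSpan_int (a b : ℕ → ℝ) (D : ℕ → ℝ → ℝ)
    (hO : ∀ k, OrthoUpTo a b (D k) (k + 1)) (f : ℝ → ℝ) (hf : f ∈ PSpan a b) :
    ∃ c : ℝ, ∃ k0 : ℕ, ∀ k ≥ k0, HasInt (fun x => f x * D k x) c := by
  unfold PSpan at hf
  induction hf using Submodule.span_induction with
  | mem f hf =>
    obtain ⟨n, rfl⟩ := hf
    refine ⟨if n = 0 then 1 else 0, n, fun k hk => ?_⟩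
    refine (hO k n (by omega) 0 (by omega)).congr (fun x => ?_) rfl
    simp [opoly]
  | zero =>
    refine ⟨0, 0, fun k _ => ?_⟩
    simp [HasInt]
  | add f g _ _ h1 h2 =>
    obtain ⟨c, k0, h⟩ := h1
    obtain ⟨c', k0', h'⟩ := h2
    refine ⟨c + c', max k0 k0', fun k hk => ?_⟩
    refine ((h k (le_trans (le_max_left _ _) hk)).add
      (h' k (le_trans (le_max_right _ _) hk))).congr (fun x => ?_) rfl
    simp; ring
  | smul r f _ h =>
    obtain ⟨c, k0, h⟩ := h
    refine ⟨r * c, k0, fun k hk => ?_⟩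
    refine ((h k hk).smul r).congr (fun x => ?_) rfl
    simp; ring

lemma exists_weak_limit (a b : ℕ → ℝ) (ha : ∀ n, 0 < a n) (D : ℕ → ℝ → ℝ)
    (hc : ∀ k, Continuous (D k)) (h0 : ∀ k x, 0 ≤ D k x)
    (hO : ∀ k, OrthoUpTo a b (D k) (k + 1)) :
    ∃ (F : Filter ℕ) (ν : Measure ℝ), F.NeBot ∧ F ≤ atTop ∧ IsProbabilityMeasure ν ∧
      ∀ f : BoundedContinuousFunction ℝ ℝ,
        Tendsto (fun k => ∫ x, f x * D k x) F (𝓝 (∫ x, f x ∂ν)) := by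
  have hprob : ∀ k, IsProbabilityMeasure (dmeas (D k)) := fun k =>
    dmeas_prob a b (D k) (h0 k) _ (hO k)
  let P : ℕ → ProbabilityMeasure ℝ := fun k => ⟨dmeas (D k), hprob k⟩
  set c2 : ℝ := a 0 ^ 2 + b 0 ^ 2 with hc2
  have hsq : ∀ k, HasInt (fun x => x ^ 2 * D k x) c2 := by
    intro k
    refine ((((hO k 1 (by omega) 1 (by omega)).smul (a 0 ^ 2)).add
      ((hO k 1 (by omega) 0 (by omega)).smul (2 * a 0 * b 0))).add
      ((hO k 0 (by omega) 0 (by omega)).smul (b 0 ^ 2))).congr (fun x => ?_) ?_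
    · have h := opoly_x0 a b ha x
      have e : opoly a b 0 x = 1 := rfl
      rw [e] at h ⊢
      have : x = a 0 * opoly a b 1 x + b 0 := by linarith
      have h2 : x ^ 2 = (a 0 * opoly a b 1 x + b 0) ^ 2 := by rw [← this]
      rw [h2]; ring
    · simp [hc2]
  let uu : ℕ → NNReal := fun n => Real.toNNReal (c2 / ((n : ℝ) + 1) ^ 2)
  have huu : Tendsto uu atTop (𝓝 0) := by
    have : Tendsto (fun n : ℕ => c2 / ((n : ℝ) + 1) ^ 2) atTop (𝓝 0) := by
      apply Tendsto.const_div_atTop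
      apply Tendsto.comp (tendsto_pow_atTop (by norm_num))
      exact tendsto_atTop_add_const_right _ _ tendsto_natCast_atTop_atTop
    have h := (continuous_real_toNNReal.tendsto 0).comp this
    rw [Real.toNNReal_zero] at h
    exact h
  have hcomp := isCompact_setOfPred_probabilityMeasure_mass_eq_compl_isCompact_le (E := ℝ) huu
    (K := fun n : ℕ => Set.Icc (-((n : ℝ) + 1)) ((n : ℝ) + 1)) (fun n => isCompact_Icc)
    (Or.inl inferInstance)
  have hmem : ∀ k, P k ∈ {μ : ProbabilityMeasure ℝ | ∀ n : ℕ,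
      μ (Set.Icc (-((n : ℝ) + 1)) ((n : ℝ) + 1))ᶜ ≤ uu n} := by
    intro k n
    have hIntg : Integrable (fun x : ℝ => x ^ 2) (dmeas (D k)) := by
      rw [dmeas_integrable _ (hc k) (h0 k)]; exact (hsq k).1
    have hmk := mul_meas_ge_le_integral_of_nonneg (μ := dmeas (D k)) (f := fun x : ℝ => x ^ 2)
      (Eventually.of_forall fun x => sq_nonneg x) hIntg (((n : ℝ) + 1) ^ 2)
    rw [dmeas_integral _ (hc k) (h0 k), (hsq k).2] at hmk
    have hsub : (Set.Icc (-((n : ℝ) + 1)) ((n : ℝ) + 1))ᶜ ⊆ {x : ℝ | ((n : ℝ) + 1) ^ 2 ≤ x ^ 2} := by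
      intro x hx
      simp only [Set.mem_compl_iff, Set.mem_Icc, not_and_or, not_le] at hx
      have hn : (0 : ℝ) ≤ n := Nat.cast_nonneg n
      simp only [Set.mem_setOf_eq]
      rcases hx with hx | hx <;> nlinarith
    have hle : (dmeas (D k)).real (Set.Icc (-((n : ℝ) + 1)) ((n : ℝ) + 1))ᶜ ≤ c2 / ((n : ℝ) + 1) ^ 2 := by
      rw [le_div_iff₀ (by positivity)]
      have := measureReal_mono hsub (μ := dmeas (D k))
      have h4 : 0 ≤ ((n : ℝ) + 1) ^ 2 := by positivity
      nlinarith
    rw [← NNReal.coe_le_coe]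
    simp only [uu]
    rw [Real.coe_toNNReal _ (by positivity)]
    exact hle
  let U : Ultrafilter ℕ := hyperfilter ℕ
  have hU : (U : Filter ℕ) ≤ atTop := by
    have := Nat.hyperfilter_le_atTop
    exact this
  obtain ⟨ν, -, hν⟩ := hcomp.ultrafilter_le_nhds (U.map P) (by
    rw [le_principal_iff]
    exact Ultrafilter.mem_map.mpr (Filter.univ_mem' hmem))
  refine ⟨U, ν, inferInstance, hU, inferInstance, fun f => ?_⟩
  have ht : Tendsto P U (𝓝 ν) := hν
  rw [ProbabilityMeasure.tendsto_iff_forall_integral_tendsto] at ht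
  refine (ht f).congr fun k => ?_
  exact dmeas_integral _ (hc k) (h0 k) f

lemma trunc_bound (q T : ℝ) (hT : 0 < T) : |q - max (-T) (min q T)| ≤ q ^ 2 / T := by
  rw [le_div_iff₀ hT]
  rcases le_total q T with h | h
  · rw [min_eq_left h]
    rcases le_total (-T) q with h' | h'
    · rw [max_eq_right h']; simp; positivity
    · rw [max_eq_left h', abs_of_nonpos (by linarith)]; nlinarith
  · rw [min_eq_right h, max_eq_right (by linarith), abs_of_nonneg (by linarith)]; nlinarith

lemma weak_moment (D : ℕ → ℝ → ℝ) (h0 : ∀ k x, 0 ≤ D k x)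
    (F : Filter ℕ) (ν : Measure ℝ) (hF : F.NeBot) (hF1 : F ≤ atTop) [IsProbabilityMeasure ν]
    (hw : ∀ f : BoundedContinuousFunction ℝ ℝ,
        Tendsto (fun k => ∫ x, f x * D k x) F (𝓝 (∫ x, f x ∂ν)))
    (hDi : ∀ k, Integrable (D k)) (hDc : ∀ k, Continuous (D k))
    (q : ℝ → ℝ) (hq : Continuous q) (c B : ℝ) (k0 : ℕ)
    (h1 : ∀ k ≥ k0, HasInt (fun x => q x * D k x) c)
    (h2 : ∀ k ≥ k0, HasInt (fun x => q x ^ 2 * D k x) B) :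
    ∫ x, q x ∂ν = c := by
  have hev : ∀ᶠ k in F, k0 ≤ k := hF1 (eventually_ge_atTop k0)
  -- truncation
  let qt : ℕ → BoundedContinuousFunction ℝ ℝ := fun n =>
    BoundedContinuousFunction.ofNormedAddCommGroup
      (fun x => max (-((n : ℝ) + 1)) (min (q x) ((n : ℝ) + 1))) (by fun_prop) ((n : ℝ) + 1) (by
        intro x
        have hn : (0 : ℝ) ≤ n := Nat.cast_nonneg n
        rw [Real.norm_eq_abs, abs_le]
        constructor
        · exact le_max_left _ _
        · exact max_le (by linarith) (min_le_right _ _))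
  let q2 : ℕ → BoundedContinuousFunction ℝ ℝ := fun n =>
    BoundedContinuousFunction.ofNormedAddCommGroup
      (fun x => min (q x ^ 2) ((n : ℝ) + 1)) (by fun_prop) ((n : ℝ) + 1) (by
        intro x
        have hn : (0 : ℝ) ≤ n := Nat.cast_nonneg n
        rw [Real.norm_eq_abs, abs_of_nonneg (by positivity)]
        exact min_le_right _ _)
  have bint : ∀ (f : BoundedContinuousFunction ℝ ℝ) k, Integrable (fun x => f x * D k x) := by
    intro f k
    exact (hDi k).bdd_mul f.continuous.aestronglyMeasurable
      (Eventually.of_forall fun x => f.norm_coe_le_norm x)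
  have hq2 : ∀ n, ∫ x, q2 n x ∂ν ≤ B := by
    intro n
    refine le_of_tendsto (hw (q2 n)) ?_
    filter_upwards [hev] with k hk
    rw [← (h2 k hk).2]
    refine integral_mono (bint _ _) (h2 k hk).1 fun x => ?_
    exact mul_le_mul_of_nonneg_right (min_le_left _ _) (h0 k x)
  have hsqint : Integrable (fun x => q x ^ 2) ν := by
    refine ⟨by fun_prop, ?_⟩
    have hfat : ∫⁻ x, ENNReal.ofReal (q x ^ 2) ∂ν ≤ ENNReal.ofReal B := by
      have hl : ∀ x, Filter.liminf (fun n : ℕ => ENNReal.ofReal (q2 n x)) atTop =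
          ENNReal.ofReal (q x ^ 2) := by
        intro x
        apply Tendsto.liminf_eq
        apply tendsto_const_nhds.congr'
        obtain ⟨n0, hn0⟩ := exists_nat_gt (q x ^ 2)
        filter_upwards [eventually_ge_atTop n0] with n hn
        have : (n0 : ℝ) ≤ n := by exact_mod_cast hn
        congr 1
        exact (min_eq_left (by linarith)).symm
      calc ∫⁻ x, ENNReal.ofReal (q x ^ 2) ∂ν
          = ∫⁻ x, Filter.liminf (fun n : ℕ => ENNReal.ofReal (q2 n x)) atTop ∂ν := by simp_rw [hl]
        _ ≤ Filter.liminf (fun n : ℕ => ∫⁻ x, ENNReal.ofReal (q2 n x) ∂ν) atTop :=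
            lintegral_liminf_le fun n => by
              have := (q2 n).continuous
              fun_prop
        _ ≤ ENNReal.ofReal B := by
            refine Filter.liminf_le_of_frequently_le' (Eventually.frequently (Eventually.of_forall fun n => ?_))
            rw [← ofReal_integral_eq_lintegral_ofReal ((q2 n).integrable ν)
              (Eventually.of_forall fun x => ?_)]
            · exact ENNReal.ofReal_le_ofReal (hq2 n)
            · have hn : (0 : ℝ) ≤ n := Nat.cast_nonneg n
              change (0 : ℝ) ≤ min (q x ^ 2) ((n : ℝ) + 1)
              exact le_min (sq_nonneg _) (by linarith)
    rw [hasFiniteIntegral_iff_ofReal (Eventually.of_forall fun x => sq_nonneg _)]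
    exact lt_of_le_of_lt hfat ENNReal.ofReal_lt_top
  have hqint : Integrable q ν := by
    refine ((integrable_const (1 : ℝ)).add hsqint).mono' hq.aestronglyMeasurable
      (Eventually.of_forall fun x => ?_)
    simp only [Pi.add_apply, Real.norm_eq_abs]
    rw [← sq_abs]; nlinarith [sq_nonneg (|q x| - 1), abs_nonneg (q x)]
  have hlim1 : Tendsto (fun n => ∫ x, qt n x ∂ν) atTop (𝓝 (∫ x, q x ∂ν)) := by
    refine tendsto_integral_of_dominated_convergence (fun x => |q x|)
      (fun n => (qt n).continuous.aestronglyMeasurable) hqint.abs (fun n => ?_) ?_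
    · refine Eventually.of_forall fun x => ?_
      have hn : (0 : ℝ) ≤ n := Nat.cast_nonneg n
      change |max (-((n : ℝ) + 1)) (min (q x) ((n : ℝ) + 1))| ≤ |q x|
      rw [abs_le]
      constructor
      · apply le_max_of_le_right
        apply le_min
        · exact neg_abs_le _
        · linarith [abs_nonneg (q x)]
      · apply max_le
        · linarith [abs_nonneg (q x)]
        · exact (min_le_left _ _).trans (le_abs_self _)
    · refine Eventually.of_forall fun x => ?_
      apply tendsto_const_nhds.congr'
      obtain ⟨n0, hn0⟩ := exists_nat_gt |q x|
      filter_upwards [eventually_ge_atTop n0] with n hn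
      have : (n0 : ℝ) ≤ n := by exact_mod_cast hn
      have h3 := abs_lt.mp hn0
      change q x = max (-((n : ℝ) + 1)) (min (q x) ((n : ℝ) + 1))
      rw [min_eq_left (by linarith), max_eq_right (by linarith)]
  have hbd : ∀ n : ℕ, |∫ x, qt n x ∂ν - c| ≤ B / ((n : ℝ) + 1) := by
    intro n
    have hn : (0 : ℝ) < (n : ℝ) + 1 := by positivity
    refine le_of_tendsto (((hw (qt n)).sub_const c).abs) ?_
    filter_upwards [hev] with k hk
    rw [← (h1 k hk).2, ← integral_sub (bint _ _) (h1 k hk).1]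
    have e : B / ((n : ℝ) + 1) = ∫ x, (1 / ((n : ℝ) + 1)) * (q x ^ 2 * D k x) := by
      rw [integral_const_mul, (h2 k hk).2]; ring
    rw [e]
    refine (abs_integral_le_integral_abs).trans ?_
    refine integral_mono ((bint _ _).sub (h1 k hk).1).abs ((h2 k hk).1.const_mul _) fun x => ?_
    simp only
    rw [← sub_mul, abs_mul, abs_of_nonneg (h0 k x), abs_sub_comm]
    have := mul_le_mul_of_nonneg_right (trunc_bound (q x) ((n : ℝ) + 1) hn) (h0 k x)
    calc _ ≤ _ := this
      _ = _ := by ring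
  have hlim2 : Tendsto (fun n => ∫ x, qt n x ∂ν) atTop (𝓝 c) := by
    rw [tendsto_iff_norm_sub_tendsto_zero]
    refine squeeze_zero (fun _ => norm_nonneg _) (fun n => hbd n) ?_
    apply Tendsto.const_div_atTop
    exact tendsto_atTop_add_const_right _ _ tendsto_natCast_atTop_atTop
  exact tendsto_nhds_unique hlim1 hlim2

lemma weak_density (D : ℕ → ℝ → ℝ)
    (F : Filter ℕ) (ν : Measure ℝ) (hF : F.NeBot) (hF1 : F ≤ atTop) [IsProbabilityMeasure ν]
    (hw : ∀ f : BoundedContinuousFunction ℝ ℝ,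
        Tendsto (fun k => ∫ x, f x * D k x) F (𝓝 (∫ x, f x ∂ν)))
    (hDc : ∀ k, Continuous (D k))
    (s u v t : ℝ) (hsu : s < u) (hvt : v < t) (g : ℝ → ℝ)
    (hg : ContinuousOn g (Set.Icc s t)) (hg0 : ∀ x ∈ Set.Icc s t, 0 ≤ g x)
    (hL : Tendsto (fun k => ∫ x in Set.Icc s t, |D k x - g x|) atTop (𝓝 0)) :
    ν.restrict (Set.Icc u v) =
      (volume.restrict (Set.Icc u v)).withDensity (fun x => ENNReal.ofReal (g x)) := by
  obtain ⟨χ, hχ0, hχ1, hχ⟩ := exists_continuous_zero_one_of_isClosed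
    (s := (Set.Ioo s t)ᶜ) (t := Set.Icc u v) isOpen_Ioo.isClosed_compl isClosed_Icc (by
      rw [Set.disjoint_left]
      intro x hx hx'
      exact hx ⟨lt_of_lt_of_le hsu hx'.1, lt_of_le_of_lt hx'.2 hvt⟩)
  let χb : BoundedContinuousFunction ℝ ℝ :=
    BoundedContinuousFunction.ofNormedAddCommGroup χ χ.continuous 1 (by
      intro x
      rw [Real.norm_eq_abs, abs_of_nonneg (hχ x).1]; exact (hχ x).2)
  have hχc := χ.continuous
  have hout : ∀ x, x ∉ Set.Icc s t → χ x = 0 := by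
    intro x hx
    apply hχ0
    intro h
    exact hx ⟨h.1.le, h.2.le⟩
  have hgi : IntegrableOn g (Set.Icc s t) := hg.integrableOn_compact isCompact_Icc
  have key : ∀ f : BoundedContinuousFunction ℝ ℝ,
      ∫ x, f x * χ x ∂ν = ∫ x in Set.Icc s t, f x * χ x * g x := by
    intro f
    have t1 := hw (f * χb)
    have bd : ∀ x, ‖f x * χ x‖ ≤ ‖f‖ := by
      intro x
      rw [norm_mul]
      have h1 := f.norm_coe_le_norm x
      have h2 : ‖χ x‖ ≤ 1 := by
        rw [Real.norm_eq_abs, abs_of_nonneg (hχ x).1]; exact (hχ x).2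
      calc _ ≤ ‖f‖ * 1 := by gcongr
        _ = ‖f‖ := mul_one _
    have cf : Continuous fun x => f x * χ x := f.continuous.mul hχc
    have e1 : ∀ k, ∫ x, (f * χb) x * D k x = ∫ x in Set.Icc s t, f x * χ x * D k x := by
      intro k
      rw [← integral_indicator measurableSet_Icc]
      refine integral_congr_ae (Eventually.of_forall fun x => ?_)
      by_cases hx : x ∈ Set.Icc s t
      · simp only [Set.indicator_of_mem hx]; rfl
      · simp only [Set.indicator_of_notMem hx]
        change f x * χ x * D k x = 0
        rw [hout x hx]; ring
    have t2 : Tendsto (fun k => ∫ x in Set.Icc s t, f x * χ x * D k x) atTop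
        (𝓝 (∫ x in Set.Icc s t, f x * χ x * g x)) := by
      rw [tendsto_iff_norm_sub_tendsto_zero]
      refine squeeze_zero (fun _ => norm_nonneg _) (fun k => ?_)
        (by simpa using hL.const_mul ‖f‖)
      have i1 : IntegrableOn (fun x => f x * χ x * D k x) (Set.Icc s t) :=
        (cf.mul (hDc k)).continuousOn.integrableOn_compact isCompact_Icc
      have i2 : IntegrableOn (fun x => f x * χ x * g x) (Set.Icc s t) :=
        (cf.continuousOn.mul hg).integrableOn_compact isCompact_Icc
      have i3 : IntegrableOn (fun x => D k x - g x) (Set.Icc s t) :=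
        ((hDc k).continuousOn.sub hg).integrableOn_compact isCompact_Icc
      rw [← integral_sub i1 i2, ← integral_const_mul]
      refine (norm_integral_le_integral_norm _).trans ?_
      refine integral_mono (i1.sub i2).norm (i3.abs.const_mul _) fun x => ?_
      simp only
      rw [← mul_sub, norm_mul, Real.norm_eq_abs (D k x - g x)]
      exact mul_le_mul_of_nonneg_right (bd x) (abs_nonneg _)
    have t3 := t2.mono_left hF1
    have t4 : Tendsto (fun k => ∫ x, (f * χb) x * D k x) F
        (𝓝 (∫ x in Set.Icc s t, f x * χ x * g x)) := t3.congr fun k => (e1 k).symm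
    exact tendsto_nhds_unique t1 t4
  have gm : AEMeasurable g (volume.restrict (Set.Icc s t)) := hgi.aestronglyMeasurable.aemeasurable
  have hci : IntegrableOn (fun x => χ x * g x) (Set.Icc s t) :=
    (hχc.continuousOn.mul hg).integrableOn_compact isCompact_Icc
  let m1 : Measure ℝ := ν.withDensity (fun x => ENNReal.ofReal (χ x))
  let m2 : Measure ℝ := (volume.restrict (Set.Icc s t)).withDensity
    (fun x => ENNReal.ofReal (χ x * g x))
  haveI : IsFiniteMeasure m1 := isFiniteMeasure_withDensity_ofReal (χb.integrable ν).2
  haveI : IsFiniteMeasure m2 := isFiniteMeasure_withDensity_ofReal hci.2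
  have hm : m1 = m2 := by
    apply ext_of_forall_integral_eq_of_IsFiniteMeasure
    intro f
    simp only [m1, m2]
    rw [integral_withDensity_eq_integral_toReal_smul₀ (by fun_prop) (by simp),
      integral_withDensity_eq_integral_toReal_smul₀
        (hci.aestronglyMeasurable.aemeasurable.ennreal_ofReal) (by simp)]
    have h1 : ∫ x, (ENNReal.ofReal (χ x)).toReal • f x ∂ν = ∫ x, f x * χ x ∂ν := by
      refine integral_congr_ae (Eventually.of_forall fun x => ?_)
      simp only [ENNReal.toReal_ofReal (hχ x).1, smul_eq_mul]; ring
    rw [h1, key f]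
    refine setIntegral_congr_fun measurableSet_Icc fun x hx => ?_
    simp only [ENNReal.toReal_ofReal (mul_nonneg (hχ x).1 (hg0 x hx)), smul_eq_mul]; ring
  have hsub : Set.Icc u v ⊆ Set.Icc s t := fun x hx =>
    ⟨hsu.le.trans hx.1, hx.2.trans hvt.le⟩
  have r1 : m1.restrict (Set.Icc u v) = ν.restrict (Set.Icc u v) := by
    simp only [m1]
    rw [restrict_withDensity measurableSet_Icc]
    conv_rhs => rw [← withDensity_one (μ := ν.restrict (Set.Icc u v))]
    apply withDensity_congr_ae
    filter_upwards [ae_restrict_mem measurableSet_Icc] with x hx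
    rw [hχ1 hx]; simp
  have r2 : m2.restrict (Set.Icc u v) =
      (volume.restrict (Set.Icc u v)).withDensity (fun x => ENNReal.ofReal (g x)) := by
    simp only [m2]
    rw [restrict_withDensity measurableSet_Icc, Measure.restrict_restrict measurableSet_Icc,
      Set.inter_eq_left.mpr hsub]
    apply withDensity_congr_ae
    filter_upwards [ae_restrict_mem measurableSet_Icc] with x hx
    rw [hχ1 hx]; simp
  rw [← r1, hm, r2]

lemma limit_measure (a b : ℕ → ℝ) (ha : ∀ n, 0 < a n) (D : ℕ → ℝ → ℝ)
    (hc : ∀ k, Continuous (D k)) (h0 : ∀ k x, 0 ≤ D k x)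
    (hO : ∀ k, OrthoUpTo a b (D k) (k + 1))
    (s u v t : ℝ) (hsu : s < u) (hvt : v < t) (g : ℝ → ℝ)
    (hg : ContinuousOn g (Set.Icc s t)) (hg0 : ∀ x ∈ Set.Icc s t, 0 ≤ g x)
    (hL : Tendsto (fun k => ∫ x in Set.Icc s t, |D k x - g x|) atTop (𝓝 0)) :
    ∃ ν : Measure ℝ, IsProbabilityMeasure ν ∧
      (∀ n m : ℕ, ∫ x, opoly a b n x * opoly a b m x ∂ν = if n = m then 1 else 0) ∧
      ν.restrict (Set.Icc u v) =
        (volume.restrict (Set.Icc u v)).withDensity (fun x => ENNReal.ofReal (g x)) := by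
  obtain ⟨F, ν, hF, hF1, hp, hw⟩ := exists_weak_limit a b ha D hc h0 hO
  refine ⟨ν, hp, fun n m => ?_, weak_density D F ν hF hF1 hw hc s u v t hsu hvt g hg hg0 hL⟩
  have hDi : ∀ k, Integrable (D k) := fun k => by
    have := (hO k 0 (by omega) 0 (by omega)).1
    simpa [opoly] using this
  have hmem : (fun x => opoly a b n x * (opoly a b m x * (opoly a b n x * opoly a b m x))) ∈ PSpan a b :=
    PSpan_mul a b ha _ (PSpan_mul a b ha _ (PSpan_mul a b ha _ (Submodule.subset_span ⟨m, rfl⟩) n) m) n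
  obtain ⟨B, k0, hB⟩ := PSpan_int a b D hO _ hmem
  refine weak_moment D h0 F ν hF hF1 hw hDi hc _ ((opoly_cont a b n).mul (opoly_cont a b m)) _ B
    (max k0 (max n m)) (fun k hk => ?_) (fun k hk => ?_)
  · have : max n m ≤ k := (le_max_right _ _).trans hk
    exact hO k n (by omega) m (by omega)
  · refine (hB k ((le_max_left _ _).trans hk)).congr (fun x => ?_) rfl
    simp only [Pi.mul_apply]
    ring



lemma prodD_poly (a b : ℕ → ℝ) (n len : ℕ) : ∀ r c : Fin 2, ∃ P : Polynomial ℝ,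
    P.natDegree ≤ len ∧ ∀ x, prodD (fun j => Bmat a b j x) n len r c = P.eval x := by
  induction len with
  | zero =>
    intro r c
    refine ⟨Polynomial.C ((1 : Mat2) r c), by simp, fun x => by simp [prodD]⟩
  | succ len ih =>
    intro r c
    obtain ⟨P, hP, hPe⟩ := ih 0 c
    obtain ⟨Q, hQ, hQe⟩ := ih 1 c
    fin_cases r
    · refine ⟨Q, by omega, fun x => ?_⟩
      rw [prodD, Matrix.mul_apply, Fin.sum_univ_two, hQe, hPe]
      simp [Bmat]
    · refine ⟨Polynomial.C (-(a (n + len - 1)) / a (n + len)) * P +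
        (Polynomial.C (1 / a (n + len)) * (Polynomial.X - Polynomial.C (b (n + len)))) * Q, ?_, fun x => ?_⟩
      · refine (Polynomial.natDegree_add_le _ _).trans (max_le ?_ ?_)
        · exact (Polynomial.natDegree_C_mul_le _ _).trans (by omega)
        · refine Polynomial.natDegree_mul_le.trans ?_
          have := (Polynomial.natDegree_C_mul_le (1 / a (n + len)) (Polynomial.X - Polynomial.C (b (n + len))))
          rw [Polynomial.natDegree_X_sub_C] at this
          omega
      · rw [prodD, Matrix.mul_apply, Fin.sum_univ_two, hQe, hPe]
        simp only [Bmat, Polynomial.eval_add, Polynomial.eval_mul, Polynomial.eval_sub, Polynomial.eval_C,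
          Polynomial.eval_X]
        simp
        ring_nf
        simp

lemma poly_extend (N : ℕ) (u v : ℝ) (huv : u < v) : ∃ C > 0, ∀ P : Polynomial ℝ, P.natDegree ≤ N →
    ∀ s, (∀ x ∈ Set.Icc u v, |P.eval x| ≤ s) → ∀ x ∈ Set.Icc (u - 1) (v + 1), |P.eval x| ≤ C * s := by
  classical
  let nd : ℕ → ℝ := fun k => u + (v - u) * (k / (N + 1 : ℝ))
  have hinj : Function.Injective nd := by
    intro k l h
    simp only [nd] at h
    have h1 : (v - u) * (k / (N + 1 : ℝ)) = (v - u) * (l / (N + 1 : ℝ)) := by linarith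
    have h2 := mul_left_cancel₀ (by linarith : v - u ≠ 0) h1
    have h3 : (k : ℝ) = l := by
      have : (N + 1 : ℝ) ≠ 0 := by positivity
      field_simp at h2
      exact h2
    exact_mod_cast h3
  let S := Finset.range (N + 1)
  have hnd : ∀ k ∈ S, nd k ∈ Set.Icc u v := by
    intro k hk
    have : (k : ℝ) ≤ N + 1 := by
      have := Finset.mem_range.mp hk
      exact_mod_cast this.le
    have h1 : (k : ℝ) / (N + 1 : ℝ) ≤ 1 := by rw [div_le_one (by positivity)]; exact this
    have h0 : 0 ≤ (k : ℝ) / (N + 1 : ℝ) := by positivity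
    constructor <;> simp only [nd] <;> nlinarith
  have hcont : ContinuousOn (fun x => ∑ k ∈ S, |(Lagrange.basis S nd k).eval x|) (Set.Icc (u - 1) (v + 1)) := by
    apply Continuous.continuousOn
    refine continuous_finsetSum _ fun k _ => ?_
    exact (Polynomial.continuous _).abs
  obtain ⟨C, hC⟩ := (isCompact_Icc.bddAbove_image hcont)
  refine ⟨max C 1, by positivity, fun P hP s hs x hx => ?_⟩
  have hs0 : 0 ≤ s := (abs_nonneg _).trans (hs u ⟨le_rfl, huv.le⟩)
  have hdeg : P.degree < S.card := by
    refine lt_of_le_of_lt Polynomial.degree_le_natDegree ?_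
    simp only [S, Finset.card_range]
    exact_mod_cast Nat.lt_succ_of_le hP
  have heq := Lagrange.eq_interpolate (s := S) (v := nd) (hinj.injOn) hdeg
  rw [heq, Lagrange.interpolate_apply, Polynomial.eval_finsetSum]
  calc _ ≤ ∑ k ∈ S, |(Polynomial.C (P.eval (nd k)) * Lagrange.basis S nd k).eval x| := Finset.abs_sum_le_sum_abs _ _
    _ ≤ ∑ k ∈ S, s * |(Lagrange.basis S nd k).eval x| := by
        refine Finset.sum_le_sum fun k hk => ?_
        rw [Polynomial.eval_mul, Polynomial.eval_C, abs_mul]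
        exact mul_le_mul_of_nonneg_right (hs _ (hnd k hk)) (abs_nonneg _)
    _ = s * ∑ k ∈ S, |(Lagrange.basis S nd k).eval x| := by rw [Finset.mul_sum]
    _ ≤ s * max C 1 := by
        refine mul_le_mul_of_nonneg_left ((hC ⟨x, hx, rfl⟩).trans (le_max_left _ _)) hs0
    _ = _ := mul_comm _ _

lemma entry_le_norm (A : Mat2) (r c : Fin 2) : |A r c| ≤ ‖A‖ := Matrix.norm_entry_le_entrywise_sup_norm A

/-- supremum of the increments -/
def incr (a b : ℕ → ℝ) (N i : ℕ) (u v : ℝ) (j : ℕ) : ℝ :=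
  ⨆ x : Set.Icc u v, ‖Xmat a b N ((j + 1) * N + i) (x : ℝ) - Xmat a b N (j * N + i) (x : ℝ)‖

lemma incr_nonneg (a b : ℕ → ℝ) (N i : ℕ) (u v : ℝ) (j : ℕ) : 0 ≤ incr a b N i u v j :=
  Real.iSup_nonneg fun _ => norm_nonneg _

lemma incr_bound (a b : ℕ → ℝ) (N i : ℕ) (u v : ℝ) (huv : u < v)
    (hbdd : ∃ C, ∀ j : ℕ, ∀ x ∈ Set.Icc u v, ‖Xmat a b N (j * N + i) x‖ ≤ C) :
    ∃ C > 0, ∀ j, ∀ x ∈ Set.Icc (u - 1) (v + 1), ∀ r c,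
      |Xmat a b N ((j + 1) * N + i) x r c - Xmat a b N (j * N + i) x r c| ≤ C * incr a b N i u v j := by
  obtain ⟨C0, hC0⟩ := hbdd
  obtain ⟨C, hC, h⟩ := poly_extend N u v huv
  refine ⟨C, hC, fun j x hx r c => ?_⟩
  obtain ⟨P, hP, hPe⟩ := prodD_poly a b ((j + 1) * N + i) N r c
  obtain ⟨Q, hQ, hQe⟩ := prodD_poly a b (j * N + i) N r c
  have key := h (P - Q) ((Polynomial.natDegree_sub_le _ _).trans (max_le hP hQ)) (incr a b N i u v j) ?_ x hx
  · rw [Polynomial.eval_sub, ← hPe, ← hQe] at key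
    exact key
  · intro y hy
    rw [Polynomial.eval_sub, ← hPe, ← hQe]
    have hb : BddAbove (Set.range fun x : Set.Icc u v =>
        ‖Xmat a b N ((j + 1) * N + i) (x : ℝ) - Xmat a b N (j * N + i) (x : ℝ)‖) := by
      refine ⟨C0 + C0, ?_⟩
      rintro _ ⟨z, rfl⟩
      exact (norm_sub_le _ _).trans (add_le_add (hC0 _ _ z.2) (hC0 _ _ z.2))
    refine le_trans ?_ (le_ciSup hb ⟨y, hy⟩)
    exact entry_le_norm (Xmat a b N ((j + 1) * N + i) y - Xmat a b N (j * N + i) y) r c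

lemma Xmat_cont (a b : ℕ → ℝ) (N n : ℕ) (r c : Fin 2) : Continuous fun x => Xmat a b N n x r c := by
  obtain ⟨P, hP, hPe⟩ := prodD_poly a b n N r c
  have : (fun x => Xmat a b N n x r c) = fun x => P.eval x := funext hPe
  rw [this]; exact P.continuous

lemma prodD_det (a b : ℕ → ℝ) (ha : ∀ n, 0 < a n) (n : ℕ) (hn : 1 ≤ n) (len : ℕ) (x : ℝ) :
    (prodD (fun j => Bmat a b j x) n len).det = a (n - 1) / a (n + len - 1) := by
  induction len with
  | zero => simp [prodD, (ha _).ne']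
  | succ len ih =>
    rw [prodD, Matrix.det_mul, ih]
    have h1 := (ha (n + len)).ne'
    have h2 := (ha (n + len - 1)).ne'
    simp [Bmat, Matrix.det_fin_two, show n + (len + 1) - 1 = n + len by omega]
    field_simp

lemma Xmat_det (a b : ℕ → ℝ) (ha : ∀ n, 0 < a n) (N i : ℕ) (hN : 0 < N) (k : ℕ) (hk : 1 ≤ k) (x : ℝ) :
    (Xmat a b N (k * N + i) x).det = a (k * N + i - 1) / a ((k + 1) * N + i - 1) := by
  have : 1 ≤ k * N + i := by nlinarith
  rw [Xmat, prodD_det a b ha _ this]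
  congr 2
  ring_nf

/-- uniform limits with a tail estimate -/
lemma tail_limit {E : Type*} [NormedAddCommGroup E] [CompleteSpace E] (S : Set ℝ) (M : ℕ) (f : ℕ → ℝ → E)
    (e : ℕ → ℝ) (he : Summable e) (hf : ∀ n ≥ M, ∀ x ∈ S, ‖f (n + 1) x - f n x‖ ≤ e n)
    (hc : ∀ n, ContinuousOn (f n) S) :
    ∃ g : ℝ → E, ContinuousOn g S ∧ ∀ n ≥ M, ∀ x ∈ S, ‖f n x - g x‖ ≤ ∑' m, e (n + m) := by
  have hes : Summable fun n => e (M + n) := by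
    simpa [add_comm] using (summable_nat_add_iff M).mpr he
  have hd : ∀ x ∈ S, ∀ n, dist (f (M + n) x) (f (M + n.succ) x) ≤ e (M + n) := by
    intro x hx n
    rw [dist_comm, dist_eq_norm]
    exact hf (M + n) (by omega) x hx
  have hlim : ∀ x, ∃ y, x ∈ S → Tendsto (fun n => f (M + n) x) atTop (𝓝 y) := by
    intro x
    by_cases hx : x ∈ S
    · obtain ⟨y, hy⟩ := cauchySeq_tendsto_of_complete
        (cauchySeq_of_dist_le_of_summable (f := fun n => f (M + n) x) _ (hd x hx) hes)
      exact ⟨y, fun _ => hy⟩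
    · exact ⟨0, fun h => absurd h hx⟩
  choose g hg using hlim
  have hb : ∀ n ≥ M, ∀ x ∈ S, ‖f n x - g x‖ ≤ ∑' m, e (n + m) := by
    intro n hn x hx
    obtain ⟨l, rfl⟩ := Nat.exists_eq_add_of_le hn
    have := dist_le_tsum_of_dist_le_of_tendsto (f := fun n => f (M + n) x) _ (hd x hx) hes (hg x hx) l
    rw [dist_eq_norm] at this
    simpa [add_assoc] using this
  refine ⟨g, ?_, hb⟩
  have hu : TendstoUniformlyOn f g atTop S := by
    rw [Metric.tendstoUniformlyOn_iff]
    intro ε hε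
    have ht := tendsto_sum_nat_add e
    filter_upwards [ht.eventually (gt_mem_nhds hε), eventually_ge_atTop M] with n hn hM x hx
    rw [dist_comm, dist_eq_norm]
    refine (hb n hM x hx).trans_lt ?_
    simpa [add_comm] using hn
  exact hu.continuousOn (Frequently.of_forall hc)



lemma discr_eq (A : Mat2) : discr A = (A 0 0 - A 1 1) ^ 2 + 4 * A 0 1 * A 1 0 := by
  rw [discr, Matrix.trace_fin_two, Matrix.det_fin_two]; ring

/-- uniform non-degeneracy of a matrix -/
def Good (σ R : ℝ) (A : Mat2) : Prop :=
  σ ≤ -discr A ∧ (∀ r c, |A r c| ≤ R) ∧ 1 / 2 ≤ A.det ∧ A.det ≤ 2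

lemma mul_lip {p q p' q' R Δ : ℝ} (hq : |q| ≤ R) (hp' : |p'| ≤ R) (h1 : |p - p'| ≤ Δ) (h2 : |q - q'| ≤ Δ) :
    |p * q - p' * q'| ≤ 2 * R * Δ := by
  have e : p * q - p' * q' = (p - p') * q + p' * (q - q') := by ring
  rw [e]
  refine (abs_add_le _ _).trans ?_
  rw [abs_mul, abs_mul]
  have hR : 0 ≤ R := (abs_nonneg _).trans hq
  have hD : 0 ≤ Δ := (abs_nonneg _).trans h1
  have := mul_le_mul h1 hq (abs_nonneg _) hD
  have := mul_le_mul hp' h2 (abs_nonneg _) hR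
  linarith

lemma discr_lip {A B : Mat2} {R Δ : ℝ} (hA : ∀ r c, |A r c| ≤ R) (hB : ∀ r c, |B r c| ≤ R)
    (h : ∀ r c, |A r c - B r c| ≤ Δ) : |discr A - discr B| ≤ 16 * R * Δ := by
  rw [discr_eq, discr_eq]
  have h1 := mul_lip (p := A 0 1) (q := A 1 0) (hA _ _) (hB 0 1) (h 0 1) (h 1 0)
  have h2 := mul_lip (p := A 0 0 - A 1 1) (q := A 0 0 - A 1 1) (p' := B 0 0 - B 1 1) (q' := B 0 0 - B 1 1)
    (R := 2 * R) (Δ := 2 * Δ) ((abs_sub _ _).trans (by linarith [hA 0 0, hA 1 1]))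
    ((abs_sub _ _).trans (by linarith [hB 0 0, hB 1 1]))
    (by rw [show A 0 0 - A 1 1 - (B 0 0 - B 1 1) = (A 0 0 - B 0 0) - (A 1 1 - B 1 1) by ring]
        exact (abs_sub _ _).trans (by linarith [h 0 0, h 1 1]))
    (by rw [show A 0 0 - A 1 1 - (B 0 0 - B 1 1) = (A 0 0 - B 0 0) - (A 1 1 - B 1 1) by ring]
        exact (abs_sub _ _).trans (by linarith [h 0 0, h 1 1]))
  rw [abs_le] at *
  constructor <;> nlinarith [h1.1, h1.2, h2.1, h2.2]

lemma det_lip {A B : Mat2} {R Δ : ℝ} (hA : ∀ r c, |A r c| ≤ R) (hB : ∀ r c, |B r c| ≤ R)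
    (h : ∀ r c, |A r c - B r c| ≤ Δ) : |A.det - B.det| ≤ 4 * R * Δ := by
  rw [Matrix.det_fin_two, Matrix.det_fin_two]
  have h1 := mul_lip (p := A 0 1) (q := A 1 0) (hA _ _) (hB 0 1) (h 0 1) (h 1 0)
  have h2 := mul_lip (p := A 0 0) (q := A 1 1) (hA _ _) (hB 0 0) (h 0 0) (h 1 1)
  rw [abs_le] at *
  constructor <;> nlinarith [h1.1, h1.2, h2.1, h2.2]

/-- the tail of the series of increments -/
def tailT (a b : ℕ → ℝ) (N i : ℕ) (u v : ℝ) (k : ℕ) : ℝ := ∑' m : ℕ, incr a b N i u v (k + m)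

lemma tailT_nonneg (a b : ℕ → ℝ) (N i : ℕ) (u v : ℝ) (k : ℕ) : 0 ≤ tailT a b N i u v k :=
  tsum_nonneg fun _ => incr_nonneg _ _ _ _ _ _ _

lemma tailT_tendsto (a b : ℕ → ℝ) (N i : ℕ) (u v : ℝ) :
    Tendsto (tailT a b N i u v) atTop (𝓝 0) := by
  have := tendsto_sum_nat_add (incr a b N i u v)
  refine this.congr fun k => ?_
  simp [tailT, add_comm]

lemma setup_lemma
    (N : ℕ) (hN : 0 < N) (a b : ℕ → ℝ) (ha : ∀ n, 0 < a n)
    (i : ℕ) (u v : ℝ) (huv : u < v)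
    (hΛ : ∀ x ∈ Set.Icc u v, ∃ d < (0 : ℝ),
      Tendsto (fun j : ℕ => discr (Xmat a b N (j * N + i) x)) atTop (𝓝 d))
    (hratio : Tendsto (fun j : ℕ => a ((j + 1) * N + i - 1) / a (j * N + i - 1))
      atTop (𝓝 1))
    (hbdd : ∃ C, ∀ j : ℕ, ∀ x ∈ Set.Icc u v, ‖Xmat a b N (j * N + i) x‖ ≤ C)
    (hD1 : Summable (incr a b N i u v))
    (XX : ℝ → Mat2)
    (hXX : TendstoUniformlyOn (fun j x => Xmat a b N (j * N + i) x) XX atTop (Set.Icc u v)) :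
    ∃ δ > 0, ∃ σ > 0, ∃ R > 0, ∃ C > 0, ∃ M ≥ 1, ∃ Y : ℝ → Mat2,
      (∀ x ∈ Set.Icc u v, Y x = XX x) ∧
      (∀ x ∈ Set.Icc (u - δ) (v + δ), Good σ R (Y x) ∧ (Y x).det = 1) ∧
      (∀ k ≥ M, ∀ x ∈ Set.Icc (u - δ) (v + δ), Good σ R (Xmat a b N (k * N + i) x)) ∧
      (∀ r c, ContinuousOn (fun x => Y x r c) (Set.Icc (u - δ) (v + δ))) ∧
      (∀ k, ∀ x ∈ Set.Icc (u - δ) (v + δ), ∀ r c,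
        |Xmat a b N ((k + 1) * N + i) x r c - Xmat a b N (k * N + i) x r c| ≤ C * incr a b N i u v k) ∧
      (∀ k, ∀ x ∈ Set.Icc (u - δ) (v + δ), ∀ r c,
        |Xmat a b N (k * N + i) x r c - Y x r c| ≤ C * tailT a b N i u v k) := by
  obtain ⟨C, hC, hinc⟩ := incr_bound a b N i u v huv hbdd
  have hlim : ∀ r c : Fin 2, ∃ g : ℝ → ℝ, ContinuousOn g (Set.Icc (u - 1) (v + 1)) ∧
      ∀ n, ∀ x ∈ Set.Icc (u - 1) (v + 1), |Xmat a b N (n * N + i) x r c - g x| ≤ C * tailT a b N i u v n := by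
    intro r c
    obtain ⟨g, hg, h⟩ := tail_limit (Set.Icc (u - 1) (v + 1)) 0 (fun n x => Xmat a b N (n * N + i) x r c)
      (fun j => C * incr a b N i u v j) (hD1.mul_left C) (fun n _ x hx => hinc n x hx r c)
      (fun n => (Xmat_cont a b N _ r c).continuousOn)
    refine ⟨g, hg, fun n x hx => ?_⟩
    have := h n (Nat.zero_le _) x hx
    rw [tsum_mul_left] at this
    exact this
  choose g hgc hg using hlim
  let Y : ℝ → Mat2 := fun x => Matrix.of fun r c => g r c x
  have hT := tailT_tendsto a b N i u v
  have hCT : Tendsto (fun k => C * tailT a b N i u v k) atTop (𝓝 0) := by simpa using hT.const_mul C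
  have hten : ∀ x ∈ Set.Icc (u - 1) (v + 1), ∀ r c,
      Tendsto (fun k => Xmat a b N (k * N + i) x r c) atTop (𝓝 (Y x r c)) := by
    intro x hx r c
    rw [tendsto_iff_dist_tendsto_zero]
    refine squeeze_zero (fun _ => dist_nonneg) (fun k => ?_) hCT
    rw [Real.dist_eq]
    exact hg r c k x hx
  have hsub : Set.Icc u v ⊆ Set.Icc (u - 1) (v + 1) := Set.Icc_subset_Icc (by linarith) (by linarith)
  have hYX : ∀ x ∈ Set.Icc u v, Y x = XX x := by
    intro x hx
    ext r c
    have h1 := hXX.tendsto_at hx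
    have h2 := (tendsto_pi_nhds.mp ((tendsto_pi_nhds.mp h1) r)) c
    exact tendsto_nhds_unique (hten x (hsub hx) r c) h2
  have hdetlim : Tendsto (fun k : ℕ => a (k * N + i - 1) / a ((k + 1) * N + i - 1)) atTop (𝓝 1) := by
    have := hratio.inv₀ one_ne_zero
    simpa using this
  have hdet : ∀ x ∈ Set.Icc (u - 1) (v + 1), (Y x).det = 1 := by
    intro x hx
    have h1 : Tendsto (fun k => (Xmat a b N (k * N + i) x).det) atTop (𝓝 (Y x).det) := by
      simp only [Matrix.det_fin_two]
      exact ((hten x hx 0 0).mul (hten x hx 1 1)).sub ((hten x hx 0 1).mul (hten x hx 1 0))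
    refine tendsto_nhds_unique h1 (hdetlim.congr' ?_)
    filter_upwards [eventually_ge_atTop 1] with k hk
    rw [Xmat_det a b ha N i hN k hk]
  have hYc : ∀ r c, ContinuousOn (fun x => Y x r c) (Set.Icc (u - 1) (v + 1)) := hgc
  have hdc : ContinuousOn (fun x => discr (Y x)) (Set.Icc (u - 1) (v + 1)) := by
    simp only [discr_eq]
    exact (((hYc 0 0).sub (hYc 1 1)).pow 2).add ((continuousOn_const.mul (hYc 0 1)).mul (hYc 1 0))
  have hneg : ∀ x ∈ Set.Icc u v, discr (Y x) < 0 := by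
    intro x hx
    obtain ⟨d, hd, h⟩ := hΛ x hx
    have h1 : Tendsto (fun k => discr (Xmat a b N (k * N + i) x)) atTop (𝓝 (discr (Y x))) := by
      have hx' := hsub hx
      simp only [discr_eq]
      exact (((hten x hx' 0 0).sub (hten x hx' 1 1)).pow 2).add
        ((tendsto_const_nhds.mul (hten x hx' 0 1)).mul (hten x hx' 1 0))
    rw [tendsto_nhds_unique h1 h]; exact hd
  obtain ⟨δ, hδ, hδ1, hδn⟩ : ∃ δ > 0, δ ≤ 1 ∧ ∀ x ∈ Set.Icc (u - δ) (v + δ), discr (Y x) < 0 := by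
    let cl : ℝ → ℝ := fun x => max (u - 1) (min x (v + 1))
    have hcl : Continuous cl := by fun_prop
    have hclm : ∀ x, cl x ∈ Set.Icc (u - 1) (v + 1) := fun x =>
      ⟨le_max_left _ _, max_le (by linarith) (min_le_right _ _)⟩
    have hcle : ∀ x ∈ Set.Icc (u - 1) (v + 1), cl x = x := fun x hx => by
      simp only [cl]; rw [min_eq_left hx.2, max_eq_right hx.1]
    have hZ : Continuous fun x => discr (Y (cl x)) := hdc.comp_continuous hcl hclm
    have hop : IsOpen {x | discr (Y (cl x)) < 0} := isOpen_lt hZ continuous_const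
    obtain ⟨δ, hδ, hs⟩ := (isCompact_Icc (a := u) (b := v)).exists_cthickening_subset_open hop (by
      intro x hx
      change discr (Y (cl x)) < 0
      rw [hcle x (hsub hx)]; exact hneg x hx)
    refine ⟨min δ 1, by positivity, min_le_right _ _, fun x hx => ?_⟩
    have hx1 : x ∈ Set.Icc (u - 1) (v + 1) :=
      ⟨by linarith [hx.1, min_le_right δ 1], by linarith [hx.2, min_le_right δ 1]⟩
    have : x ∈ Metric.cthickening δ (Set.Icc u v) := by
      have hm := min_le_left δ 1
      rcases le_total x u with h | h
      · refine Metric.mem_cthickening_of_dist_le x u δ _ ⟨le_rfl, huv.le⟩ ?_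
        rw [Real.dist_eq, abs_le]; constructor <;> linarith [hx.1, hx.2]
      · rcases le_total x v with h' | h'
        · exact Metric.mem_cthickening_of_dist_le x x δ _ ⟨h, h'⟩ (by simpa using hδ.le)
        · refine Metric.mem_cthickening_of_dist_le x v δ _ ⟨huv.le, le_rfl⟩ ?_
          rw [Real.dist_eq, abs_le]; constructor <;> linarith [hx.1, hx.2]
    have h2 : discr (Y (cl x)) < 0 := hs this
    rwa [hcle x hx1] at h2
  have hsub2 : Set.Icc (u - δ) (v + δ) ⊆ Set.Icc (u - 1) (v + 1) :=
    Set.Icc_subset_Icc (by linarith) (by linarith)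
  obtain ⟨x0, hx0, hmax⟩ := (isCompact_Icc (a := u - δ) (b := v + δ)).exists_isMaxOn
    ⟨u, by constructor <;> linarith⟩ (hdc.mono hsub2)
  obtain ⟨R0, hR0⟩ : ∃ R0, ∀ r c, ∀ x ∈ Set.Icc (u - δ) (v + δ), |Y x r c| ≤ R0 := by
    have : ∀ r c, ∃ R0, ∀ x ∈ Set.Icc (u - δ) (v + δ), |Y x r c| ≤ R0 := fun r c =>
      isCompact_Icc.exists_bound_of_continuousOn ((hYc r c).mono hsub2)
    choose f hf using this
    refine ⟨∑ r, ∑ c, |f r c|, fun r c x hx => (hf r c x hx).trans ((le_abs_self _).trans ?_)⟩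
    refine le_trans ?_ (Finset.single_le_sum (f := fun r => ∑ c, |f r c|)
      (fun r _ => Finset.sum_nonneg fun _ _ => abs_nonneg _) (Finset.mem_univ r))
    exact Finset.single_le_sum (f := fun c => |f r c|) (fun _ _ => abs_nonneg _) (Finset.mem_univ c)
  have hR00 : 0 ≤ R0 := (abs_nonneg _).trans (hR0 0 0 x0 hx0)
  set τ := -discr (Y x0) with hτ
  have hτ0 : 0 < τ := by have := hδn x0 hx0; linarith
  have hmin : ∀ x ∈ Set.Icc (u - δ) (v + δ), τ ≤ -discr (Y x) := fun x hx => by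
    have : discr (Y x) ≤ discr (Y x0) := hmax hx
    linarith
  set R := R0 + 1
  have e1 : ∀ᶠ k in atTop, C * tailT a b N i u v k < min 1 (min (τ / 2 / (16 * R)) (1 / 2 / (4 * R))) :=
    hCT.eventually (gt_mem_nhds (by positivity))
  obtain ⟨M, hM⟩ := eventually_atTop.mp e1
  refine ⟨δ, hδ, τ / 2, by positivity, R, by positivity, C, hC, max M 1, le_max_right _ _, Y, hYX,
    fun x hx => ⟨⟨by linarith [hmin x hx], fun r c => (hR0 r c x hx).trans (by simp [R]), ?_, ?_⟩, hdet x (hsub2 hx)⟩,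
    fun k hk x hx => ?_, fun r c => (hYc r c).mono hsub2, fun k x hx r c => hinc k x (hsub2 hx) r c,
    fun k x hx r c => hg r c k x (hsub2 hx)⟩
  · rw [hdet x (hsub2 hx)]; norm_num
  · rw [hdet x (hsub2 hx)]; norm_num
  have hMk := hM k ((le_max_left _ _).trans hk)
  rw [lt_min_iff, lt_min_iff] at hMk
  obtain ⟨m1, m2, m3⟩ := hMk
  have hYR : ∀ r c, |Y x r c| ≤ R := fun r c => (hR0 r c x hx).trans (by simp [R])
  have hd : ∀ r c, |Xmat a b N (k * N + i) x r c - Y x r c| ≤ C * tailT a b N i u v k :=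
    fun r c => hg r c k x (hsub2 hx)
  have hXR : ∀ r c, |Xmat a b N (k * N + i) x r c| ≤ R := fun r c => by
    have h1 := hd r c
    have h2 := hR0 r c x hx
    rw [abs_le] at *
    simp only [R]
    constructor <;> linarith
  have hl1 := discr_lip hXR hYR hd
  have hl2 := det_lip hXR hYR hd
  rw [hdet x (hsub2 hx)] at hl2
  rw [lt_div_iff₀ (by positivity)] at m2 m3
  have := hmin x hx
  rw [abs_le] at hl1 hl2
  exact ⟨by linarith, hXR, by linarith, by linarith⟩



/-- eigenvalue in the upper half plane -/
def muC (A : Mat2) : ℂ := ⟨(A 0 0 + A 1 1) / 2, Real.sqrt (-discr A) / 2⟩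

/-- normalized eigenvalue -/
def lamC (A : Mat2) : ℂ := muC A / (Real.sqrt A.det : ℂ)

/-- pairing with the left eigenvector -/
def phiC (A : Mat2) (p q : ℝ) : ℂ := ⟨A 1 0 * p + (A 1 1 - A 0 0) / 2 * q, Real.sqrt (-discr A) / 2 * q⟩

lemma phiC_step (A : Mat2) (h : discr A ≤ 0) (p q : ℝ) :
    phiC A (A 0 0 * p + A 0 1 * q) (A 1 0 * p + A 1 1 * q) = muC A * phiC A p q := by
  have hs : Real.sqrt (-discr A) * Real.sqrt (-discr A) = -discr A := Real.mul_self_sqrt (by linarith)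
  rw [discr_eq] at hs
  rw [← discr_eq] at hs
  apply Complex.ext
  · simp only [phiC, muC, Complex.mul_re]
    have : Real.sqrt (-discr A) / 2 * (Real.sqrt (-discr A) / 2 * q) =
      (Real.sqrt (-discr A) * Real.sqrt (-discr A)) / 4 * q := by ring
    rw [this, hs, discr_eq]
    ring
  · simp only [phiC, muC, Complex.mul_im]
    ring

lemma phiC_smul (A : Mat2) (p q c : ℝ) : phiC A (p * c) (q * c) = phiC A p q * (c : ℂ) := by
  apply Complex.ext
  · simp only [phiC, Complex.mul_re, Complex.ofReal_re, Complex.ofReal_im]; ring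
  · simp only [phiC, Complex.mul_im, Complex.ofReal_re, Complex.ofReal_im]; ring

lemma phiC_normSq (A : Mat2) (h : discr A ≤ 0) (p q : ℝ) :
    ‖phiC A p q‖ ^ 2 = A 1 0 * (p * (A 1 0 * p + A 1 1 * q) - q * (A 0 0 * p + A 0 1 * q)) := by
  have hs : Real.sqrt (-discr A) * Real.sqrt (-discr A) = -discr A := Real.mul_self_sqrt (by linarith)
  rw [← Complex.normSq_eq_norm_sq, Complex.normSq_apply]
  simp only [phiC]
  have : Real.sqrt (-discr A) / 2 * q * (Real.sqrt (-discr A) / 2 * q) =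
      (Real.sqrt (-discr A) * Real.sqrt (-discr A)) / 4 * q ^ 2 := by ring
  rw [this, hs, discr_eq]
  ring

lemma muC_normSq (A : Mat2) (h : discr A ≤ 0) : ‖muC A‖ ^ 2 = A.det := by
  have hs : Real.sqrt (-discr A) * Real.sqrt (-discr A) = -discr A := Real.mul_self_sqrt (by linarith)
  rw [← Complex.normSq_eq_norm_sq, Complex.normSq_apply]
  simp only [muC]
  have : Real.sqrt (-discr A) / 2 * (Real.sqrt (-discr A) / 2) =
      (Real.sqrt (-discr A) * Real.sqrt (-discr A)) / 4 := by ring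
  rw [this, hs, discr_eq, Matrix.det_fin_two]
  ring

lemma Good.discr_neg {σ R : ℝ} (hσ : 0 < σ) {A : Mat2} (h : Good σ R A) : discr A < 0 := by
  have := h.1; linarith

lemma Good.det_pos {σ R : ℝ} {A : Mat2} (h : Good σ R A) : 0 < A.det := by
  have := h.2.2.1; linarith

lemma lamC_norm (A : Mat2) (h : discr A ≤ 0) (hd : 0 < A.det) : ‖lamC A‖ = 1 := by
  have h1 := muC_normSq A h
  have h2 : ‖muC A‖ = Real.sqrt A.det := by rw [← h1, Real.sqrt_sq (norm_nonneg _)]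
  rw [lamC, norm_div, h2, Complex.norm_real, Real.norm_eq_abs, abs_of_nonneg (Real.sqrt_nonneg _)]
  exact div_self (Real.sqrt_pos.mpr hd).ne'

lemma lamC_exp (A : Mat2) (h : discr A ≤ 0) (hd : 0 < A.det) :
    lamC A = Complex.exp ((Real.arccos (Matrix.trace A / (2 * Real.sqrt A.det)) : ℝ) * Complex.I) := by
  have hsd : 0 < Real.sqrt A.det := Real.sqrt_pos.mpr hd
  have hsq : Real.sqrt A.det ^ 2 = A.det := Real.sq_sqrt hd.le
  have hdis : (Matrix.trace A) ^ 2 - 4 * A.det ≤ 0 := h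
  have hb : |Matrix.trace A / (2 * Real.sqrt A.det)| ≤ 1 := by
    rw [← sq_le_one_iff_abs_le_one, div_pow, mul_pow, hsq, div_le_one (by positivity)]
    linarith
  rw [Complex.exp_mul_I, ← Complex.ofReal_cos, ← Complex.ofReal_sin, Real.cos_arccos (by linarith [(abs_le.mp hb).1])
    (abs_le.mp hb).2, Real.sin_arccos]
  have hsn : Real.sqrt (1 - (Matrix.trace A / (2 * Real.sqrt A.det)) ^ 2) =
      Real.sqrt (-discr A) / 2 / Real.sqrt A.det := by
    rw [Real.sqrt_eq_iff_mul_self_eq, ← sq, div_pow, div_pow, div_pow, mul_pow, hsq, Real.sq_sqrt (by linarith), discr]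
    · field_simp; ring
    · rw [sub_nonneg, sq_le_one_iff_abs_le_one]; exact hb
    · positivity
  rw [hsn]
  apply Complex.ext
  · rw [lamC, Complex.div_ofReal_re]
    rw [Complex.add_re, Complex.mul_I_re, Complex.ofReal_im, Complex.ofReal_re, Matrix.trace_fin_two]
    simp only [muC]
    field_simp
    simp
  · rw [lamC, Complex.div_ofReal_im]
    rw [Complex.add_im, Complex.mul_I_im, Complex.ofReal_im, Complex.ofReal_re]
    simp only [muC, zero_add]

lemma sqrt_discr_lip {σ R Δ : ℝ} (hσ : 0 < σ) {A B : Mat2} (hA : Good σ R A) (hB : Good σ R B)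
    (h : ∀ r c, |A r c - B r c| ≤ Δ) :
    |Real.sqrt (-discr A) - Real.sqrt (-discr B)| ≤ 16 * R / Real.sqrt σ * Δ := by
  have hl := discr_lip hA.2.1 hB.2.1 h
  have hs := Real.sqrt_pos.mpr hσ
  have h1 : Real.sqrt σ ≤ Real.sqrt (-discr A) := Real.sqrt_le_sqrt hA.1
  have h2 : Real.sqrt σ ≤ Real.sqrt (-discr B) := Real.sqrt_le_sqrt hB.1
  have e : (Real.sqrt (-discr A) - Real.sqrt (-discr B)) * (Real.sqrt (-discr A) + Real.sqrt (-discr B)) =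
      -(discr A - discr B) := by
    have a1 := Real.mul_self_sqrt (show 0 ≤ -discr A by linarith [hA.1])
    have a2 := Real.mul_self_sqrt (show 0 ≤ -discr B by linarith [hB.1])
    ring_nf at *
    linarith
  have e2 := congrArg abs e
  rw [abs_mul, abs_neg, abs_of_pos (by linarith : 0 < Real.sqrt (-discr A) + Real.sqrt (-discr B))] at e2
  rw [div_mul_eq_mul_div, le_div_iff₀ hs]
  have := abs_nonneg (Real.sqrt (-discr A) - Real.sqrt (-discr B))
  nlinarith

lemma phiC_lip {σ R Δ : ℝ} (hσ : 0 < σ) {A B : Mat2} (hA : Good σ R A) (hB : Good σ R B)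
    (h : ∀ r c, |A r c - B r c| ≤ Δ) (p q : ℝ) :
    ‖phiC A p q - phiC B p q‖ ≤ (1 + 8 * R / Real.sqrt σ) * Δ * (|p| + |q|) := by
  refine (Complex.norm_le_abs_re_add_abs_im _).trans ?_
  have hl := sqrt_discr_lip hσ hA hB h
  have hD : 0 ≤ Δ := (abs_nonneg _).trans (h 0 0)
  have hR : 0 ≤ R := (abs_nonneg _).trans (hA.2.1 0 0)
  simp only [phiC, Complex.sub_re, Complex.sub_im]
  have e1 : A 1 0 * p + (A 1 1 - A 0 0) / 2 * q - (B 1 0 * p + (B 1 1 - B 0 0) / 2 * q) =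
    (A 1 0 - B 1 0) * p + ((A 1 1 - B 1 1) - (A 0 0 - B 0 0)) / 2 * q := by ring
  have e2 : Real.sqrt (-discr A) / 2 * q - Real.sqrt (-discr B) / 2 * q =
    (Real.sqrt (-discr A) - Real.sqrt (-discr B)) / 2 * q := by ring
  rw [e1, e2]
  have b1 : |(A 1 0 - B 1 0) * p| ≤ Δ * |p| := by
    rw [abs_mul]; exact mul_le_mul_of_nonneg_right (h _ _) (abs_nonneg _)
  have b2 : |((A 1 1 - B 1 1) - (A 0 0 - B 0 0)) / 2 * q| ≤ Δ * |q| := by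
    rw [abs_mul]
    refine mul_le_mul_of_nonneg_right ?_ (abs_nonneg _)
    have h1 := h 1 1
    have h2 := h 0 0
    rw [abs_le] at *
    constructor <;> linarith
  have b3 : |(Real.sqrt (-discr A) - Real.sqrt (-discr B)) / 2 * q| ≤ 8 * R / Real.sqrt σ * Δ * |q| := by
    rw [abs_mul, abs_div, abs_two]
    refine mul_le_mul_of_nonneg_right ?_ (abs_nonneg _)
    have : 16 * R / Real.sqrt σ * Δ = 2 * (8 * R / Real.sqrt σ * Δ) := by ring
    linarith
  have b4 : 0 ≤ 8 * R / Real.sqrt σ * Δ * |p| := by positivity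
  refine (add_le_add ((abs_add_le _ _).trans (add_le_add b1 b2)) b3).trans ?_
  nlinarith

lemma phiC_lower {σ R : ℝ} (hσ : 0 < σ) {A : Mat2} (hA : Good σ R A) (p q : ℝ) :
    |p| + |q| ≤ (4 * R / σ * (1 + 2 * R / Real.sqrt σ) + 2 / Real.sqrt σ) * ‖phiC A p q‖ := by
  have hs := Real.sqrt_pos.mpr hσ
  have h1 : Real.sqrt σ ≤ Real.sqrt (-discr A) := Real.sqrt_le_sqrt hA.1
  have him := Complex.abs_im_le_norm (phiC A p q)
  have hre := Complex.abs_re_le_norm (phiC A p q)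
  have hR : 0 ≤ R := (abs_nonneg _).trans (hA.2.1 0 0)
  simp only [phiC] at him hre
  set n := ‖phiC A p q‖ with hn
  rw [← phiC, ← hn] at him hre
  have hn0 : 0 ≤ n := norm_nonneg _
  have hq : |q| ≤ 2 / Real.sqrt σ * n := by
    rw [abs_mul, abs_div, abs_two, abs_of_nonneg (Real.sqrt_nonneg _)] at him
    rw [div_mul_eq_mul_div, le_div_iff₀ hs]
    nlinarith [abs_nonneg q]
  have hA10 : σ ≤ 4 * R * |A 1 0| := by
    have := hA.1
    rw [discr_eq] at this
    have h2 : |4 * A 0 1 * A 1 0| ≤ 4 * R * |A 1 0| := by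
      rw [abs_mul, abs_mul, abs_of_pos (by norm_num : (0 : ℝ) < 4)]
      have := hA.2.1 0 1
      gcongr
    have h3 := neg_abs_le (4 * A 0 1 * A 1 0)
    nlinarith [sq_nonneg (A 0 0 - A 1 1)]
  have hp1 : |A 1 0| * |p| ≤ n + R * |q| := by
    rw [← abs_mul]
    have e : A 1 0 * p = (A 1 0 * p + (A 1 1 - A 0 0) / 2 * q) - (A 1 1 - A 0 0) / 2 * q := by ring
    rw [e]
    refine (abs_sub _ _).trans (add_le_add hre ?_)
    rw [abs_mul]
    refine mul_le_mul_of_nonneg_right ?_ (abs_nonneg _)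
    have h1 := hA.2.1 1 1
    have h2 := hA.2.1 0 0
    rw [abs_le] at *
    constructor <;> linarith
  have hp : |p| ≤ 4 * R / σ * (1 + 2 * R / Real.sqrt σ) * n := by
    have h5 : R * |q| ≤ R * (2 / Real.sqrt σ * n) := mul_le_mul_of_nonneg_left hq hR
    have h6 : |A 1 0| * |p| ≤ (1 + 2 * R / Real.sqrt σ) * n := by
      have : R * (2 / Real.sqrt σ * n) = 2 * R / Real.sqrt σ * n := by ring
      linarith
    have e : 4 * R / σ * (1 + 2 * R / Real.sqrt σ) * n = (4 * R * ((1 + 2 * R / Real.sqrt σ) * n)) / σ := by ring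
    rw [e, le_div_iff₀ hσ]
    calc |p| * σ ≤ |p| * (4 * R * |A 1 0|) := mul_le_mul_of_nonneg_left hA10 (abs_nonneg _)
      _ = 4 * R * (|A 1 0| * |p|) := by ring
      _ ≤ _ := mul_le_mul_of_nonneg_left h6 (by positivity)
  rw [add_mul]
  exact add_le_add hp hq

lemma phiC_rec (σ R : ℝ) (hσ : 0 < σ) (hR : 0 < R) : ∃ C > 0, ∀ (A B : Mat2) (Δ p q p' q' : ℝ),
    Good σ R A → Good σ R B → (∀ r c, |A r c - B r c| ≤ Δ) →
    p' = (A 0 0 * p + A 0 1 * q) / Real.sqrt A.det → q' = (A 1 0 * p + A 1 1 * q) / Real.sqrt A.det →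
    ‖phiC B p' q' - lamC A * phiC A p q‖ ≤ C * Δ * ‖phiC A p q‖ ∧
    ‖phiC B p' q' - lamC A * phiC A p q‖ ≤ C * Δ * ‖phiC B p' q'‖ := by
  have hs := Real.sqrt_pos.mpr hσ
  set C1 := 1 + 8 * R / Real.sqrt σ with hC1
  set C2 := 4 * R / σ * (1 + 2 * R / Real.sqrt σ) + 2 / Real.sqrt σ with hC2
  have h1 : 0 < C1 := by positivity
  have h2 : 0 < C2 := by positivity
  refine ⟨C1 * C2 * (1 + 4 * R), by positivity, fun A B Δ p q p' q' hA hB h hp hq => ?_⟩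
  have hD : 0 ≤ Δ := (abs_nonneg _).trans (h 0 0)
  have e : lamC A * phiC A p q = phiC A p' q' := by
    rw [hp, hq, div_eq_mul_inv, div_eq_mul_inv, phiC_smul, phiC_step A (hA.discr_neg hσ).le, lamC]
    push_cast
    ring
  rw [e]
  have hl := phiC_lip hσ hB hA (fun r c => by rw [abs_sub_comm]; exact h r c) p' q'
  rw [← hC1] at hl
  have l1 := phiC_lower hσ hA p q
  have l2 := phiC_lower hσ hB p' q'
  rw [← hC2] at l1 l2
  have hsd : 1 / 2 ≤ Real.sqrt A.det := by
    rw [Real.le_sqrt' (by norm_num)]; have := hA.2.2.1; linarith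
  have hb : |p'| + |q'| ≤ 4 * R * (|p| + |q|) := by
    rw [hp, hq, abs_div, abs_div, ← add_div, abs_of_nonneg (Real.sqrt_nonneg A.det), div_le_iff₀ (by linarith)]
    have t1 : |A 0 0 * p + A 0 1 * q| ≤ R * (|p| + |q|) := by
      refine (abs_add_le _ _).trans ?_
      rw [abs_mul, abs_mul, mul_add]
      have := hA.2.1 0 0
      have := hA.2.1 0 1
      gcongr
    have t2 : |A 1 0 * p + A 1 1 * q| ≤ R * (|p| + |q|) := by
      refine (abs_add_le _ _).trans ?_
      rw [abs_mul, abs_mul, mul_add]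
      have := hA.2.1 1 0
      have := hA.2.1 1 1
      gcongr
    have : 0 ≤ 4 * R * (|p| + |q|) := by positivity
    nlinarith
  have n1 := norm_nonneg (phiC A p q)
  have n2 := norm_nonneg (phiC B p' q')
  constructor
  · refine hl.trans ?_
    calc C1 * Δ * (|p'| + |q'|) ≤ C1 * Δ * (4 * R * (C2 * ‖phiC A p q‖)) := by
          refine mul_le_mul_of_nonneg_left (hb.trans ?_) (by positivity)
          exact mul_le_mul_of_nonneg_left l1 (by positivity)
      _ = C1 * C2 * (4 * R) * Δ * ‖phiC A p q‖ := by ring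
      _ ≤ _ := by gcongr; linarith
  · refine hl.trans ?_
    calc C1 * Δ * (|p'| + |q'|) ≤ C1 * Δ * (C2 * ‖phiC B p' q'‖) := by gcongr
      _ = C1 * C2 * 1 * Δ * ‖phiC B p' q'‖ := by ring
      _ ≤ _ := by gcongr; linarith



lemma growth_up (M : ℕ) (f e : ℕ → ℝ) (C : ℝ) (hC : 0 ≤ C) (he0 : ∀ k, 0 ≤ e k) (he : Summable e)
    (hf0 : ∀ k, 0 ≤ f k)
    (h : ∀ k ≥ M, f (k + 1) ≤ (1 + C * e k) * f k) (k : ℕ) (hk : M ≤ k) :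
    f k ≤ Real.exp (C * ∑' j, e j) * f M := by
  have key : ∀ k ≥ M, f k ≤ Real.exp (C * ∑ j ∈ Finset.range k, e j) * f M := by
    intro k hk
    induction k, hk using Nat.le_induction with
    | base =>
      have : 1 ≤ Real.exp (C * ∑ j ∈ Finset.range M, e j) :=
        Real.one_le_exp (mul_nonneg hC (Finset.sum_nonneg fun _ _ => he0 _))
      nlinarith [hf0 M]
    | succ k hk ih =>
      have h1 : 1 + C * e k ≤ Real.exp (C * e k) := by linarith [Real.add_one_le_exp (C * e k)]
      rw [Finset.sum_range_succ, mul_add, Real.exp_add]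
      calc f (k + 1) ≤ (1 + C * e k) * f k := h k hk
        _ ≤ Real.exp (C * e k) * (Real.exp (C * ∑ j ∈ Finset.range k, e j) * f M) := by
            have := hf0 k
            gcongr
        _ = _ := by ring
  refine (key k hk).trans ?_
  have := hf0 M
  gcongr
  exact he.sum_le_tsum _ fun _ _ => he0 _

lemma growth_down (M : ℕ) (f e : ℕ → ℝ) (C : ℝ) (hC : 0 ≤ C) (he0 : ∀ k, 0 ≤ e k) (he : Summable e)
    (hf0 : ∀ k, 0 ≤ f k)
    (h : ∀ k ≥ M, f k ≤ (1 + C * e k) * f (k + 1)) (k : ℕ) (hk : M ≤ k) :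
    f M ≤ Real.exp (C * ∑' j, e j) * f k := by
  have key : ∀ k ≥ M, f M ≤ Real.exp (C * ∑ j ∈ Finset.range k, e j) * f k := by
    intro k hk
    induction k, hk using Nat.le_induction with
    | base =>
      have : 1 ≤ Real.exp (C * ∑ j ∈ Finset.range M, e j) :=
        Real.one_le_exp (mul_nonneg hC (Finset.sum_nonneg fun _ _ => he0 _))
      nlinarith [hf0 M]
    | succ k hk ih =>
      have h1 : 1 + C * e k ≤ Real.exp (C * e k) := by linarith [Real.add_one_le_exp (C * e k)]
      rw [Finset.sum_range_succ, mul_add, Real.exp_add]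
      calc f M ≤ Real.exp (C * ∑ j ∈ Finset.range k, e j) * f k := ih
        _ ≤ Real.exp (C * ∑ j ∈ Finset.range k, e j) * (Real.exp (C * e k) * f (k + 1)) := by
            have := hf0 (k + 1)
            have h2 := h k hk
            gcongr
            refine h2.trans ?_
            gcongr
        _ = _ := by ring
  refine (key k hk).trans ?_
  have := hf0 k
  gcongr
  exact he.sum_le_tsum _ fun _ _ => he0 _

lemma discr_contOn {S : Set ℝ} {A : ℝ → Mat2} (h : ∀ r c, ContinuousOn (fun x => A x r c) S) :
    ContinuousOn (fun x => discr (A x)) S := by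
  simp only [discr_eq]
  exact (((h 0 0).sub (h 1 1)).pow 2).add ((continuousOn_const.mul (h 0 1)).mul (h 1 0))

lemma det_contOn {S : Set ℝ} {A : ℝ → Mat2} (h : ∀ r c, ContinuousOn (fun x => A x r c) S) :
    ContinuousOn (fun x => (A x).det) S := by
  simp only [Matrix.det_fin_two]
  exact ((h 0 0).mul (h 1 1)).sub ((h 0 1).mul (h 1 0))

lemma complex_contOn {S : Set ℝ} {f g : ℝ → ℝ} (hf : ContinuousOn f S) (hg : ContinuousOn g S) :
    ContinuousOn (fun x => (⟨f x, g x⟩ : ℂ)) S := by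
  have : (fun x => (⟨f x, g x⟩ : ℂ)) = fun x => (f x : ℂ) + (g x : ℂ) * Complex.I := by
    funext x; apply Complex.ext <;> simp
  rw [this]
  exact (Complex.continuous_ofReal.comp_continuousOn hf).add
    ((Complex.continuous_ofReal.comp_continuousOn hg).mul continuousOn_const)

lemma muC_contOn {S : Set ℝ} {A : ℝ → Mat2} (h : ∀ r c, ContinuousOn (fun x => A x r c) S) :
    ContinuousOn (fun x => muC (A x)) S := by
  refine complex_contOn (((h 0 0).add (h 1 1)).div_const 2) ?_
  exact ((discr_contOn h).neg.sqrt).div_const 2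

lemma phiC_contOn {S : Set ℝ} {A : ℝ → Mat2} (h : ∀ r c, ContinuousOn (fun x => A x r c) S)
    {p q : ℝ → ℝ} (hp : ContinuousOn p S) (hq : ContinuousOn q S) :
    ContinuousOn (fun x => phiC (A x) (p x) (q x)) S := by
  refine complex_contOn (((h 1 0).mul hp).add ((((h 1 1).sub (h 0 0)).div_const 2).mul hq)) ?_
  exact ((((discr_contOn h).neg.sqrt).div_const 2).mul hq)

lemma lamC_contOn {S : Set ℝ} {A : ℝ → Mat2} (h : ∀ r c, ContinuousOn (fun x => A x r c) S)
    (hd : ∀ x ∈ S, 0 < (A x).det) :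
    ContinuousOn (fun x => lamC (A x)) S := by
  refine (muC_contOn h).div (Complex.continuous_ofReal.comp_continuousOn (det_contOn h).sqrt) ?_
  intro x hx
  exact_mod_cast (Real.sqrt_pos.mpr (hd x hx)).ne'

lemma psi_exists (S : Set ℝ) (hS : IsCompact S) (X : ℕ → ℝ → Mat2) (p q : ℕ → ℝ → ℝ) (M : ℕ) (e : ℕ → ℝ)
    (he0 : ∀ k, 0 ≤ e k) (he : Summable e) (σ R : ℝ) (hσ : 0 < σ) (hR : 0 < R)
    (hG : ∀ k ≥ M, ∀ x ∈ S, Good σ R (X k x))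
    (hXc : ∀ k r c, ContinuousOn (fun x => X k x r c) S)
    (hpc : ∀ k, ContinuousOn (p k) S) (hqc : ∀ k, ContinuousOn (q k) S)
    (hΔ : ∀ k ≥ M, ∀ x ∈ S, ∀ r c, |X (k + 1) x r c - X k x r c| ≤ e k)
    (hp : ∀ k ≥ M, ∀ x ∈ S, p (k + 1) x = (X k x 0 0 * p k x + X k x 0 1 * q k x) / Real.sqrt (X k x).det)
    (hq : ∀ k ≥ M, ∀ x ∈ S, q (k + 1) x = (X k x 1 0 * p k x + X k x 1 1 * q k x) / Real.sqrt (X k x).det)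
    (hne : ∀ x ∈ S, p M x ≠ 0 ∨ q M x ≠ 0) :
    ∃ ψ : ℝ → ℂ, ContinuousOn ψ S ∧ (∀ x ∈ S, ψ x ≠ 0) ∧ ∃ C > 0, ∀ k ≥ M, ∀ x ∈ S,
      ‖phiC (X k x) (p k x) (q k x) - ψ x * ∏ j ∈ Finset.Ico M k, lamC (X j x)‖ ≤ C * ∑' m, e (k + m) := by
  obtain ⟨C, hC, hrec⟩ := phiC_rec σ R hσ hR
  set φ : ℕ → ℝ → ℂ := fun k x => phiC (X k x) (p k x) (q k x) with hφ
  have hr : ∀ k ≥ M, ∀ x ∈ S, ‖φ (k + 1) x - lamC (X k x) * φ k x‖ ≤ C * e k * ‖φ k x‖ ∧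
      ‖φ (k + 1) x - lamC (X k x) * φ k x‖ ≤ C * e k * ‖φ (k + 1) x‖ := fun k hk x hx =>
    hrec (X k x) (X (k + 1) x) (e k) (p k x) (q k x) _ _ (hG k hk x hx) (hG (k + 1) (by omega) x hx)
      (fun r c => by rw [abs_sub_comm]; exact hΔ k hk x hx r c) (hp k hk x hx) (hq k hk x hx)
  have hlam : ∀ k ≥ M, ∀ x ∈ S, ‖lamC (X k x)‖ = 1 := fun k hk x hx =>
    lamC_norm _ ((hG k hk x hx).discr_neg hσ).le (hG k hk x hx).det_pos
  have hup : ∀ x ∈ S, ∀ k ≥ M, ‖φ k x‖ ≤ Real.exp (C * ∑' j, e j) * ‖φ M x‖ := fun x hx k hk =>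
    growth_up M (fun k => ‖φ k x‖) e C hC.le he0 he (fun _ => norm_nonneg _) (fun k hk => by
      have h1 := (hr k hk x hx).1
      have h2 := norm_sub_norm_le (φ (k + 1) x) (lamC (X k x) * φ k x)
      rw [norm_mul, hlam k hk x hx] at h2
      linarith) k hk
  have hdn : ∀ x ∈ S, ∀ k ≥ M, ‖φ M x‖ ≤ Real.exp (C * ∑' j, e j) * ‖φ k x‖ := fun x hx k hk =>
    growth_down M (fun k => ‖φ k x‖) e C hC.le he0 he (fun _ => norm_nonneg _) (fun k hk => by
      have h1 := (hr k hk x hx).2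
      have h2 := norm_sub_norm_le (lamC (X k x) * φ k x) (φ (k + 1) x)
      rw [norm_mul, hlam k hk x hx, norm_sub_rev] at h2
      linarith) k hk
  have hφc : ∀ k, ContinuousOn (φ k) S := fun k => phiC_contOn (hXc k) (hpc k) (hqc k)
  obtain ⟨B, hB⟩ := hS.exists_bound_of_continuousOn (hφc M)
  set B' := max B 1
  set E := Real.exp (C * ∑' j, e j)
  set D := C * (E * B')
  have hE : 0 < E := Real.exp_pos _
  have hB' : 0 < B' := by positivity
  have hD : 0 < D := by positivity
  set P : ℕ → ℝ → ℂ := fun k x => ∏ j ∈ Finset.Ico M k, lamC (X j x) with hP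
  have hPn : ∀ k, ∀ x ∈ S, ‖P k x‖ = 1 := fun k x hx => by
    simp only [hP, norm_prod]
    exact Finset.prod_eq_one fun j hj => hlam j (Finset.mem_Ico.mp hj).1 x hx
  have hPne : ∀ k, ∀ x ∈ S, P k x ≠ 0 := fun k x hx h => by
    have := hPn k x hx; rw [h] at this; simp at this
  have hPs : ∀ k ≥ M, ∀ x, P (k + 1) x = P k x * lamC (X k x) := fun k hk x => by
    simp only [hP]; rw [Finset.prod_Ico_succ_top hk]
  have hPc : ∀ k, ContinuousOn (P k) S := fun k => by
    refine continuousOn_finsetProd _ fun j hj => ?_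
    exact lamC_contOn (hXc j) fun x hx => (hG j (Finset.mem_Ico.mp hj).1 x hx).det_pos
  obtain ⟨ψ, hψc, hψ⟩ := tail_limit S M (fun k x => φ k x / P k x) (fun k => D * e k) (he.mul_left D)
    (fun k hk x hx => by
      have hl : lamC (X k x) ≠ 0 := fun h => by have := hlam k hk x hx; rw [h] at this; simp at this
      have : φ (k + 1) x / P (k + 1) x - φ k x / P k x = (φ (k + 1) x - lamC (X k x) * φ k x) / P (k + 1) x := by
        rw [hPs k hk]
        have := hPne k x hx
        field_simp
      rw [this, norm_div, hPn _ x hx, div_one]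
      refine (hr k hk x hx).1.trans ?_
      have h1 := (hup x hx k hk).trans (mul_le_mul_of_nonneg_left ((hB x hx).trans (le_max_left B 1)) hE.le)
      have := he0 k
      calc C * e k * ‖φ k x‖ ≤ C * e k * (E * B') := by gcongr
        _ = _ := by ring) (fun k => (hφc k).div (hPc k) (hPne k))
  have hfin : ∀ k ≥ M, ∀ x ∈ S, ‖φ k x - ψ x * P k x‖ ≤ D * ∑' m, e (k + m) := by
    intro k hk x hx
    have h1 := hψ k hk x hx
    rw [tsum_mul_left] at h1
    have h2 : φ k x - ψ x * P k x = (φ k x / P k x - ψ x) * P k x := by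
      have := hPne k x hx
      field_simp
    rw [h2, norm_mul, hPn k x hx, mul_one]
    exact h1
  refine ⟨ψ, hψc, fun x hx h0 => ?_, D, hD, hfin⟩
  have hpos : 0 < ‖φ M x‖ := by
    rw [norm_pos_iff]
    intro h
    have h1 := phiC_lower hσ (hG M le_rfl x hx) (p M x) (q M x)
    have h2 : phiC (X M x) (p M x) (q M x) = 0 := h
    rw [h2, norm_zero, mul_zero] at h1
    rcases hne x hx with h3 | h3
    · have := abs_pos.mpr h3; linarith [abs_nonneg (q M x)]
    · have := abs_pos.mpr h3; linarith [abs_nonneg (p M x)]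
  have ht : Tendsto (fun k => D * ∑' m, e (k + m)) atTop (𝓝 0) := by
    have := (tendsto_sum_nat_add e).const_mul D
    simpa [add_comm] using this
  have h3 : ∀ᶠ k in atTop, ‖φ M x‖ / E ≤ D * ∑' m, e (k + m) := by
    filter_upwards [eventually_ge_atTop M] with k hk
    have h4 := hfin k hk x hx
    rw [h0, zero_mul, sub_zero] at h4
    refine le_trans ?_ h4
    rw [div_le_iff₀ hE, mul_comm]
    exact hdn x hx k hk
  have h5 := ge_of_tendsto ht h3
  have : 0 < ‖φ M x‖ / E := by positivity
  linarith



lemma transfer (a b : ℕ → ℝ) (ha : ∀ n, 0 < a n) (m : ℕ) (hm : 1 ≤ m) (x : ℝ) (len : ℕ) :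
    prodD (fun j => Bmat a b j x) m len 0 0 * opoly a b (m - 1) x +
      prodD (fun j => Bmat a b j x) m len 0 1 * opoly a b m x = opoly a b (m + len - 1) x ∧
    prodD (fun j => Bmat a b j x) m len 1 0 * opoly a b (m - 1) x +
      prodD (fun j => Bmat a b j x) m len 1 1 * opoly a b m x = opoly a b (m + len) x := by
  induction len with
  | zero => simp [prodD]
  | succ len ih =>
    obtain ⟨h1, h2⟩ := ih
    constructor
    · rw [prodD, Matrix.mul_apply, Matrix.mul_apply, Fin.sum_univ_two, Fin.sum_univ_two]
      simp only [Bmat]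
      simp only [Matrix.of_apply, Matrix.cons_val', Matrix.cons_val_zero, Matrix.cons_val_one, Matrix.cons_val_fin_one]
      rw [show m + (len + 1) - 1 = m + len by omega, ← h2]
      simp only [Bmat]
      ring
    · rw [prodD, Matrix.mul_apply, Matrix.mul_apply, Fin.sum_univ_two, Fin.sum_univ_two]
      obtain ⟨l, hl⟩ : ∃ l, m + len = l + 1 := ⟨m + len - 1, by omega⟩
      rw [hl] at h1 h2
      rw [show m + (len + 1) = l + 2 by omega, hl]
      rw [show l + 1 - 1 = l by omega] at h1
      have e0 : opoly a b (l + 2) x =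
        ((x - b (l + 1)) * opoly a b (l + 1) x - a l * opoly a b l x) / a (l + 1) := rfl
      rw [e0, ← h1, ← h2]
      have := (ha (l + 1)).ne'
      simp only [Bmat]
      simp only [Matrix.of_apply, Matrix.cons_val', Matrix.cons_val_zero, Matrix.cons_val_one,
        Matrix.cons_val_fin_one, Nat.add_sub_cancel]
      field_simp
      ring

lemma cont_arg (u v : ℝ) (huv : u < v) (ψ : ℝ → ℂ) (hc : ContinuousOn ψ (Set.Icc u v))
    (h0 : ∀ x ∈ Set.Icc u v, ψ x ≠ 0) :
    ∃ η : ℝ → ℝ, ContinuousOn η (Set.Icc u v) ∧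
      ∀ x ∈ Set.Icc u v, ψ x = (‖ψ x‖ : ℂ) * Complex.exp ((η x : ℂ) * Complex.I) := by
  have hm : ∀ t : unitInterval, u + (t : ℝ) * (v - u) ∈ Set.Icc u v := fun t => by
    have h1 := t.2.1
    have h2 := t.2.2
    constructor <;> nlinarith
  have hcc : Continuous fun t : unitInterval => ψ (u + (t : ℝ) * (v - u)) :=
    hc.comp_continuous (by fun_prop) hm
  let γ : C(unitInterval, Circle) := ⟨fun t => ⟨ψ (u + (t : ℝ) * (v - u)) / (‖ψ (u + (t : ℝ) * (v - u))‖ : ℂ), by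
      rw [Submonoid.unitSphere, ← SetLike.mem_coe]
      simp [h0 _ (hm t)]⟩, by
      refine Continuous.subtype_mk ?_ _
      refine hcc.div (Complex.continuous_ofReal.comp hcc.norm) fun t => ?_
      simpa using h0 _ (hm t)⟩
  obtain ⟨Γ, hΓ, -⟩ := Circle.isCoveringMap_exp.exists_path_lifts γ (Complex.arg (γ 0))
    (by rw [Circle.exp_arg])
  refine ⟨fun x => Γ (Set.projIcc 0 1 zero_le_one ((x - u) / (v - u))), ?_, fun x hx => ?_⟩
  · apply Continuous.continuousOn
    exact Γ.continuous.comp (continuous_projIcc.comp (by fun_prop))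
  · have hd : 0 < v - u := by linarith
    have hxm : (x - u) / (v - u) ∈ Set.Icc (0 : ℝ) 1 :=
      ⟨div_nonneg (by linarith [hx.1]) hd.le, by rw [div_le_one hd]; linarith [hx.2]⟩
    have h1 := congrFun hΓ (Set.projIcc 0 1 zero_le_one ((x - u) / (v - u)))
    rw [Function.comp] at h1
    have h2 := congrArg (fun z : Circle => (z : ℂ)) h1
    simp only [Circle.coe_exp] at h2
    rw [h2, Set.projIcc_of_mem _ hxm]
    have e : u + (x - u) / (v - u) * (v - u) = x := by field_simp; ring
    change ψ x = _ * (ψ (u + (x - u) / (v - u) * (v - u)) / (‖ψ (u + (x - u) / (v - u) * (v - u))‖ : ℂ))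
    rw [e]
    have : (‖ψ x‖ : ℂ) ≠ 0 := by simpa using h0 x hx
    field_simp

lemma lamC_lip {σ R Δ : ℝ} (hσ : 0 < σ) (hR : 0 < R) {A Y : Mat2} (hA : Good σ R A) (hY : Good σ R Y)
    (hd : Y.det = 1) (h : ∀ r c, |A r c - Y r c| ≤ Δ) :
    |1 - Real.sqrt A.det| ≤ 4 * R * Δ ∧
    ‖lamC A - lamC Y‖ ≤ (1 + 8 * R / Real.sqrt σ + 4 * R) * Δ := by
  have hl := det_lip hA.2.1 hY.2.1 h
  rw [hd] at hl
  have hs := Real.sqrt_pos.mpr hA.det_pos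
  have hsq := Real.sq_sqrt hA.det_pos.le
  have h1 : |1 - Real.sqrt A.det| ≤ 4 * R * Δ := by
    refine le_trans ?_ hl
    have e : A.det - 1 = -((1 - Real.sqrt A.det) * (1 + Real.sqrt A.det)) := by nlinarith
    rw [e, abs_neg, abs_mul, abs_of_pos (by linarith : 0 < 1 + Real.sqrt A.det)]
    nlinarith [abs_nonneg (1 - Real.sqrt A.det)]
  refine ⟨h1, ?_⟩
  have hmu : ‖muC A - muC Y‖ ≤ (1 + 8 * R / Real.sqrt σ) * Δ := by
    refine (Complex.norm_le_abs_re_add_abs_im _).trans ?_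
    simp only [muC, Complex.sub_re, Complex.sub_im]
    have b1 : |(A 0 0 + A 1 1) / 2 - (Y 0 0 + Y 1 1) / 2| ≤ Δ := by
      have h1 := h 0 0
      have h2 := h 1 1
      rw [abs_le] at *
      constructor <;> linarith
    have b2 := sqrt_discr_lip hσ hA hY h
    have b3 : |Real.sqrt (-discr A) / 2 - Real.sqrt (-discr Y) / 2| ≤ 8 * R / Real.sqrt σ * Δ := by
      rw [← sub_div, abs_div, abs_two]
      have : 16 * R / Real.sqrt σ * Δ = 2 * (8 * R / Real.sqrt σ * Δ) := by ring
      linarith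
    linarith
  have e : lamC A - lamC Y = (muC A - muC Y) + lamC A * ((1 - Real.sqrt A.det : ℝ) : ℂ) := by
    have hne : (Real.sqrt A.det : ℂ) ≠ 0 := by exact_mod_cast hs.ne'
    simp only [lamC]
    rw [hd]
    push_cast
    simp
    field_simp
    ring
  rw [e]
  refine (norm_add_le _ _).trans ?_
  rw [norm_mul, lamC_norm A (hA.discr_neg hσ).le hA.det_pos, one_mul, Complex.norm_real, Real.norm_eq_abs]
  linarith

lemma final_pt (σ R : ℝ) (hσ : 0 < σ) (hR : 0 < R) : ∃ C > 0, ∀ (A Y : Mat2) (Δ τ p q : ℝ) (z : ℂ),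
    Good σ R A → Good σ R Y → Y.det = 1 → (∀ r c, |A r c - Y r c| ≤ Δ) →
    ‖phiC A p q - z * (starRingEnd ℂ) (lamC A)‖ ≤ τ →
    |q / Real.sqrt A.det - 2 / Real.sqrt (-discr Y) * (z * (starRingEnd ℂ) (lamC Y)).im| ≤ C * (τ + ‖z‖ * Δ) := by
  have hs := Real.sqrt_pos.mpr hσ
  set L1 := 1 + 8 * R / Real.sqrt σ + 4 * R with hL1
  set L2 := 16 * R / Real.sqrt σ + 12 * R with hL2
  have hL10 : 0 < L1 := by positivity
  have hL20 : 0 < L2 := by positivity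
  refine ⟨4 / Real.sqrt σ * (1 + L1) + 4 / σ * L2, by positivity, fun A Y Δ τ p q z hA hY hd h hτ => ?_⟩
  have hD : 0 ≤ Δ := (abs_nonneg _).trans (h 0 0)
  have hτ0 : 0 ≤ τ := (norm_nonneg _).trans hτ
  obtain ⟨l1, l2⟩ := lamC_lip hσ hR hA hY hd h
  rw [← hL1] at l2
  have l3 := sqrt_discr_lip hσ hA hY h
  set sA := Real.sqrt (-discr A) with hsA
  set sY := Real.sqrt (-discr Y) with hsY
  set rd := Real.sqrt A.det with hrd
  have hrd2 : 1 / 2 ≤ rd := by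
    rw [hrd, Real.le_sqrt' (by norm_num)]; have := hA.2.2.1; linarith
  have hsA1 : Real.sqrt σ ≤ sA := Real.sqrt_le_sqrt hA.1
  have hsY1 : Real.sqrt σ ≤ sY := Real.sqrt_le_sqrt hY.1
  have hsA3 : sA ≤ 3 := by
    rw [hsA, Real.sqrt_le_left (by norm_num), discr]
    nlinarith [hA.2.2.2, sq_nonneg (Matrix.trace A)]
  have him : (phiC A p q).im = sA / 2 * q := rfl
  set zA := z * (starRingEnd ℂ) (lamC A)
  set zY := z * (starRingEnd ℂ) (lamC Y) with hzY
  have hzz : ‖zA - zY‖ ≤ ‖z‖ * (L1 * Δ) := by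
    rw [← mul_sub, ← map_sub, norm_mul, Complex.norm_conj]
    exact mul_le_mul_of_nonneg_left l2 (norm_nonneg _)
  have hzYn : ‖zY‖ = ‖z‖ := by
    rw [hzY, norm_mul, Complex.norm_conj, lamC_norm Y (hY.discr_neg hσ).le hY.det_pos, mul_one]
  have hA1 : 0 < sA := hs.trans_le hsA1
  have hY1 : 0 < sY := hs.trans_le hsY1
  have hr1 : 0 < rd := by linarith
  have e : q / rd - 2 / sY * zY.im = 2 / (sA * rd) * ((phiC A p q - zA).im + (zA - zY).im) +
      2 * zY.im * ((sY - sA * rd) / (sA * rd * sY)) := by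
    rw [Complex.sub_im, Complex.sub_im, him]
    field_simp
    ring
  rw [e]
  have c1 : |2 / (sA * rd) * ((phiC A p q - zA).im + (zA - zY).im)| ≤ 4 / Real.sqrt σ * (τ + ‖z‖ * (L1 * Δ)) := by
    rw [abs_mul, abs_of_pos (by positivity : 0 < 2 / (sA * rd))]
    refine mul_le_mul ?_ ?_ (abs_nonneg _) (by positivity)
    · rw [div_le_div_iff₀ (by positivity) hs]
      nlinarith
    · refine (abs_add_le _ _).trans (add_le_add ((Complex.abs_im_le_norm _).trans hτ) ((Complex.abs_im_le_norm _).trans hzz))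
  have c2 : |sY - sA * rd| ≤ L2 * Δ := by
    have e2 : sY - sA * rd = -(sA - sY) + sA * (1 - rd) := by ring
    rw [e2]
    refine (abs_add_le _ _).trans ?_
    rw [abs_neg, abs_mul, abs_of_pos hA1]
    have : sA * |1 - rd| ≤ 3 * (4 * R * Δ) := mul_le_mul hsA3 l1 (abs_nonneg _) (by norm_num)
    rw [hL2, add_mul]
    linarith
  have c3 : |2 * zY.im * ((sY - sA * rd) / (sA * rd * sY))| ≤ 4 / σ * L2 * (‖z‖ * Δ) := by
    rw [abs_mul, abs_mul, abs_two, abs_div, abs_of_pos (by positivity : 0 < sA * rd * sY)]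
    have t1 : |zY.im| ≤ ‖z‖ := (Complex.abs_im_le_norm _).trans hzYn.le
    have t2 : |sY - sA * rd| / (sA * rd * sY) ≤ 2 / σ * (L2 * Δ) := by
      rw [div_le_iff₀ (by positivity)]
      have t3 : σ ≤ sA * sY := by
        have := mul_le_mul hsA1 hsY1 hs.le hA1.le
        rwa [Real.mul_self_sqrt hσ.le] at this
      have t4 : σ / 2 ≤ sA * rd * sY := by nlinarith
      have t5 : 1 ≤ 2 / σ * (sA * rd * sY) := by
        rw [div_mul_eq_mul_div, le_div_iff₀ hσ]; linarith
      have : 0 ≤ L2 * Δ := by positivity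
      nlinarith
    calc 2 * |zY.im| * (|sY - sA * rd| / (sA * rd * sY)) ≤ 2 * ‖z‖ * (2 / σ * (L2 * Δ)) := by gcongr
      _ = _ := by ring
  refine (abs_add_le _ _).trans ((add_le_add c1 c3).trans ?_)
  have n1 : 0 ≤ ‖z‖ * Δ := by positivity
  have n2 : 0 ≤ 4 / Real.sqrt σ := by positivity
  have n3 : 0 ≤ 4 / σ * L2 := by positivity
  have e3 : (4 / Real.sqrt σ * (1 + L1) + 4 / σ * L2) * (τ + ‖z‖ * Δ) =
    4 / Real.sqrt σ * (τ + ‖z‖ * (L1 * Δ)) + 4 / σ * L2 * (‖z‖ * Δ) +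
     (4 / Real.sqrt σ * (‖z‖ * Δ) + 4 / Real.sqrt σ * L1 * τ + 4 / σ * L2 * τ) := by ring
  rw [e3]
  have : 0 ≤ 4 / Real.sqrt σ * (‖z‖ * Δ) + 4 / Real.sqrt σ * L1 * τ + 4 / σ * L2 * τ := by positivity
  linarith



/-- first component of the rescaled polynomial vector -/
def uP (a b : ℕ → ℝ) (N i k : ℕ) (x : ℝ) : ℝ := Real.sqrt (a (k * N + i - 1)) * opoly a b (k * N + i - 1) x

/-- second component of the rescaled polynomial vector -/
def uQ (a b : ℕ → ℝ) (N i k : ℕ) (x : ℝ) : ℝ := Real.sqrt (a (k * N + i - 1)) * opoly a b (k * N + i) x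

lemma u_step (a b : ℕ → ℝ) (ha : ∀ n, 0 < a n) (N i : ℕ) (hN : 0 < N) (k : ℕ) (hk : 1 ≤ k) (x : ℝ) :
    uP a b N i (k + 1) x = (Xmat a b N (k * N + i) x 0 0 * uP a b N i k x +
      Xmat a b N (k * N + i) x 0 1 * uQ a b N i k x) / Real.sqrt (Xmat a b N (k * N + i) x).det ∧
    uQ a b N i (k + 1) x = (Xmat a b N (k * N + i) x 1 0 * uP a b N i k x +
      Xmat a b N (k * N + i) x 1 1 * uQ a b N i k x) / Real.sqrt (Xmat a b N (k * N + i) x).det := by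
  have hm : 1 ≤ k * N + i := by nlinarith
  have ht := transfer a b ha (k * N + i) hm x N
  have hd := Xmat_det a b ha N i hN k hk x
  have h1 := Real.sqrt_pos.mpr (ha (k * N + i - 1))
  have h2 := Real.sqrt_pos.mpr (ha ((k + 1) * N + i - 1))
  have e1 : k * N + i + N - 1 = (k + 1) * N + i - 1 := by ring_nf
  have e2 : k * N + i + N = (k + 1) * N + i := by ring_nf
  rw [e1, e2] at ht
  rw [hd, Real.sqrt_div (ha _).le]
  simp only [uP, uQ]
  rw [← ht.1, ← ht.2]
  simp only [Xmat]
  constructor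
  · field_simp
  · field_simp

lemma u_cont (a b : ℕ → ℝ) (N i k : ℕ) : Continuous (uP a b N i k) ∧ Continuous (uQ a b N i k) :=
  ⟨continuous_const.mul (opoly_cont a b _), continuous_const.mul (opoly_cont a b _)⟩

lemma u_ne (a b : ℕ → ℝ) (ha : ∀ n, 0 < a n) (N i : ℕ) (hN : 0 < N) (k : ℕ) (hk : 1 ≤ k) (x : ℝ) :
    uP a b N i k x ≠ 0 ∨ uQ a b N i k x ≠ 0 := by
  have hm : 1 ≤ k * N + i := by nlinarith
  have h := opoly_ne a b ha x (k * N + i - 1)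
  rw [show k * N + i - 1 + 1 = k * N + i by omega] at h
  have h1 := (Real.sqrt_pos.mpr (ha (k * N + i - 1))).ne'
  by_contra hc
  push Not at hc
  simp only [uP, uQ, mul_eq_zero, h1, false_or] at hc
  rw [hc.1, hc.2] at h
  simp at h

lemma psi_concrete (N : ℕ) (hN : 0 < N) (a b : ℕ → ℝ) (ha : ∀ n, 0 < a n) (i : ℕ) (u v : ℝ)
    (hD1 : Summable (incr a b N i u v)) (S : Set ℝ) (hS : IsCompact S) (σ R C : ℝ) (hσ : 0 < σ) (hR : 0 < R)
    (hC : 0 < C) (M : ℕ) (hM : 1 ≤ M)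
    (hG : ∀ k ≥ M, ∀ x ∈ S, Good σ R (Xmat a b N (k * N + i) x))
    (hΔ : ∀ k, ∀ x ∈ S, ∀ r c,
        |Xmat a b N ((k + 1) * N + i) x r c - Xmat a b N (k * N + i) x r c| ≤ C * incr a b N i u v k) :
    ∃ ψ : ℝ → ℂ, ContinuousOn ψ S ∧ (∀ x ∈ S, ψ x ≠ 0) ∧ ∃ C > 0, ∀ k ≥ M, ∀ x ∈ S,
      ‖phiC (Xmat a b N (k * N + i) x) (uP a b N i k x) (uQ a b N i k x) -
        ψ x * ∏ j ∈ Finset.Ico M k, lamC (Xmat a b N (j * N + i) x)‖ ≤ C * tailT a b N i u v k := by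
  obtain ⟨ψ, h1, h2, C', hC', h3⟩ := psi_exists S hS (fun k => Xmat a b N (k * N + i)) (uP a b N i) (uQ a b N i) M
    (fun k => C * incr a b N i u v k) (fun k => mul_nonneg hC.le (incr_nonneg _ _ _ _ _ _ _)) (hD1.mul_left C)
    σ R hσ hR hG (fun k r c => (Xmat_cont a b N _ r c).continuousOn)
    (fun k => (u_cont a b N i k).1.continuousOn) (fun k => (u_cont a b N i k).2.continuousOn)
    (fun k _ x hx r c => hΔ k x hx r c)
    (fun k hk x _ => (u_step a b ha N i hN k (hM.trans hk) x).1)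
    (fun k hk x _ => (u_step a b ha N i hN k (hM.trans hk) x).2)
    (fun x _ => u_ne a b ha N i hN M hM x)
  refine ⟨ψ, h1, h2, C' * C, by positivity, fun k hk x hx => ?_⟩
  have := h3 k hk x hx
  rw [tsum_mul_left, ← mul_assoc] at this
  exact this

/-- the density -/
def wfun (Y : ℝ → Mat2) (ψ : ℝ → ℂ) (x : ℝ) : ℝ :=
  |Y x 1 0| * Real.sqrt (-discr (Y x)) / (2 * π * ‖ψ x‖ ^ 2)

lemma Good.ne10 {σ R : ℝ} (hσ : 0 < σ) {A : Mat2} (h : Good σ R A) : A 1 0 ≠ 0 := by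
  intro h0
  have := h.1
  rw [discr_eq, h0] at this
  nlinarith [sq_nonneg (A 0 0 - A 1 1)]

lemma wfun_pos {σ R : ℝ} (hσ : 0 < σ) {Y : ℝ → Mat2} {ψ : ℝ → ℂ} {x : ℝ} (h : Good σ R (Y x)) (hψ : ψ x ≠ 0) :
    0 < wfun Y ψ x := by
  have h1 := abs_pos.mpr (h.ne10 hσ)
  have h2 : 0 < Real.sqrt (-discr (Y x)) := Real.sqrt_pos.mpr (by linarith [h.1])
  have h3 := norm_pos_iff.mpr hψ
  unfold wfun
  positivity

lemma wfun_cont {S : Set ℝ} {Y : ℝ → Mat2} {ψ : ℝ → ℂ} (hY : ∀ r c, ContinuousOn (fun x => Y x r c) S)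
    (hψ : ContinuousOn ψ S) (h0 : ∀ x ∈ S, ψ x ≠ 0) : ContinuousOn (wfun Y ψ) S := by
  refine ((hY 1 0).abs.mul (discr_contOn hY).neg.sqrt).div (continuousOn_const.mul (hψ.norm.pow 2)) fun x hx => ?_
  have := norm_pos_iff.mpr (h0 x hx)
  positivity

lemma asymp_final (N : ℕ) (hN : 0 < N) (a b : ℕ → ℝ) (ha : ∀ n, 0 < a n) (i : ℕ) (u v : ℝ) (huv : u < v)
    (σ R C : ℝ) (hσ : 0 < σ) (hR : 0 < R) (hC : 0 < C) (M : ℕ) (hM : 1 ≤ M) (Y : ℝ → Mat2)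
    (hYG : ∀ x ∈ Set.Icc u v, Good σ R (Y x) ∧ (Y x).det = 1)
    (hYc : ∀ r c, ContinuousOn (fun x => Y x r c) (Set.Icc u v))
    (hG : ∀ k ≥ M, ∀ x ∈ Set.Icc u v, Good σ R (Xmat a b N (k * N + i) x))
    (hΔ : ∀ k, ∀ x ∈ Set.Icc u v, ∀ r c,
        |Xmat a b N (k * N + i) x r c - Y x r c| ≤ C * tailT a b N i u v k)
    (ψ : ℝ → ℂ) (hψc : ContinuousOn ψ (Set.Icc u v)) (hψ0 : ∀ x ∈ Set.Icc u v, ψ x ≠ 0)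
    (C' : ℝ) (hC' : 0 < C') (hψ : ∀ k ≥ M, ∀ x ∈ Set.Icc u v,
      ‖phiC (Xmat a b N (k * N + i) x) (uP a b N i k x) (uQ a b N i k x) -
        ψ x * ∏ j ∈ Finset.Ico M k, lamC (Xmat a b N (j * N + i) x)‖ ≤ C' * tailT a b N i u v k) :
    ∃ c > 0, ∃ η : ℝ → ℝ, ContinuousOn η (Set.Icc u v) ∧ ∀ k ≥ M, ∀ x ∈ Set.Icc u v,
      |Real.sqrt (a ((k + 1) * N + i - 1)) * opoly a b (k * N + i) x -
          Real.sqrt (2 * |Y x 1 0| / (π * wfun Y ψ x * Real.sqrt (-discr (Y x)))) *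
            Real.sin ((∑ j ∈ Finset.Icc (M + 1) k, thetaf a b N (j * N + i) x) + η x)| ≤
        c * tailT a b N i u v k := by
  obtain ⟨η0, hη0c, hη0⟩ := cont_arg u v huv ψ hψc hψ0
  obtain ⟨C1, hC1, hpt⟩ := final_pt σ R hσ hR
  obtain ⟨B, hB⟩ := isCompact_Icc.exists_bound_of_continuousOn hψc
  have hB0 : 0 ≤ B := (norm_nonneg _).trans (hB u ⟨le_rfl, huv.le⟩)
  refine ⟨C1 * (C' + B * C), by positivity, fun x => η0 x + thetaf a b N (M * N + i) x -
    Real.arccos (Matrix.trace (Y x) / (2 * Real.sqrt (Y x).det)), ?_, fun k hk x hx => ?_⟩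
  · have harc : ∀ A : ℝ → Mat2, (∀ r c, ContinuousOn (fun x => A x r c) (Set.Icc u v)) →
        (∀ x ∈ Set.Icc u v, 0 < (A x).det) →
        ContinuousOn (fun x => Real.arccos (Matrix.trace (A x) / (2 * Real.sqrt (A x).det))) (Set.Icc u v) := by
      intro A hA hd
      refine Real.continuous_arccos.comp_continuousOn ?_
      refine ContinuousOn.div ?_ (continuousOn_const.mul (det_contOn hA).sqrt) fun x hx => ?_
      · simp only [Matrix.trace_fin_two]
        exact (hA 0 0).add (hA 1 1)
      · have := Real.sqrt_pos.mpr (hd x hx)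
        positivity
    refine (hη0c.add ?_).sub (harc Y hYc fun x hx => (hYG x hx).1.det_pos)
    exact harc (Xmat a b N (M * N + i)) (fun r c => (Xmat_cont a b N _ r c).continuousOn)
      fun x hx => (hG M le_rfl x hx).det_pos
  · have hT := tailT_nonneg a b N i u v k
    have hGk := hG k hk x hx
    obtain ⟨hYx, hYd⟩ := hYG x hx
    set z : ℂ := ψ x * ∏ j ∈ Finset.Ico M (k + 1), lamC (Xmat a b N (j * N + i) x) with hz
    have hll : lamC (Xmat a b N (k * N + i) x) * (starRingEnd ℂ) (lamC (Xmat a b N (k * N + i) x)) = 1 := by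
      rw [Complex.mul_conj, Complex.normSq_eq_norm_sq, lamC_norm _ (hGk.discr_neg hσ).le hGk.det_pos]; simp
    have hzl : z * (starRingEnd ℂ) (lamC (Xmat a b N (k * N + i) x)) =
        ψ x * ∏ j ∈ Finset.Ico M k, lamC (Xmat a b N (j * N + i) x) := by
      rw [hz, Finset.prod_Ico_succ_top hk, mul_assoc, mul_assoc, hll, mul_one]
    have key := hpt (Xmat a b N (k * N + i) x) (Y x) (C * tailT a b N i u v k) (C' * tailT a b N i u v k)
      (uP a b N i k x) (uQ a b N i k x) z hGk hYx hYd (fun r c => hΔ k x hx r c) (by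
        rw [hzl]; exact hψ k hk x hx)
    have hzn : ‖z‖ = ‖ψ x‖ := by
      rw [hz, norm_mul, norm_prod, Finset.prod_eq_one, mul_one]
      intro j hj
      have := hG j (Finset.mem_Ico.mp hj).1 x hx
      exact lamC_norm _ (this.discr_neg hσ).le this.det_pos
    have hexp : ∏ j ∈ Finset.Ico M (k + 1), lamC (Xmat a b N (j * N + i) x) =
        Complex.exp (((∑ j ∈ Finset.Ico M (k + 1), thetaf a b N (j * N + i) x : ℝ) : ℂ) * Complex.I) := by
      push_cast
      rw [Finset.sum_mul, Complex.exp_sum]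
      refine Finset.prod_congr rfl fun j hj => ?_
      have := hG j (Finset.mem_Ico.mp hj).1 x hx
      exact lamC_exp _ (this.discr_neg hσ).le this.det_pos
    have hsum : ∑ j ∈ Finset.Ico M (k + 1), thetaf a b N (j * N + i) x =
        thetaf a b N (M * N + i) x + ∑ j ∈ Finset.Icc (M + 1) k, thetaf a b N (j * N + i) x := by
      rw [Finset.sum_eq_sum_Ico_succ_bot (by omega)]
      congr 1
    have hq : uQ a b N i k x / Real.sqrt (Xmat a b N (k * N + i) x).det =
        Real.sqrt (a ((k + 1) * N + i - 1)) * opoly a b (k * N + i) x := by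
      rw [Xmat_det a b ha N i hN k (hM.trans hk), Real.sqrt_div (ha _).le, uQ]
      have h1 := Real.sqrt_pos.mpr (ha (k * N + i - 1))
      have h2 := Real.sqrt_pos.mpr (ha ((k + 1) * N + i - 1))
      field_simp
    set θi := Real.arccos (Matrix.trace (Y x) / (2 * Real.sqrt (Y x).det)) with hθi
    have him : (z * (starRingEnd ℂ) (lamC (Y x))).im = ‖ψ x‖ *
        Real.sin ((∑ j ∈ Finset.Icc (M + 1) k, thetaf a b N (j * N + i) x) +
          (η0 x + thetaf a b N (M * N + i) x - θi)) := by
      have h5 := hη0 x hx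
      obtain ⟨nn, hnn⟩ : ∃ nn, nn = ‖ψ x‖ := ⟨_, rfl⟩
      rw [← hnn] at h5 ⊢
      rw [lamC_exp _ (hYx.discr_neg hσ).le hYx.det_pos, ← hθi, ← Complex.exp_conj, hz, hexp, h5, hsum]
      rw [mul_assoc, mul_assoc, ← Complex.exp_add, ← Complex.exp_add]
      have : (η0 x : ℂ) * Complex.I + (((thetaf a b N (M * N + i) x +
          ∑ j ∈ Finset.Icc (M + 1) k, thetaf a b N (j * N + i) x : ℝ) : ℂ) * Complex.I +
          (starRingEnd ℂ) ((θi : ℂ) * Complex.I)) =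
          (((∑ j ∈ Finset.Icc (M + 1) k, thetaf a b N (j * N + i) x) +
          (η0 x + thetaf a b N (M * N + i) x - θi) : ℝ) : ℂ) * Complex.I := by
        rw [map_mul, Complex.conj_I, Complex.conj_ofReal]
        push_cast
        ring
      rw [this, Complex.im_ofReal_mul, Complex.exp_ofReal_mul_I_im]
    have hrt : Real.sqrt (2 * |Y x 1 0| / (π * wfun Y ψ x * Real.sqrt (-discr (Y x)))) =
        2 / Real.sqrt (-discr (Y x)) * ‖ψ x‖ := by
      have h1 := abs_pos.mpr (hYx.ne10 hσ)
      have h2 : 0 < Real.sqrt (-discr (Y x)) := Real.sqrt_pos.mpr (by linarith [hYx.1])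
      have h3 := norm_pos_iff.mpr (hψ0 x hx)
      rw [Real.sqrt_eq_iff_mul_self_eq (by have := wfun_pos hσ hYx (hψ0 x hx); positivity) (by positivity)]
      unfold wfun
      have := Real.pi_pos
      field_simp
    rw [hq, him, hzn, ← mul_assoc, ← hrt] at key
    refine key.trans ?_
    have hBx := hB x hx
    have : C1 * (C' * tailT a b N i u v k + ‖ψ x‖ * (C * tailT a b N i u v k)) ≤
        C1 * (C' * tailT a b N i u v k + B * (C * tailT a b N i u v k)) := by gcongr
    refine this.trans (le_of_eq ?_)
    ring



lemma avg_pow (ω : ℂ) (h1 : ‖ω‖ = 1) (h : ω ≠ 1) :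
    Tendsto (fun L : ℕ => (L : ℂ)⁻¹ * ∑ l ∈ Finset.range L, ω ^ l) atTop (𝓝 0) := by
  have hb : ∀ L : ℕ, ‖(L : ℂ)⁻¹ * ∑ l ∈ Finset.range L, ω ^ l‖ ≤ (2 / ‖ω - 1‖) * (L : ℝ)⁻¹ := by
    intro L
    rw [geom_sum_eq h, norm_mul, norm_div, norm_inv, Complex.norm_natCast, mul_comm]
    refine mul_le_mul_of_nonneg_right ?_ (by positivity)
    gcongr
    refine (norm_sub_le _ _).trans ?_
    rw [norm_pow, h1]; norm_num
  refine squeeze_zero_norm hb ?_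
  have := tendsto_inv_atTop_nhds_zero_nat (𝕜 := ℝ)
  simpa using this.const_mul (2 / ‖ω - 1‖)

lemma avg_mobius (r ω : ℂ) (hr : ‖r‖ < 1) (hω : ‖ω‖ = 1) (hj : ∀ j : ℕ, 1 ≤ j → ω ^ j ≠ 1) :
    Tendsto (fun L : ℕ => (L : ℂ)⁻¹ * ∑ l ∈ Finset.range L, (1 - r * ω ^ l) / (1 + r * ω ^ l)) atTop (𝓝 1) := by
  have hz : ∀ l : ℕ, ‖-(r * ω ^ l)‖ < 1 := fun l => by
    rw [norm_neg, norm_mul, norm_pow, hω, one_pow, mul_one]; exact hr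
  have hgeo : ∀ l : ℕ, (1 - r * ω ^ l) / (1 + r * ω ^ l) = -1 + 2 * ∑' j : ℕ, (-r) ^ j * (ω ^ j) ^ l := by
    intro l
    have hne : 1 + r * ω ^ l ≠ 0 := fun h => by
      have h2 := hz l
      rw [show -(r * ω ^ l) = 1 by linear_combination -h] at h2
      simp at h2
    have e : ∀ j : ℕ, (-r) ^ j * (ω ^ j) ^ l = (-(r * ω ^ l)) ^ j := fun j => by
      rw [← pow_mul, mul_comm j l, pow_mul, ← mul_pow]; ring
    simp only [e]
    rw [tsum_geometric_of_norm_lt_one (hz l), sub_neg_eq_add]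
    field_simp
    ring
  have hsum : ∀ l : ℕ, Summable fun j : ℕ => (-r) ^ j * (ω ^ j) ^ l := fun l => by
    have := summable_geometric_of_norm_lt_one (hz l)
    refine this.congr fun j => ?_
    rw [← pow_mul, mul_comm j l, pow_mul, ← mul_pow]; ring
  have htends : Tendsto (fun L : ℕ => ∑' j : ℕ, (-r) ^ j * ((L : ℂ)⁻¹ * ∑ l ∈ Finset.range L, (ω ^ j) ^ l))
      atTop (𝓝 (∑' j : ℕ, if j = 0 then 1 else 0)) := by
    refine tendsto_tsum_of_dominated_convergence (bound := fun j => ‖r‖ ^ j)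
      (summable_geometric_of_lt_one (norm_nonneg _) hr) (fun j => ?_) (Eventually.of_forall fun L j => ?_)
    · rcases Nat.eq_zero_or_pos j with rfl | hj0
      · simp only [pow_zero, one_pow, Finset.sum_const, Finset.card_range, one_mul, if_true]
        refine tendsto_const_nhds.congr' ?_
        filter_upwards [eventually_gt_atTop 0] with L hL
        have : (L : ℂ) ≠ 0 := by exact_mod_cast hL.ne'
        simp [this]
      · rw [if_neg hj0.ne']
        have := (avg_pow (ω ^ j) (by rw [norm_pow, hω, one_pow]) (hj j hj0)).const_mul ((-r) ^ j)
        simpa using this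
    · rw [norm_mul, norm_pow, norm_neg]
      refine mul_le_of_le_one_right (by positivity) ?_
      rw [norm_mul, norm_inv, Complex.norm_natCast]
      have : ‖∑ l ∈ Finset.range L, (ω ^ j) ^ l‖ ≤ L := by
        refine (norm_sum_le _ _).trans ?_
        simp [hω]
      rcases Nat.eq_zero_or_pos L with rfl | hL
      · simp
      · have hL' : (0 : ℝ) < L := by exact_mod_cast hL
        rw [inv_mul_le_iff₀ hL', mul_one]; exact this
  rw [tsum_ite_eq] at htends
  have h2 := (htends.const_mul 2).const_add (-1)
  rw [show (-1 : ℂ) + 2 * 1 = 1 by norm_num] at h2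
  refine h2.congr' ?_
  filter_upwards [eventually_gt_atTop 0] with L hL
  have hL' : (L : ℂ) ≠ 0 := by exact_mod_cast hL.ne'
  simp only [hgeo]
  rw [Finset.sum_add_distrib, ← Finset.mul_sum, ← Summable.tsum_finsetSum (fun l _ => hsum l), mul_add]
  simp only [← Finset.mul_sum]
  simp only [mul_left_comm _ ((L : ℂ)⁻¹)]
  rw [tsum_mul_left]
  simp [hL']
  ring

lemma re_mobius (z : ℂ) (h : ‖z‖ < 1) : ((1 - z) / (1 + z)).re = (1 - ‖z‖ ^ 2) / ‖1 + z‖ ^ 2 := by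
  rw [← Complex.normSq_eq_norm_sq, ← Complex.normSq_eq_norm_sq, Complex.div_re, Complex.normSq_apply z]
  simp only [Complex.sub_re, Complex.one_re, Complex.add_re, Complex.sub_im, Complex.add_im, Complex.one_im]
  ring

lemma avg_complex (γ : ℕ → ℂ) (μ : ℂ) (hμ : ‖μ‖ = 1) (him : 0 < μ.im)
    (hrec : ∀ l, γ (l + 2) = (2 * μ.re : ℝ) * γ (l + 1) - γ l)
    (hD : 0 < (γ 1 * (starRingEnd ℂ) (γ 0)).im) (hroot : ∀ j : ℕ, 1 ≤ j → (μ ^ 2) ^ j ≠ 1) :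
    Tendsto (fun L : ℕ => (L : ℝ)⁻¹ * ∑ l ∈ Finset.range L, 1 / ‖γ l‖ ^ 2) atTop
      (𝓝 (μ.im / (γ 1 * (starRingEnd ℂ) (γ 0)).im)) := by
  set μb := (starRingEnd ℂ) μ with hμb
  have hmm : μ * μb = 1 := by
    rw [hμb, Complex.mul_conj, Complex.normSq_eq_norm_sq, hμ]; simp
  have hμ0 : μ ≠ 0 := by intro h; rw [h] at hμ; simp at hμ
  have hadd : μ + μb = (2 * μ.re : ℝ) := by rw [hμb, Complex.add_conj]
  have hsub : μ - μb = (2 * μ.im : ℝ) * Complex.I := by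
    rw [hμb, Complex.sub_conj]
  have hsub0 : μ - μb ≠ 0 := by
    rw [hsub]
    refine mul_ne_zero ?_ Complex.I_ne_zero
    exact_mod_cast (by positivity : 2 * μ.im ≠ 0)
  set A := (γ 1 - μb * γ 0) / (μ - μb) with hA
  set B := (μ * γ 0 - γ 1) / (μ - μb) with hB
  have hγ : ∀ l, γ l = A * μ ^ l + B * μb ^ l ∧ γ (l + 1) = A * μ ^ (l + 1) + B * μb ^ (l + 1) := by
    intro l
    induction l with
    | zero =>
      constructor
      · rw [hA, hB]; field_simp; ring
      · rw [hA, hB]; field_simp; ring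
    | succ l ih =>
      refine ⟨ih.2, ?_⟩
      rw [hrec, ih.1, ih.2, ← hadd]
      linear_combination (A * μ ^ l + B * μb ^ l) * hmm
  have hnorm : ‖A‖ ^ 2 - ‖B‖ ^ 2 = (γ 1 * (starRingEnd ℂ) (γ 0)).im / μ.im := by
    rw [hA, hB, norm_div, norm_div, div_pow, div_pow, ← sub_div]
    have hs : ‖μ - μb‖ ^ 2 = 4 * μ.im ^ 2 := by
      rw [hsub, norm_mul, Complex.norm_I, Complex.norm_real, mul_one, Real.norm_eq_abs, sq_abs]; ring
    rw [hs, div_eq_div_iff (by positivity) him.ne']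
    rw [← Complex.normSq_eq_norm_sq, ← Complex.normSq_eq_norm_sq, Complex.normSq_apply, Complex.normSq_apply]
    simp only [hμb, Complex.sub_re, Complex.sub_im, Complex.mul_re, Complex.mul_im, Complex.conj_re, Complex.conj_im]
    ring
  have hAB : ‖B‖ ^ 2 < ‖A‖ ^ 2 := by
    have : 0 < (γ 1 * (starRingEnd ℂ) (γ 0)).im / μ.im := by positivity
    linarith
  have hlt : ‖B‖ < ‖A‖ := lt_of_pow_lt_pow_left₀ 2 (norm_nonneg _) hAB
  have hA0 : A ≠ 0 := by
    intro h; rw [h, norm_zero] at hlt; linarith [norm_nonneg B]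
  have hAn : 0 < ‖A‖ := norm_pos_iff.mpr hA0
  have hμbn : ‖μb‖ = 1 := by rw [hμb, Complex.norm_conj, hμ]
  have hω : ‖μb ^ 2‖ = 1 := by rw [norm_pow, hμbn, one_pow]
  have hr : ‖B / A‖ < 1 := by rw [norm_div, div_lt_one hAn]; exact hlt
  have hroot' : ∀ j : ℕ, 1 ≤ j → (μb ^ 2) ^ j ≠ 1 := fun j hj h => by
    refine hroot j hj ?_
    have h2 := congrArg (starRingEnd ℂ) h
    simpa [hμb] using h2
  have hlim := avg_mobius (B / A) (μb ^ 2) hr hω hroot'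
  have hre := (Complex.continuous_re.tendsto _).comp hlim
  have hfin := hre.const_mul (1 / (‖A‖ ^ 2 - ‖B‖ ^ 2))
  rw [Complex.one_re, mul_one, hnorm, one_div_div] at hfin
  refine hfin.congr fun L => ?_
  rw [show μ.im / (γ 1 * (starRingEnd ℂ) (γ 0)).im = 1 / (‖A‖ ^ 2 - ‖B‖ ^ 2) by rw [hnorm, one_div_div]]
  simp only [Function.comp]
  have e1 : (L : ℂ)⁻¹ = ((L : ℝ)⁻¹ : ℝ) := by push_cast; rfl
  rw [e1, Complex.re_ofReal_mul, Complex.re_sum, mul_left_comm, Finset.mul_sum]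
  congr 1
  refine Finset.sum_congr rfl fun l _ => ?_
  have hzn : ‖B / A * (μb ^ 2) ^ l‖ = ‖B‖ / ‖A‖ := by
    rw [norm_mul, norm_pow, hω, one_pow, mul_one, norm_div]
  rw [re_mobius _ (by rw [hzn, ← norm_div]; exact hr), hzn]
  have e2 : γ l = A * μ ^ l * (1 + B / A * (μb ^ 2) ^ l) := by
    rw [(hγ l).1]
    have : μ ^ l * μb ^ l = 1 := by rw [← mul_pow, hmm, one_pow]
    field_simp
    linear_combination -B * μb ^ l * this
  have e3 : ‖γ l‖ = ‖A‖ * ‖1 + B / A * (μb ^ 2) ^ l‖ := by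
    rw [e2, norm_mul, norm_mul, norm_pow, hμ, one_pow, mul_one]
  have h1z : 0 < ‖1 + B / A * (μb ^ 2) ^ l‖ := by
    rw [norm_pos_iff]; intro h
    have h3 : ‖B / A * (μb ^ 2) ^ l‖ = 1 := by
      rw [show B / A * (μb ^ 2) ^ l = -1 by linear_combination h]; simp
    rw [hzn, ← norm_div] at h3
    linarith
  rw [e3]
  have h5 : ‖A‖ ^ 2 - ‖B‖ ^ 2 ≠ 0 := by linarith
  field_simp

lemma avg_matrix (Y : Mat2) (hd : Y.det = 1) (hdis : discr Y < 0) (g h : ℕ → ℝ)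
    (hg : ∀ l, g (l + 1) = Y 0 0 * g l + Y 0 1 * h l) (hh : ∀ l, h (l + 1) = Y 1 0 * g l + Y 1 1 * h l)
    (hD : g 0 * h 1 - h 0 * g 1 ≠ 0) (hroot : ∀ j : ℕ, 1 ≤ j → (muC Y ^ 2) ^ j ≠ 1) :
    Tendsto (fun L : ℕ => (L : ℝ)⁻¹ * ∑ l ∈ Finset.range L, 1 / (g l ^ 2 + h l ^ 2)) atTop
      (𝓝 (Real.sqrt (-discr Y) / (2 * |g 0 * h 1 - h 0 * g 1|))) := by
  have hμ : ‖muC Y‖ = 1 := by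
    have := muC_normSq Y hdis.le
    rw [hd] at this
    nlinarith [norm_nonneg (muC Y)]
  have him : 0 < (muC Y).im := by
    simp only [muC]
    have := Real.sqrt_pos.mpr (by linarith : 0 < -discr Y)
    linarith
  have hre : 2 * (muC Y).re = Y 0 0 + Y 1 1 := by simp only [muC]; ring
  rw [Matrix.det_fin_two] at hd
  have rg : ∀ l, g (l + 2) = 2 * (muC Y).re * g (l + 1) - g l := fun l => by
    rw [hre, hg (l + 1), hh l, hg l]
    linear_combination (- g l) * hd
  have rh : ∀ l, h (l + 2) = 2 * (muC Y).re * h (l + 1) - h l := fun l => by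
    rw [hre, hh (l + 1), hh l, hg l]
    linear_combination (- h l) * hd
  have himv : (muC Y).im = Real.sqrt (-discr Y) / 2 := rfl
  rcases lt_or_gt_of_ne hD with hneg | hpos
  · have key := avg_complex (fun l => ⟨g l, -h l⟩) (muC Y) hμ him (fun l => by
        apply Complex.ext
        · simp [rg]
        · simp [rh]; ring) (by simp; linarith) hroot
    simp only [← Complex.normSq_eq_norm_sq, Complex.normSq_apply, himv] at key
    have e : ((⟨g 1, -h 1⟩ : ℂ) * (starRingEnd ℂ) (⟨g 0, -h 0⟩ : ℂ)).im = -(g 0 * h 1 - h 0 * g 1) := by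
      simp; ring
    rw [e, div_div] at key
    rw [abs_of_neg hneg]
    refine key.congr fun L => ?_
    congr 1
    refine Finset.sum_congr rfl fun l _ => ?_
    congr 1; ring
  · have key := avg_complex (fun l => ⟨g l, h l⟩) (muC Y) hμ him (fun l => by
        apply Complex.ext
        · simp [rg]
        · simp [rh]) (by simp; linarith) hroot
    simp only [← Complex.normSq_eq_norm_sq, Complex.normSq_apply, himv] at key
    have e : ((⟨g 1, h 1⟩ : ℂ) * (starRingEnd ℂ) (⟨g 0, h 0⟩ : ℂ)).im = (g 0 * h 1 - h 0 * g 1) := by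
      simp; ring
    rw [e, div_div] at key
    rw [abs_of_pos hpos]
    refine key.congr fun L => ?_
    congr 1
    refine Finset.sum_congr rfl fun l _ => ?_
    congr 1; ring



/-- Periodic continuation of a sequence from index `n` on, with period `N`. -/
def per (a : ℕ → ℝ) (n N m : ℕ) : ℝ := if m < n then a m else a (n + (m - n) % N)

lemma per_pos {a : ℕ → ℝ} (ha : ∀ n, 0 < a n) (n N m : ℕ) : 0 < per a n N m := by
  unfold per; split_ifs <;> exact ha _

lemma per_eq (a : ℕ → ℝ) (n N m : ℕ) (h : m < n + N) : per a n N m = a m := by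
  unfold per
  split_ifs with h1
  · rfl
  · rw [Nat.mod_eq_of_lt (by omega)]; congr 1; omega

lemma per_add (a : ℕ → ℝ) (n N m : ℕ) (h : n ≤ m) : per a n N (m + N) = per a n N m := by
  unfold per
  rw [if_neg (by omega), if_neg (by omega), show m + N - n = (m - n) + N by omega, Nat.add_mod_right]

lemma per_add_mul (a : ℕ → ℝ) (n N m l : ℕ) (h : n ≤ m) : per a n N (m + l * N) = per a n N m := by
  induction l with
  | zero => simp
  | succ l ih => rw [show m + (l + 1) * N = (m + l * N) + N by ring, per_add _ _ _ _ (by omega), ih]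

lemma opoly_congr (a b a' b' : ℕ → ℝ) (x : ℝ) : ∀ m : ℕ, (∀ j < m, a' j = a j ∧ b' j = b j) →
    opoly a' b' m x = opoly a b m x := by
  intro m
  induction m using Nat.strong_induction_on with
  | _ m ih =>
    intro h
    match m, ih, h with
    | 0, _, _ => rfl
    | 1, _, h => simp only [opoly]; rw [(h 0 (by omega)).1, (h 0 (by omega)).2]
    | m + 2, ih, h =>
      simp only [opoly]
      rw [ih (m + 1) (by omega) (fun j hj => h j (by omega)), ih m (by omega) (fun j hj => h j (by omega)),
        (h (m + 1) (by omega)).1, (h (m + 1) (by omega)).2, (h m (by omega)).1]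

lemma opoly_per (a b : ℕ → ℝ) (n N m : ℕ) (h : m ≤ n + N) (x : ℝ) :
    opoly (per a n N) (per b n N) m x = opoly a b m x :=
  opoly_congr _ _ _ _ _ _ fun j hj => ⟨per_eq _ _ _ _ (by omega), per_eq _ _ _ _ (by omega)⟩

lemma Bmat_per_add (a b : ℕ → ℝ) (n N m : ℕ) (h : n + 1 ≤ m) (x : ℝ) :
    Bmat (per a n N) (per b n N) (m + N) x = Bmat (per a n N) (per b n N) m x := by
  unfold Bmat
  rw [show m + N - 1 = (m - 1) + N by omega, per_add _ _ _ _ (by omega), per_add _ _ _ _ (by omega),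
    per_add _ _ _ _ (by omega)]

lemma prodD_congr {C C' : ℕ → Mat2} (n n' len : ℕ) (h : ∀ j < len, C' (n' + j) = C (n + j)) :
    prodD C' n' len = prodD C n len := by
  induction len with
  | zero => rfl
  | succ len ih => simp only [prodD]; rw [h len (by omega), ih fun j hj => h j (by omega)]

lemma Xmat_per (a b : ℕ → ℝ) (n N l : ℕ) (hN : 0 < N) (x : ℝ) :
    Xmat (per a n N) (per b n N) N (n + (l + 1) * N) x = Xmat (per a n N) (per b n N) N (n + N) x := by
  induction l with
  | zero => simp
  | succ l ih =>
    rw [← ih]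
    unfold Xmat
    refine prodD_congr _ _ _ fun j hj => ?_
    have h1 : N ≤ (l + 1) * N := Nat.le_mul_of_pos_left _ (by omega)
    refine Eq.trans ?_ (Bmat_per_add a b n N (n + (l + 1) * N + j) (by omega) x)
    congr 1; ring

/-- The period matrix. -/
def tY (a b : ℕ → ℝ) (N n : ℕ) (x : ℝ) : Mat2 := Xmat (per a n N) (per b n N) N (n + N) x

lemma tY_entries (a b : ℕ → ℝ) (ha : ∀ n, 0 < a n) (N n : ℕ) (hN : 0 < N) (hn : 1 ≤ n) (x : ℝ) (r : Fin 2) :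
    tY a b N n x r 0 = Xmat a b N n x r 0 * (a (n + N - 1) / a (n - 1)) ∧
      tY a b N n x r 1 = Xmat a b N n x r 1 := by
  have key : ∀ len : ℕ, len < N → ∀ r : Fin 2,
      prodD (fun j => Bmat (per a n N) (per b n N) j x) (n + N) (len + 1) r 0
        = prodD (fun j => Bmat a b j x) n (len + 1) r 0 * (a (n + N - 1) / a (n - 1)) ∧
      prodD (fun j => Bmat (per a n N) (per b n N) j x) (n + N) (len + 1) r 1
        = prodD (fun j => Bmat a b j x) n (len + 1) r 1 := by
    intro len
    induction len with
    | zero =>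
      intro _ r
      have h1 := (ha (n - 1)).ne'
      have h2 := (ha n).ne'
      simp only [prodD, add_zero, mul_one, Bmat]
      rw [per_add _ _ _ _ le_rfl, per_add _ _ _ _ le_rfl, per_eq _ _ _ _ (by omega), per_eq _ _ _ _ (by omega),
        per_eq _ _ _ _ (by omega)]
      fin_cases r
      · simp
      · simp; field_simp
    | succ len ih =>
      intro hl r
      have hB : Bmat (per a n N) (per b n N) (n + N + (len + 1)) x = Bmat a b (n + (len + 1)) x := by
        rw [show n + N + (len + 1) = n + (len + 1) + N by ring, Bmat_per_add _ _ _ _ _ (by omega)]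
        unfold Bmat
        rw [per_eq _ _ _ _ (by omega), per_eq _ _ _ _ (by omega), per_eq _ _ _ _ (by omega)]
      have e : ∀ (C : ℕ → Mat2) (m : ℕ), prodD C m (len + 1 + 1) = C (m + (len + 1)) * prodD C m (len + 1) :=
        fun C m => rfl
      rw [e, e]
      simp only [hB, Matrix.mul_apply, Fin.sum_univ_two]
      obtain ⟨h00, h01⟩ := ih (by omega) 0
      obtain ⟨h10, h11⟩ := ih (by omega) 1
      rw [h00, h01, h10, h11]
      constructor <;> ring
  have := key (N - 1) (by omega) r
  rw [Nat.sub_add_cancel hN] at this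
  exact this

lemma tY_det (a b : ℕ → ℝ) (ha : ∀ n, 0 < a n) (N n : ℕ) (hN : 0 < N) (hn : 1 ≤ n) (x : ℝ) :
    (tY a b N n x).det = 1 := by
  unfold tY Xmat
  rw [prodD_det _ _ (per_pos ha n N) _ (by omega)]
  rw [show n + N + N - 1 = (n + N - 1) + N by omega, per_add _ _ _ _ (by omega)]
  exact div_self (per_pos ha _ _ _).ne'

lemma trace_growth (a b : ℕ → ℝ) (ha : ∀ n, 0 < a n) (n len : ℕ) : ∃ e κ : ℝ, 0 ≤ e ∧ 0 < κ ∧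
    Tendsto (fun x : ℝ => prodD (fun j => Bmat a b j x) n len 0 0 * (x⁻¹) ^ len) atTop (𝓝 e) ∧
    Tendsto (fun x : ℝ => prodD (fun j => Bmat a b j x) n len 1 0 * (x⁻¹) ^ len) atTop (𝓝 0) ∧
    Tendsto (fun x : ℝ => prodD (fun j => Bmat a b j x) n len 0 1 * (x⁻¹) ^ len) atTop (𝓝 0) ∧
    Tendsto (fun x : ℝ => prodD (fun j => Bmat a b j x) n len 1 1 * (x⁻¹) ^ len) atTop (𝓝 κ) := by
  induction len with
  | zero => refine ⟨1, 1, by norm_num, by norm_num, ?_, ?_, ?_, ?_⟩ <;> simp [prodD]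
  | succ len ih =>
    obtain ⟨e, κ, he, hκ, h00, h10, h01, h11⟩ := ih
    have hi : Tendsto (fun x : ℝ => x⁻¹) atTop (𝓝 0) := tendsto_inv_atTop_zero
    have hA := (ha (n + len))
    set α := -(a (n + len - 1)) / a (n + len)
    have hc : Tendsto (fun x : ℝ => (x - b (n + len)) / a (n + len) * x⁻¹) atTop (𝓝 (1 / a (n + len))) := by
      have h1 : Tendsto (fun x : ℝ => (1 - b (n + len) * x⁻¹) / a (n + len)) atTop (𝓝 ((1 - b (n + len) * 0) / a (n + len))) :=
        (tendsto_const_nhds.sub (hi.const_mul _)).div_const _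
      rw [mul_zero, sub_zero] at h1
      refine h1.congr' ?_
      filter_upwards [eventually_gt_atTop 0] with x hx
      field_simp
    refine ⟨0, 1 / a (n + len) * κ, le_rfl, by positivity, ?_, ?_, ?_, ?_⟩
    · have := h10.mul hi
      rw [mul_zero] at this
      refine this.congr fun x => ?_
      simp [prodD, Matrix.mul_apply, Fin.sum_univ_two, Bmat]; ring
    · have := ((h00.mul hi).const_mul α).add (hc.mul h10)
      simp only [mul_zero, add_zero] at this
      refine this.congr fun x => ?_
      simp [prodD, Matrix.mul_apply, Fin.sum_univ_two, Bmat, α]; ring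
    · have := h11.mul hi
      rw [mul_zero] at this
      refine this.congr fun x => ?_
      simp [prodD, Matrix.mul_apply, Fin.sum_univ_two, Bmat]; ring
    · have := ((h01.mul hi).const_mul α).add (hc.mul h11)
      simp only [mul_zero, zero_add] at this
      refine this.congr fun x => ?_
      simp [prodD, Matrix.mul_apply, Fin.sum_univ_two, Bmat, α]; ring

lemma trace_level_finite (a b : ℕ → ℝ) (ha : ∀ n, 0 < a n) (n N : ℕ) (hN : 0 < N) (t : ℝ) :
    {x : ℝ | Xmat a b N n x 0 0 + Xmat a b N n x 1 1 = t}.Finite := by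
  obtain ⟨P, -, hP⟩ := prodD_poly a b n N 0 0
  obtain ⟨Q, -, hQ⟩ := prodD_poly a b n N 1 1
  obtain ⟨e, κ, he, hκ, h00, -, -, h11⟩ := trace_growth a b ha n N
  have hne : P + Q - Polynomial.C t ≠ 0 := by
    intro h0
    have hE : ∀ x : ℝ, prodD (fun j => Bmat a b j x) n N 0 0 + prodD (fun j => Bmat a b j x) n N 1 1 = t := by
      intro x
      have := congrArg (Polynomial.eval x) h0
      simp at this
      rw [hP, hQ]; linarith
    have h1 := h00.add h11
    have h2 : Tendsto (fun x : ℝ => t * (x⁻¹) ^ N) atTop (𝓝 0) := by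
      have := ((tendsto_inv_atTop_zero (𝕜 := ℝ)).pow N).const_mul t
      simpa [hN.ne'] using this
    have h3 := tendsto_nhds_unique (h1.congr fun x => by rw [← add_mul, hE x]) h2
    linarith
  refine (P + Q - Polynomial.C t).roots.toFinset.finite_toSet.subset fun x hx => ?_
  simp only [Set.mem_setOf_eq, Xmat, hP, hQ] at hx
  simp only [Finset.mem_coe, Multiset.mem_toFinset, Polynomial.mem_roots hne, Polynomial.IsRoot]
  simp; linarith

lemma bad_null (a b : ℕ → ℝ) (ha : ∀ n, 0 < a n) (n N : ℕ) (hN : 0 < N) :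
    ∀ᵐ x : ℝ, ∀ j : ℕ, 1 ≤ j → (muC (Xmat a b N n x) ^ 2) ^ j ≠ 1 := by
  rw [ae_all_iff]
  intro j
  by_cases hj : 1 ≤ j
  swap
  · exact Eventually.of_forall fun x h => absurd h hj
  have hfin : {x : ℝ | (muC (Xmat a b N n x) ^ 2) ^ j = 1}.Finite := by
    have hr : (((Polynomial.X ^ (2 * j) - Polynomial.C (1 : ℂ)).roots.toFinset : Finset ℂ) : Set ℂ).Finite :=
      Finset.finite_toSet _
    refine (hr.biUnion (t := fun ζ => {x : ℝ | Xmat a b N n x 0 0 + Xmat a b N n x 1 1 = 2 * ζ.re})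
      fun ζ _ => trace_level_finite a b ha n N hN _).subset fun x hx => ?_
    simp only [Set.mem_setOf_eq] at hx
    refine Set.mem_biUnion (x := muC (Xmat a b N n x)) ?_ ?_
    · simp only [Finset.mem_coe, Multiset.mem_toFinset]
      rw [Polynomial.mem_roots (Polynomial.X_pow_sub_C_ne_zero (by omega) _)]
      simp [Polynomial.IsRoot, pow_mul, hx]
    · simp only [Set.mem_setOf_eq, muC]; ring
  have := hfin.measure_zero volume
  rw [ae_iff]
  refine measure_mono_null (fun x hx => ?_) this
  simp only [Set.mem_setOf_eq] at hx ⊢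
  by_contra h
  exact hx fun _ => h



/-- Averaged Carmona densities of the periodic continuation. -/
def avgD (a b : ℕ → ℝ) (N n L : ℕ) (x : ℝ) : ℝ :=
  (L : ℝ)⁻¹ * ∑ l ∈ Finset.range L, carm (per a n N) (per b n N) (n + (l + 1) * N - 1) x

lemma avgD_cont (a b : ℕ → ℝ) (ha : ∀ n, 0 < a n) (N n L : ℕ) : Continuous (avgD a b N n L) := by
  unfold avgD
  exact continuous_const.mul (continuous_finsetSum _ fun l _ => carm_cont _ _ (per_pos ha n N) _)

lemma avgD_nonneg (a b : ℕ → ℝ) (ha : ∀ n, 0 < a n) (N n L : ℕ) (x : ℝ) : 0 ≤ avgD a b N n L x := by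
  unfold avgD
  exact mul_nonneg (by positivity) (Finset.sum_nonneg fun l _ => carm_nonneg _ _ (per_pos ha n N) _ _)

lemma avgD_ortho (a b : ℕ → ℝ) (ha : ∀ n, 0 < a n) (N n L : ℕ) (hN : 0 < N) (hL : 1 ≤ L) :
    OrthoUpTo a b (avgD a b N n L) n := by
  intro j hj m hm
  have key : ∀ L : ℕ, HasInt (fun x => opoly a b j x * opoly a b m x *
      ∑ l ∈ Finset.range L, carm (per a n N) (per b n N) (n + (l + 1) * N - 1) x)
      (L * (if j = m then 1 else 0)) := by
    intro L
    induction L with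
    | zero => simp [HasInt]
    | succ L ih =>
      have h1 : N ≤ (L + 1) * N := Nat.le_mul_of_pos_left _ (by omega)
      have h := carm_ortho (per a n N) (per b n N) (per_pos ha n N) (n + (L + 1) * N - 1) j (by omega) m (by omega)
      refine (ih.add h).congr (fun x => ?_) ?_
      · rw [Finset.sum_range_succ, opoly_per _ _ _ _ _ (by omega), opoly_per _ _ _ _ _ (by omega)]; ring
      · push_cast; ring
  have hL0 : (L : ℝ) ≠ 0 := by positivity
  refine ((key L).smul (L : ℝ)⁻¹).congr (fun x => ?_) ?_
  · unfold avgD; ring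
  · field_simp

/-- The limit density of the averages. -/
def limG (a b : ℕ → ℝ) (N n : ℕ) : ℝ → ℝ :=
  wfun (tY a b N n) fun x => phiC (tY a b N n x) (Real.sqrt (a (n + N - 1)) * opoly a b (n + N - 1) x)
    (Real.sqrt (a (n + N - 1)) * opoly a b (n + N) x)

lemma tY_cont (a b : ℕ → ℝ) (N n : ℕ) (r c : Fin 2) : Continuous fun x => tY a b N n x r c :=
  Xmat_cont _ _ _ _ r c

lemma phiC_ne {A : Mat2} (hA : discr A < 0) {p q : ℝ} (h : 0 < p ^ 2 + q ^ 2) : phiC A p q ≠ 0 := by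
  intro h0
  have h1 := congrArg Complex.re h0
  have h2 := congrArg Complex.im h0
  simp only [phiC, Complex.zero_re, Complex.zero_im] at h1 h2
  have hs := Real.sqrt_pos.mpr (by linarith : 0 < -discr A)
  have hq : q = 0 := by
    rcases mul_eq_zero.mp h2 with h | h
    · linarith
    · exact h
  subst hq
  rw [discr_eq] at hA
  have h10 : A 1 0 ≠ 0 := fun h => by rw [h] at hA; nlinarith [sq_nonneg (A 0 0 - A 1 1)]
  simp only [mul_zero, add_zero] at h1
  rcases mul_eq_zero.mp h1 with h3 | h3
  · exact h10 h3
  · subst h3; simp at h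

lemma limG_psi_ne (a b : ℕ → ℝ) (ha : ∀ n, 0 < a n) (N n : ℕ) (hN : 0 < N) (x : ℝ)
    (hd : discr (tY a b N n x) < 0) : phiC (tY a b N n x) (Real.sqrt (a (n + N - 1)) * opoly a b (n + N - 1) x)
    (Real.sqrt (a (n + N - 1)) * opoly a b (n + N) x) ≠ 0 := by
  refine phiC_ne hd ?_
  have h := opoly_ne a b ha x (n + N - 1)
  rw [show n + N - 1 + 1 = n + N by omega] at h
  have h2 := ha (n + N - 1)
  rw [mul_pow, mul_pow, Real.sq_sqrt h2.le, ← mul_add]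
  positivity

lemma limG_cont (a b : ℕ → ℝ) (ha : ∀ n, 0 < a n) (N n : ℕ) (hN : 0 < N) (S : Set ℝ)
    (hd : ∀ x ∈ S, discr (tY a b N n x) < 0) : ContinuousOn (limG a b N n) S := by
  refine wfun_cont (fun r c => (tY_cont a b N n r c).continuousOn) ?_ fun x hx => limG_psi_ne a b ha N n hN x (hd x hx)
  exact phiC_contOn (fun r c => (tY_cont a b N n r c).continuousOn)
    (continuous_const.mul (opoly_cont _ _ _)).continuousOn (continuous_const.mul (opoly_cont _ _ _)).continuousOn

lemma avgD_tendsto (a b : ℕ → ℝ) (ha : ∀ n, 0 < a n) (N n : ℕ) (hN : 0 < N) (hn : 1 ≤ n) (s t : ℝ)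
    (hd : ∀ x ∈ Set.Icc s t, discr (tY a b N n x) < 0) :
    Tendsto (fun L => ∫ x in Set.Icc s t, |avgD a b N n L x - limG a b N n x|) atTop (𝓝 0) := by
  set a' := per a n N with ha'
  set b' := per b n N with hb'
  have hpos : ∀ m, 0 < a' m := per_pos ha n N
  set g : ℕ → ℝ → ℝ := fun l x => opoly a' b' (n + (l + 1) * N - 1) x with hg
  set h : ℕ → ℝ → ℝ := fun l x => opoly a' b' (n + (l + 1) * N) x with hh
  set Y := tY a b N n with hY
  set α := a (n + N - 1) with hα
  have hα0 : 0 < α := ha _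
  have hle : ∀ l : ℕ, N ≤ (l + 1) * N := fun l => Nat.le_mul_of_pos_left _ (by omega)
  have hrec : ∀ l x, g (l + 1) x = Y x 0 0 * g l x + Y x 0 1 * h l x ∧
      h (l + 1) x = Y x 1 0 * g l x + Y x 1 1 * h l x := by
    intro l x
    have := transfer a' b' hpos (n + (l + 1) * N) (by omega) x N
    have e := Xmat_per a b n N l hN x
    rw [show n + (l + 1) * N + N = n + (l + 1 + 1) * N by ring] at this
    change Xmat a' b' N _ x = Xmat a' b' N _ x at e
    unfold Xmat at e
    rw [e] at this
    exact ⟨this.1.symm, this.2.symm⟩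
  have hcarm : ∀ l x, carm a' b' (n + (l + 1) * N - 1) x = 1 / (π * α) * (1 / (g l x ^ 2 + h l x ^ 2)) := by
    intro l x
    unfold carm
    have e : a' (n + (l + 1) * N - 1) = α := by
      rw [show n + (l + 1) * N - 1 = (n + N - 1) + l * N by
        rw [add_mul, one_mul]; omega, ha', per_add_mul _ _ _ _ _ (by omega), per_eq _ _ _ _ (by omega)]
    rw [e, show n + (l + 1) * N - 1 + 1 = n + (l + 1) * N by have := hle l; omega, one_div_mul_one_div]
  have hgh : ∀ l x, 0 < g l x ^ 2 + h l x ^ 2 := by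
    intro l x
    have := opoly_ne a' b' hpos x (n + (l + 1) * N - 1)
    rwa [show n + (l + 1) * N - 1 + 1 = n + (l + 1) * N by have := hle l; omega] at this
  have hdet : ∀ x, Y x 0 0 * Y x 1 1 - Y x 0 1 * Y x 1 0 = 1 := fun x => by
    rw [← Matrix.det_fin_two]; exact tY_det a b ha N n hN hn x
  set D : ℝ → ℝ := fun x => g 0 x * h 1 x - h 0 x * g 1 x with hD
  have hDl : ∀ l x, g l x * h (l + 1) x - h l x * g (l + 1) x = D x := by
    intro l x
    induction l with
    | zero => rfl
    | succ l ih =>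
      rw [← ih, (hrec (l + 1) x).1, (hrec (l + 1) x).2]
      rw [(hrec l x).1, (hrec l x).2]
      linear_combination (g l x * (Y x 1 0 * g l x + Y x 1 1 * h l x) - h l x * (Y x 0 0 * g l x + Y x 0 1 * h l x)) * hdet x
  have hg0 : ∀ x, g 0 x = opoly a b (n + N - 1) x := fun x => by
    simp only [hg, zero_add, one_mul]; exact opoly_per _ _ _ _ _ (by omega) _
  have hh0 : ∀ x, h 0 x = opoly a b (n + N) x := fun x => by
    simp only [hh, zero_add, one_mul]; exact opoly_per _ _ _ _ _ (by omega) _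
  have hphi : ∀ x ∈ Set.Icc s t, ‖phiC (Y x) (Real.sqrt α * opoly a b (n + N - 1) x)
      (Real.sqrt α * opoly a b (n + N) x)‖ ^ 2 = α * (Y x 1 0 * D x) := by
    intro x hx
    rw [phiC_normSq _ (hd x hx).le, ← hg0, ← hh0, ← hDl 0 x, (hrec 0 x).1, (hrec 0 x).2]
    have := Real.mul_self_sqrt hα0.le
    linear_combination (Y x 1 0 * (g 0 x * (Y x 1 0 * g 0 x + Y x 1 1 * h 0 x) - h 0 x * (Y x 0 0 * g 0 x + Y x 0 1 * h 0 x))) * this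
  have hYD : ∀ x ∈ Set.Icc s t, 0 < Y x 1 0 * D x := by
    intro x hx
    have h1 := norm_pos_iff.mpr (limG_psi_ne a b ha N n hN x (hd x hx))
    have h2 := hphi x hx
    have h3 : 0 < α * (Y x 1 0 * D x) := by rw [← h2]; positivity
    exact (mul_pos_iff_of_pos_left hα0).mp h3
  have hD0 : ∀ x ∈ Set.Icc s t, D x ≠ 0 := fun x hx h0 => by
    have := hYD x hx; rw [h0, mul_zero] at this; exact lt_irrefl _ this
  have hlim : ∀ x ∈ Set.Icc s t, limG a b N n x = 1 / (π * α) * (Real.sqrt (-discr (Y x)) / (2 * |D x|)) := by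
    intro x hx
    unfold limG wfun
    rw [hphi x hx, ← abs_of_pos (hYD x hx), abs_mul]
    have h1 : |D x| ≠ 0 := abs_ne_zero.mpr (hD0 x hx)
    have h2 : |Y x 1 0| ≠ 0 := abs_ne_zero.mpr fun h0 => by
      have := hYD x hx; rw [h0, zero_mul] at this; exact lt_irrefl _ this
    have h3 := Real.pi_pos.ne'
    rw [← hY]
    field_simp
  have hpt : ∀ᵐ x ∂(volume.restrict (Set.Icc s t)), Tendsto (fun L => |avgD a b N n L x - limG a b N n x|) atTop (𝓝 0) := by
    rw [ae_restrict_iff' measurableSet_Icc]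
    filter_upwards [bad_null a' b' hpos (n + N) N hN] with x hx hxS
    have key := (avg_matrix (Y x) (tY_det a b ha N n hN hn x) (hd x hxS) (fun l => g l x) (fun l => h l x)
      (fun l => (hrec l x).1) (fun l => (hrec l x).2) (hD0 x hxS) hx).const_mul (1 / (π * α))
    have k2 : Tendsto (fun L => avgD a b N n L x) atTop (𝓝 (limG a b N n x)) := by
      rw [hlim x hxS]
      refine key.congr fun L => ?_
      unfold avgD
      rw [mul_left_comm, Finset.mul_sum]
      congr 1
      exact Finset.sum_congr rfl fun l _ => (hcarm l x).symm
    have k3 := (k2.sub_const (limG a b N n x)).abs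
    simpa using k3
  have hDc : Continuous D := by
    simp only [hD, hg, hh]
    exact ((opoly_cont _ _ _).mul (opoly_cont _ _ _)).sub ((opoly_cont _ _ _).mul (opoly_cont _ _ _))
  obtain ⟨B, hB0, hB⟩ : ∃ B : ℝ, 0 ≤ B ∧ ∀ x ∈ Set.Icc s t, ∀ l, carm a' b' (n + (l + 1) * N - 1) x ≤ B := by
    set q : ℝ → ℝ := fun x => 1 / (π * α) * ((|Y x 1 0| + |Y x 1 1| + |Y x 0 0| + |Y x 0 1|) / |D x|) with hq
    have hqc : ContinuousOn q (Set.Icc s t) := by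
      refine continuousOn_const.mul (ContinuousOn.div ?_ hDc.abs.continuousOn fun x hx => abs_ne_zero.mpr (hD0 x hx))
      exact ((((tY_cont a b N n 1 0).abs.add (tY_cont a b N n 1 1).abs).add (tY_cont a b N n 0 0).abs).add
        (tY_cont a b N n 0 1).abs).continuousOn
    obtain ⟨B, hB⟩ := isCompact_Icc.exists_bound_of_continuousOn hqc
    refine ⟨max B 0, le_max_right _ _, fun x hx l => ?_⟩
    refine le_trans ?_ ((le_abs_self _).trans ((hB x hx).trans (le_max_left _ _)))
    rw [hcarm]
    simp only [hq]
    have hDp : 0 < |D x| := abs_pos.mpr (hD0 x hx)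
    refine mul_le_mul_of_nonneg_left ?_ (by positivity)
    rw [div_le_div_iff₀ (hgh l x) hDp, one_mul, ← hDl l x, (hrec l x).1, (hrec l x).2]
    generalize g l x = p
    generalize h l x = r
    generalize Y x 0 0 = A
    generalize Y x 0 1 = B
    generalize Y x 1 0 = C
    generalize Y x 1 1 = E
    have e : p * (C * p + E * r) - r * (A * p + B * r) = C * p ^ 2 + E * (p * r) + -(A * (p * r)) + -(B * r ^ 2) := by ring
    rw [e]
    have hpr : |p * r| ≤ p ^ 2 + r ^ 2 := by
      rw [abs_le]; constructor <;> nlinarith [sq_nonneg (p + r), sq_nonneg (p - r)]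
    refine (abs_add_le _ _).trans ((add_le_add ((abs_add_le _ _).trans (add_le_add (abs_add_le _ _) le_rfl)) le_rfl).trans ?_)
    rw [abs_neg, abs_neg, abs_mul C, abs_mul E, abs_mul A, abs_mul B, abs_of_nonneg (sq_nonneg p), abs_of_nonneg (sq_nonneg r)]
    have i1 := mul_le_mul_of_nonneg_left hpr (abs_nonneg E)
    have i2 := mul_le_mul_of_nonneg_left hpr (abs_nonneg A)
    nlinarith [mul_nonneg (abs_nonneg C) (sq_nonneg r), mul_nonneg (abs_nonneg B) (sq_nonneg p)]
  have hLc := limG_cont a b ha N n hN (Set.Icc s t) hd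
  have hLi : IntegrableOn (fun x => B + |limG a b N n x|) (Set.Icc s t) :=
    (continuousOn_const.add hLc.abs).integrableOn_Icc
  have := tendsto_integral_of_dominated_convergence (μ := volume.restrict (Set.Icc s t))
    (F := fun L x => |avgD a b N n L x - limG a b N n x|) (f := fun _ => (0 : ℝ)) (fun x => B + |limG a b N n x|)
    (fun L => (((avgD_cont a b ha N n L).continuousOn.sub hLc).abs.aestronglyMeasurable measurableSet_Icc))
    hLi (fun L => by
      rw [ae_restrict_iff' measurableSet_Icc]
      refine Eventually.of_forall fun x hx => ?_
      rw [Real.norm_eq_abs, abs_abs]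
      refine (abs_sub _ _).trans (add_le_add ?_ le_rfl)
      rw [abs_of_nonneg (avgD_nonneg a b ha N n L x)]
      unfold avgD
      have hs : ∑ l ∈ Finset.range L, carm a' b' (n + (l + 1) * N - 1) x ≤ L * B := by
        refine (Finset.sum_le_sum fun l _ => hB x hx l).trans ?_
        simp
      rcases Nat.eq_zero_or_pos L with rfl | hL
      · simpa using hB0
      · have hL' : (0 : ℝ) < L := by exact_mod_cast hL
        rw [inv_mul_le_iff₀ hL']; exact hs)
    hpt
  simpa using this



lemma limG_tendsto (N : ℕ) (hN : 0 < N) (a b : ℕ → ℝ) (ha : ∀ n, 0 < a n) (i : ℕ) (u v s t : ℝ)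
    (hratio : Tendsto (fun j : ℕ => a ((j + 1) * N + i - 1) / a (j * N + i - 1)) atTop (𝓝 1))
    (σ R C : ℝ) (hσ : 0 < σ) (hR : 0 < R) (hC : 0 < C) (M : ℕ) (hM : 1 ≤ M) (Y : ℝ → Mat2)
    (hYG : ∀ x ∈ Set.Icc s t, Good σ R (Y x) ∧ (Y x).det = 1)
    (hYc : ∀ r c, ContinuousOn (fun x => Y x r c) (Set.Icc s t))
    (hG : ∀ k ≥ M, ∀ x ∈ Set.Icc s t, Good σ R (Xmat a b N (k * N + i) x))
    (hXY : ∀ k : ℕ, ∀ x ∈ Set.Icc s t, ∀ r c, |Xmat a b N (k * N + i) x r c - Y x r c| ≤ C * tailT a b N i u v k)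
    (ψ : ℝ → ℂ) (hψc : ContinuousOn ψ (Set.Icc s t)) (hψ0 : ∀ x ∈ Set.Icc s t, ψ x ≠ 0) (C' : ℝ) (hC' : 0 < C')
    (hψ : ∀ k ≥ M, ∀ x ∈ Set.Icc s t,
      ‖phiC (Xmat a b N (k * N + i) x) (uP a b N i k x) (uQ a b N i k x) -
        ψ x * ∏ j ∈ Finset.Ico M k, lamC (Xmat a b N (j * N + i) x)‖ ≤ C' * tailT a b N i u v k) :
    ∃ M' ≥ M, (∀ k ≥ M', ∀ x ∈ Set.Icc s t, discr (tY a b N (k * N + i) x) < 0) ∧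
      Tendsto (fun k => ∫ x in Set.Icc s t, |limG a b N (k * N + i) x - wfun Y ψ x|) atTop (𝓝 0) := by
  set τ := tailT a b N i u v with hτ
  have hτ0 : Tendsto τ atTop (𝓝 0) := tailT_tendsto a b N i u v
  have hτ1 : Tendsto (fun k => τ (k + 1)) atTop (𝓝 0) := hτ0.comp (tendsto_add_atTop_nat 1)
  have hτn : ∀ k, 0 ≤ τ k := tailT_nonneg a b N i u v
  set ρ : ℕ → ℝ := fun j => a ((j + 1) * N + i - 1) / a (j * N + i - 1) with hρ
  have hρ1 : Tendsto (fun k => |ρ k - 1|) atTop (𝓝 0) := by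
    have := (hratio.sub_const 1).abs
    simpa using this
  set Δ : ℕ → ℝ := fun k => R * |ρ k - 1| + C * τ k + C * τ (k + 1) with hΔ
  have hΔ0 : Tendsto Δ atTop (𝓝 0) := by
    have := ((hρ1.const_mul R).add (hτ0.const_mul C)).add (hτ1.const_mul C)
    simpa using this
  have hn1 : ∀ k ≥ M, 1 ≤ k * N + i := fun k hk => by
    have : 1 ≤ k * N := Nat.mul_pos (by omega) hN
    omega
  have hnN : ∀ k, k * N + i + N = (k + 1) * N + i := fun k => by ring
  -- entries of the period matrix
  have hE : ∀ k ≥ M, ∀ x ∈ Set.Icc s t, ∀ r c,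
      |tY a b N (k * N + i) x r c - Xmat a b N (k * N + i) x r c| ≤ R * |ρ k - 1| := by
    intro k hk x hx r c
    obtain ⟨h0, h1⟩ := tY_entries a b ha N (k * N + i) hN (hn1 k hk) x r
    rw [hnN k] at h0
    fin_cases c
    · change |tY a b N (k * N + i) x r 0 - Xmat a b N (k * N + i) x r 0| ≤ _
      rw [h0]
      change |Xmat a b N (k * N + i) x r 0 * ρ k - Xmat a b N (k * N + i) x r 0| ≤ _
      rw [show Xmat a b N (k * N + i) x r 0 * ρ k - Xmat a b N (k * N + i) x r 0 =
        Xmat a b N (k * N + i) x r 0 * (ρ k - 1) by ring, abs_mul]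
      exact mul_le_mul_of_nonneg_right ((hG k hk x hx).2.1 r 0) (abs_nonneg _)
    · change |tY a b N (k * N + i) x r 1 - Xmat a b N (k * N + i) x r 1| ≤ _
      rw [h1, sub_self, abs_zero]; positivity
  have hEY : ∀ k ≥ M, ∀ x ∈ Set.Icc s t, ∀ r c, |tY a b N (k * N + i) x r c - Y x r c| ≤ Δ k := by
    intro k hk x hx r c
    have h1 := hE k hk x hx r c
    have h2 := hXY k x hx r c
    have h3 := abs_sub_le (tY a b N (k * N + i) x r c) (Xmat a b N (k * N + i) x r c) (Y x r c)
    have h4 : 0 ≤ C * τ (k + 1) := mul_nonneg hC.le (hτn _)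
    simp only [hΔ]; linarith
  have hEX : ∀ k ≥ M, ∀ x ∈ Set.Icc s t, ∀ r c,
      |tY a b N (k * N + i) x r c - Xmat a b N ((k + 1) * N + i) x r c| ≤ Δ k := by
    intro k hk x hx r c
    have h1 := hE k hk x hx r c
    have h2 := hXY k x hx r c
    have h2' := hXY (k + 1) x hx r c
    rw [abs_sub_comm] at h2'
    have h3 := abs_sub_le (tY a b N (k * N + i) x r c) (Xmat a b N (k * N + i) x r c) (Xmat a b N ((k + 1) * N + i) x r c)
    have h4 := abs_sub_le (Xmat a b N (k * N + i) x r c) (Y x r c) (Xmat a b N ((k + 1) * N + i) x r c)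
    simp only [hΔ]; linarith
  have hmono : ∀ A : Mat2, Good σ R A → Good (σ / 2) (2 * R) A := fun A h =>
    ⟨by linarith [h.1], fun r c => (h.2.1 r c).trans (by linarith), h.2.2⟩
  -- goodness of the period matrix
  have hev : ∀ᶠ k in atTop, M ≤ k ∧ ∀ x ∈ Set.Icc s t, Good (σ / 2) (2 * R) (tY a b N (k * N + i) x) := by
    have h1 : ∀ᶠ k in atTop, Δ k < R := hΔ0.eventually_lt_const hR
    have h2 : ∀ᶠ k in atTop, Δ k < σ / (64 * R) := hΔ0.eventually_lt_const (by positivity)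
    filter_upwards [h1, h2, eventually_ge_atTop M] with k hk1 hk2 hk
    refine ⟨hk, fun x hx => ?_⟩
    have hb : ∀ r c, |tY a b N (k * N + i) x r c| ≤ 2 * R := by
      intro r c
      have e1 := hEY k hk x hx r c
      have e2 := (hYG x hx).1.2.1 r c
      have e3 := abs_sub_abs_le_abs_sub (tY a b N (k * N + i) x r c) (Y x r c)
      linarith
    have hd := tY_det a b ha N (k * N + i) hN (hn1 k hk) x
    refine ⟨?_, hb, by rw [hd]; norm_num, by rw [hd]; norm_num⟩
    have e4 := discr_lip hb (hmono _ (hYG x hx).1).2.1 (hEY k hk x hx)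
    have e5 : 16 * (2 * R) * Δ k ≤ σ / 2 := by
      have : 16 * (2 * R) * (σ / (64 * R)) = σ / 2 := by field_simp; norm_num
      rw [← this]; gcongr
    have e6 := (hYG x hx).1.1
    have := (abs_le.mp (e4.trans e5)).2
    linarith
  obtain ⟨M', hM'⟩ := eventually_atTop.mp hev
  have hσ2 : 0 < σ / 2 := by positivity
  refine ⟨max M M', le_max_left _ _, fun k hk x hx => ?_, ?_⟩
  · have := ((hM' k (le_of_max_le_right hk)).2 x hx).1
    linarith
  -- norms
  set Φ : ℕ → ℝ → ℂ := fun k x => phiC (tY a b N (k * N + i) x) (uP a b N i (k + 1) x) (uQ a b N i (k + 1) x) with hΦ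
  have hlimG : ∀ k x, limG a b N (k * N + i) x =
      |tY a b N (k * N + i) x 1 0| * Real.sqrt (-discr (tY a b N (k * N + i) x)) / (2 * π * ‖Φ k x‖ ^ 2) := by
    intro k x
    simp only [limG, wfun, hnN k, hΦ, uP, uQ]
  obtain ⟨Ψ, hΨ⟩ := isCompact_Icc.exists_bound_of_continuousOn hψc
  obtain ⟨m, hm0, hm⟩ : ∃ m > 0, ∀ x ∈ Set.Icc s t, m ≤ ‖ψ x‖ := by
    obtain ⟨B, hB⟩ := isCompact_Icc.exists_bound_of_continuousOn (hψc.inv₀ hψ0)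
    refine ⟨1 / max B 1, by positivity, fun x hx => ?_⟩
    have h1 := hB x hx
    have h2 : 0 < ‖ψ x‖ := norm_pos_iff.mpr (hψ0 x hx)
    rw [Pi.inv_apply, norm_inv] at h1
    rw [one_div_le (by positivity) h2, one_div]
    exact h1.trans (le_max_left _ _)
  set c1 := 1 + 8 * (2 * R) / Real.sqrt (σ / 2) with hc1
  set c2 := 4 * R / σ * (1 + 2 * R / Real.sqrt σ) + 2 / Real.sqrt σ with hc2
  have hc1p : 0 ≤ c1 := by positivity
  have hc2p : 0 ≤ c2 := by positivity
  set E : ℕ → ℝ := fun k => c1 * Δ k * (c2 * (Ψ + C' * τ (k + 1))) + C' * τ (k + 1) with hEd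
  have hE0 : Tendsto E atTop (𝓝 0) := by
    have h1 : Tendsto (fun k => C' * τ (k + 1)) atTop (𝓝 (C' * 0)) := hτ1.const_mul C'
    have h2 := (((hΔ0.const_mul c1).mul ((h1.const_add Ψ).const_mul c2))).add h1
    simpa using h2
  have hnorm : ∀ k ≥ max M M', ∀ x ∈ Set.Icc s t, |‖Φ k x‖ - ‖ψ x‖| ≤ E k := by
    intro k hk x hx
    have hkM := le_of_max_le_left hk
    have hgt := (hM' k (le_of_max_le_right hk)).2 x hx
    have hgX := hG (k + 1) (by omega) x hx
    set p := uP a b N i (k + 1) x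
    set q := uQ a b N i (k + 1) x
    set φ := phiC (Xmat a b N ((k + 1) * N + i) x) p q with hφ
    have h1 : ‖Φ k x - φ‖ ≤ c1 * Δ k * (|p| + |q|) := phiC_lip hσ2 hgt (hmono _ hgX) (hEX k hkM x hx) p q
    have h2 : |p| + |q| ≤ c2 * ‖φ‖ := phiC_lower hσ hgX p q
    have h3 := hψ (k + 1) (by omega) x hx
    have hprod : ‖∏ j ∈ Finset.Ico M (k + 1), lamC (Xmat a b N (j * N + i) x)‖ = 1 := by
      rw [norm_prod]
      refine Finset.prod_eq_one fun j hj => ?_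
      have hgj := hG j (Finset.mem_Ico.mp hj).1 x hx
      exact lamC_norm _ (by linarith [hgj.1]) (by linarith [hgj.2.2.1])
    have h4 : |‖φ‖ - ‖ψ x‖| ≤ C' * τ (k + 1) := by
      have := (abs_norm_sub_norm_le _ _).trans h3
      rwa [norm_mul, hprod, mul_one] at this
    have h5 : ‖φ‖ ≤ Ψ + C' * τ (k + 1) := by linarith [(abs_le.mp h4).2, hΨ x hx]
    have hΔn : 0 ≤ Δ k := (abs_nonneg _).trans (hEX k hkM x hx 0 0)
    have h6 : c1 * Δ k * (|p| + |q|) ≤ c1 * Δ k * (c2 * (Ψ + C' * τ (k + 1))) :=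
      mul_le_mul_of_nonneg_left (h2.trans (mul_le_mul_of_nonneg_left h5 hc2p)) (by positivity)
    have h7 := (abs_norm_sub_norm_le (Φ k x) φ).trans (h1.trans h6)
    have h8 := abs_sub_le ‖Φ k x‖ ‖φ‖ ‖ψ x‖
    simp only [hEd]; linarith
  have hwc := wfun_cont hYc hψc hψ0
  have hev2 : ∀ᶠ k in atTop, max M M' ≤ k ∧ E k < m / 2 :=
    (eventually_ge_atTop _).and (hE0.eventually_lt_const (by positivity))
  have := tendsto_integral_filter_of_dominated_convergence (μ := volume.restrict (Set.Icc s t)) (l := atTop)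
    (F := fun (k : ℕ) x => |limG a b N (k * N + i) x - wfun Y ψ x|) (f := fun _ => (0 : ℝ))
    (fun x => 2 * R * 2 / (2 * π * (m / 2) ^ 2) + |wfun Y ψ x|) ?_ ?_ ?_ ?_
  · simpa using this
  · filter_upwards [hev2] with k hk
    refine ContinuousOn.aestronglyMeasurable ?_ measurableSet_Icc
    refine ((limG_cont a b ha N (k * N + i) hN _ fun x hx => ?_).sub hwc).abs
    have := ((hM' k (le_of_max_le_right hk.1)).2 x hx).1
    linarith
  · filter_upwards [hev2] with k hk
    rw [ae_restrict_iff' measurableSet_Icc]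
    refine Eventually.of_forall fun x hx => ?_
    rw [Real.norm_eq_abs, abs_abs]
    refine (abs_sub _ _).trans (add_le_add ?_ le_rfl)
    have hgt := (hM' k (le_of_max_le_right hk.1)).2 x hx
    have hlow : m / 2 ≤ ‖Φ k x‖ := by
      have := (abs_le.mp (hnorm k hk.1 x hx)).1
      linarith [hm x hx, hk.2]
    have hs : Real.sqrt (-discr (tY a b N (k * N + i) x)) ≤ 2 := by
      rw [Real.sqrt_le_left (by norm_num)]
      have hd := tY_det a b ha N (k * N + i) hN (hn1 k (le_of_max_le_left hk.1)) x
      unfold discr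
      rw [hd]
      nlinarith [sq_nonneg (Matrix.trace (tY a b N (k * N + i) x))]
    have hb := hgt.2.1 1 0
    have hpos : 0 ≤ limG a b N (k * N + i) x := by rw [hlimG]; positivity
    rw [abs_of_nonneg hpos, hlimG]
    gcongr
  · exact (continuousOn_const.add hwc.abs).integrableOn_Icc
  · rw [ae_restrict_iff' measurableSet_Icc]
    refine Eventually.of_forall fun x hx => ?_
    have hent : ∀ r c, Tendsto (fun k => tY a b N (k * N + i) x r c) atTop (𝓝 (Y x r c)) := by
      intro r c
      rw [tendsto_iff_norm_sub_tendsto_zero]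
      refine squeeze_zero' (Eventually.of_forall fun k => norm_nonneg _) ?_ hΔ0
      filter_upwards [eventually_ge_atTop M] with k hk
      exact hEY k hk x hx r c
    have hnt : Tendsto (fun k => ‖Φ k x‖) atTop (𝓝 ‖ψ x‖) := by
      rw [tendsto_iff_norm_sub_tendsto_zero]
      refine squeeze_zero' (Eventually.of_forall fun k => norm_nonneg _) ?_ hE0
      filter_upwards [eventually_ge_atTop (max M M')] with k hk
      exact hnorm k hk x hx
    have hdt : Tendsto (fun k => discr (tY a b N (k * N + i) x)) atTop (𝓝 (discr (Y x))) := by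
      simp only [discr_eq]
      exact (((hent 0 0).sub (hent 1 1)).pow 2).add (((hent 0 1).const_mul 4).mul (hent 1 0))
    have hψn : 2 * π * ‖ψ x‖ ^ 2 ≠ 0 := by
      have : 0 < ‖ψ x‖ := norm_pos_iff.mpr (hψ0 x hx)
      positivity
    have hfin : Tendsto (fun k => limG a b N (k * N + i) x) atTop (𝓝 (wfun Y ψ x)) := by
      simp only [hlimG, wfun]
      exact ((hent 1 0).abs.mul ((Real.continuous_sqrt.tendsto _).comp hdt.neg)).div ((hnt.pow 2).const_mul (2 * π)) hψn
    have := (hfin.sub_const (wfun Y ψ x)).abs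
    simpa using this

lemma measure_exists (N : ℕ) (hN : 0 < N) (a b : ℕ → ℝ) (ha : ∀ n, 0 < a n) (i : ℕ) (u v s t : ℝ)
    (hsu : s < u) (hvt : v < t) (M' : ℕ)
    (hM : 1 ≤ M') (hd : ∀ k ≥ M', ∀ x ∈ Set.Icc s t, discr (tY a b N (k * N + i) x) < 0) (w : ℝ → ℝ)
    (hw : ContinuousOn w (Set.Icc s t)) (hw0 : ∀ x ∈ Set.Icc s t, 0 ≤ w x)
    (hlim : Tendsto (fun k => ∫ x in Set.Icc s t, |limG a b N (k * N + i) x - w x|) atTop (𝓝 0)) :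
    ∃ ν : Measure ℝ, IsProbabilityMeasure ν ∧
      (∀ n m : ℕ, ∫ x, opoly a b n x * opoly a b m x ∂ν = if n = m then 1 else 0) ∧
      ν.restrict (Set.Icc u v) =
          (volume.restrict (Set.Icc u v)).withDensity (fun x => ENNReal.ofReal (w x)) := by
  have hkN : ∀ k, k ≤ k * N := fun k => Nat.le_mul_of_pos_right _ hN
  have hch : ∀ k : ℕ, ∃ L : ℕ, 1 ≤ L ∧
      ∫ x in Set.Icc s t, |avgD a b N ((k + M') * N + i) L x - limG a b N ((k + M') * N + i) x| < 1 / ((k : ℝ) + 1) := by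
    intro k
    have h1 := hkN (k + M')
    have := avgD_tendsto a b ha N ((k + M') * N + i) hN (by omega) s t (hd (k + M') (by omega))
    have h2 := (this.eventually_lt_const (by positivity : (0 : ℝ) < 1 / ((k : ℝ) + 1))).and (eventually_ge_atTop 1)
    obtain ⟨L, hL⟩ := h2.exists
    exact ⟨L, hL.2, hL.1⟩
  choose L hL1 hL using hch
  refine limit_measure a b ha (fun k => avgD a b N ((k + M') * N + i) (L k)) (fun k => avgD_cont a b ha _ _ _)
    (fun k => avgD_nonneg a b ha _ _ _) (fun k => ?_) s u v t hsu hvt w hw hw0 ?_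
  · have h := avgD_ortho a b ha N ((k + M') * N + i) (L k) hN (hL1 k)
    have h1 := hkN (k + M')
    intro j hj l hl
    exact h j (by omega) l (by omega)
  · have h1 : Tendsto (fun k : ℕ => 1 / ((k : ℝ) + 1) + ∫ x in Set.Icc s t, |limG a b N ((k + M') * N + i) x - w x|) atTop (𝓝 0) := by
      have := (tendsto_one_div_add_atTop_nhds_zero_nat (𝕜 := ℝ)).add (hlim.comp (tendsto_add_atTop_nat M'))
      simpa using this
    refine squeeze_zero (fun k => integral_nonneg fun x => abs_nonneg _) (fun k => ?_) h1
    have hc1 := limG_cont a b ha N ((k + M') * N + i) hN (Set.Icc s t) (hd (k + M') (by omega))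
    have hc2 := (avgD_cont a b ha N ((k + M') * N + i) (L k)).continuousOn (s := Set.Icc s t)
    refine le_trans ?_ (add_le_add (hL k).le le_rfl)
    have i1 : IntegrableOn (fun x => |avgD a b N ((k + M') * N + i) (L k) x - limG a b N ((k + M') * N + i) x|)
        (Set.Icc s t) := (hc2.sub hc1).abs.integrableOn_Icc
    have i2 : IntegrableOn (fun x => |limG a b N ((k + M') * N + i) x - w x|) (Set.Icc s t) :=
      (hc1.sub hw).abs.integrableOn_Icc
    have i3 : IntegrableOn (fun x => |avgD a b N ((k + M') * N + i) (L k) x - w x|) (Set.Icc s t) :=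
      (hc2.sub hw).abs.integrableOn_Icc
    rw [← integral_add i1 i2]
    refine setIntegral_mono_on i3 (i1.add i2) measurableSet_Icc fun x _ => ?_
    exact abs_sub_le _ _ _


/-- Theorem 14 of the paper. Quantitative asymptotics of the orthonormal
polynomials in the `𝒟_1` setting. -/
theorem polynomial_asymptotics_D1
    (N : ℕ) (hN : 0 < N) (a b : ℕ → ℝ) (ha : ∀ n, 0 < a n)
    (i : ℕ) (hi : i < N) (u v : ℝ) (huv : u < v)
    (hΛ : ∀ x ∈ Set.Icc u v, ∃ d < (0 : ℝ),
      Tendsto (fun j : ℕ => discr (Xmat a b N (j * N + i) x)) atTop (𝓝 d))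
    (hratio : Tendsto (fun j : ℕ => a ((j + 1) * N + i - 1) / a (j * N + i - 1))
      atTop (𝓝 1))
    (hbdd : ∃ C, ∀ j : ℕ, ∀ x ∈ Set.Icc u v, ‖Xmat a b N (j * N + i) x‖ ≤ C)
    (hinv : ∀ j : ℕ, ∀ x ∈ Set.Icc u v, IsUnit (Xmat a b N (j * N + i) x))
    (hD1 : Summable fun j : ℕ =>
      ⨆ x : Set.Icc u v, ‖Xmat a b N ((j + 1) * N + i) (x : ℝ) - Xmat a b N (j * N + i) (x : ℝ)‖)
    (XX : ℝ → Mat2)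
    (hXX : TendstoUniformlyOn (fun j x => Xmat a b N (j * N + i) x) XX atTop (Set.Icc u v)) :
    ∃ ν : Measure ℝ, IsProbabilityMeasure ν ∧
      (∀ n m : ℕ, ∫ x, opoly a b n x * opoly a b m x ∂ν = if n = m then 1 else 0) ∧
      ∃ w : ℝ → ℝ, ContinuousOn w (Set.Icc u v) ∧ (∀ x ∈ Set.Icc u v, 0 < w x) ∧
        ν.restrict (Set.Icc u v) =
          (volume.restrict (Set.Icc u v)).withDensity (fun x => ENNReal.ofReal (w x)) ∧
        ∃ c > 0, ∃ M : ℕ, ∃ η : ℝ → ℝ, ContinuousOn η (Set.Icc u v) ∧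
          ∀ k ≥ M, ∀ x ∈ Set.Icc u v,
            discr (Xmat a b N (k * N + i) x) < 0 ∧
            |Real.sqrt (a ((k + 1) * N + i - 1)) * opoly a b (k * N + i) x -
                Real.sqrt (2 * |XX x 1 0| / (π * w x * Real.sqrt (-discr (XX x)))) *
                  Real.sin ((∑ j ∈ Finset.Icc (M + 1) k, thetaf a b N (j * N + i) x) + η x)| ≤
              c * ∑' m : ℕ, ⨆ y : Set.Icc u v,
                ‖Xmat a b N ((k + m + 1) * N + i) (y : ℝ) -
                  Xmat a b N ((k + m) * N + i) (y : ℝ)‖ := by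
  have hD1' : Summable (incr a b N i u v) := hD1
  obtain ⟨δ, hδ, σ, hσ, R, hR, C, hC, M, hM, Y, hYX, hYG, hG, hYc, hinc, hXY⟩ :=
    setup_lemma N hN a b ha i u v huv hΛ hratio hbdd hD1' XX hXX
  obtain ⟨ψ, hψc, hψ0, C', hC', hψ⟩ := psi_concrete N hN a b ha i u v hD1' (Set.Icc (u - δ) (v + δ))
    isCompact_Icc σ R C hσ hR hC M hM hG hinc
  obtain ⟨M', hM', hdis, hlim⟩ := limG_tendsto N hN a b ha i u v (u - δ) (v + δ) hratio σ R C hσ hR hC M hM Y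
    hYG hYc hG hXY ψ hψc hψ0 C' hC' hψ
  have hwc := wfun_cont hYc hψc hψ0
  have hwp : ∀ x ∈ Set.Icc (u - δ) (v + δ), 0 < wfun Y ψ x := fun x hx => wfun_pos hσ (hYG x hx).1 (hψ0 x hx)
  obtain ⟨ν, hν, hort, hres⟩ := measure_exists N hN a b ha i u v (u - δ) (v + δ) (by linarith) (by linarith) M'
    (by omega) hdis (wfun Y ψ) hwc (fun x hx => (hwp x hx).le) hlim
  have hsub : Set.Icc u v ⊆ Set.Icc (u - δ) (v + δ) := Set.Icc_subset_Icc (by linarith) (by linarith)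
  obtain ⟨c, hc, η, hη, hest⟩ := asymp_final N hN a b ha i u v huv σ R C hσ hR hC M hM Y
    (fun x hx => hYG x (hsub hx)) (fun r c => (hYc r c).mono hsub) (fun k hk x hx => hG k hk x (hsub hx))
    (fun k x hx => hXY k x (hsub hx)) ψ (hψc.mono hsub) (fun x hx => hψ0 x (hsub hx)) C' hC'
    (fun k hk x hx => hψ k hk x (hsub hx))
  refine ⟨ν, hν, hort, wfun Y ψ, hwc.mono hsub, fun x hx => hwp x (hsub hx), hres, c, hc, M, η, hη, ?_⟩
  intro k hk x hx
  refine ⟨by linarith [(hG k hk x (hsub hx)).1], ?_⟩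
  have := hest k hk x hx
  rw [hYX x hx] at this
  exact this
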